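/- Let n ≥ 2 and let p₁,…,p_ℓ ∈ ℤ[t₁^{±1},…,t_n^{±1}]. Then there exists a constant C = C(p₁,…,p_ℓ) such that for every k ∈ ℤⁿ with ⟨k⟩ > C there exist a (possibly empty) product φ of cyclotomic polynomials and a unit u of ℤ[t^{±1}] with gcd(τ_k(p₁),…,τ_k(p_ℓ)) = u · φ · τ_k(gcd(p₁,…,p_ℓ)). -/

import Mathlib

noncomputable section

abbrev RL (n : ℕ) : Type := AddMonoidAlgebra ℤ (Fin n → ℤ)

def IsGCDOf {α : Type*} [CommRing α] (d : α) (S : Set α) : Prop :=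
  (∀ s ∈ S, d ∣ s) ∧ ∀ e : α, (∀ s ∈ S, e ∣ s) → e ∣ d

/-- the group homomorphism `ℤⁿ → ℤ`, `m ↦ m·k`. -/
def dotHom {n : ℕ} (k : Fin n → ℤ) : (Fin n → ℤ) →+ ℤ where
  toFun m := ∑ i, m i * k i
  map_zero' := by simp
  map_add' x y := by
    simp [add_mul, Finset.sum_add_distrib]

/-- the ring homomorphism `τ_k : ℤ[t₁^{±1},…,t_n^{±1}] → ℤ[t^{±1}]`, `t^m ↦ t^{m·k}`. -/
def tau {n : ℕ} (k : Fin n → ℤ) : RL n →+* LaurentPolynomial ℤ :=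
  AddMonoidAlgebra.mapDomainRingHom ℤ (dotHom k)

/-- `⟨k⟩`: the minimal Euclidean norm of a nonzero integer vector orthogonal to `k`. -/
def gaugeVec {n : ℕ} (k : Fin n → ℤ) : ℝ :=
  sInf {r : ℝ | ∃ m : Fin n → ℤ, m ≠ 0 ∧ (∑ i, m i * k i) = 0 ∧
    r = Real.sqrt (∑ i, ((m i : ℝ)) ^ 2)}

section

open scoped AddMonoidAlgebra
open Filter

section

open Height AdmissibleAbsValues in
theorem one_le_pow_totalWeight_mul_zpow_mulHeight₁ {K : Type*} [Field K] [AdmissibleAbsValues K]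
    {α k : K} (hk : k ≠ 0) {a b : ℤ} {c : ℝ}
    (harch : ∀ v ∈ archAbsVal (K := K), v k ≤ c * (max (v α) 1 ^ a * max (v α⁻¹) 1 ^ b))
    (hnon : ∀ v ∈ nonarchAbsVal (K := K), v k ≤ max (v α) 1 ^ a * max (v α⁻¹) 1 ^ b) :
    1 ≤ c ^ totalWeight K * mulHeight₁ α ^ (a + b) := by
  have hfin (x : K) : (fun v : nonarchAbsVal (K := K) ↦ max (v.val x) 1).HasFiniteMulSupport := by
    rcases eq_or_ne x 0 with rfl | hx
    · simp [Function.HasFiniteMulSupport]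
    · have := hasFiniteMulSupport hx
      fun_prop
  have hz (f : nonarchAbsVal (K := K) → ℝ) (hf : f.HasFiniteMulSupport) (n : ℤ) :
      (fun v ↦ f v ^ n).HasFiniteMulSupport := by
    refine hf.subset ?_
    intro v hv h
    exact hv (by simp [h])
  have hfz (f : nonarchAbsVal (K := K) → ℝ) (hf : f.HasFiniteMulSupport) (n : ℤ) :
      ∏ᶠ v, f v ^ n = (∏ᶠ v, f v) ^ n := by
    have hs : (Function.mulSupport f) ⊆ ↑(Set.Finite.toFinset hf) :=
      (Set.Finite.coe_toFinset _).ge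
    rw [finprod_eq_prod_of_mulSupport_subset _ hs, finprod_eq_prod_of_mulSupport_subset (s :=
      Set.Finite.toFinset hf), Finset.prod_zpow]
    intro v hv
    refine hs fun h ↦ hv ?_
    simp [h]
  have hmz (f : AbsoluteValue K ℝ → ℝ) (n : ℤ) :
      ((archAbsVal (K := K)).map fun v ↦ f v ^ n).prod = ((archAbsVal (K := K)).map f).prod ^ n := by
    exact Multiset.prod_map_zpow
  have h1 : (archAbsVal.map (· k)).prod ≤ c ^ totalWeight K *
      ((archAbsVal.map fun v ↦ max (v α) 1).prod ^ a *
        (archAbsVal.map fun v ↦ max (v α⁻¹) 1).prod ^ b) := by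
    refine (Multiset.prod_map_le_prod_map₀ _ _ (fun v _ ↦ v.nonneg k) harch).trans_eq ?_
    rw [Multiset.prod_map_mul, Multiset.prod_map_mul, hmz, hmz]
    simp [totalWeight]
  have h2 : ∏ᶠ v : nonarchAbsVal, v.val k ≤
      (∏ᶠ v : nonarchAbsVal, max (v.val α) 1) ^ a *
        (∏ᶠ v : nonarchAbsVal, max (v.val α⁻¹) 1) ^ b := by
    rw [← hfz _ (hfin _), ← hfz _ (hfin _), ← finprod_mul_distrib (hz _ (hfin _) _)
      (hz _ (hfin _) _)]
    refine finprod_le_finprod (hasFiniteMulSupport hk) (fun v ↦ v.val.nonneg k)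
      (Function.HasFiniteMulSupport.mul (hz _ (hfin _) _) (hz _ (hfin _) _)) fun v ↦ hnon v.1 v.2
  have h3 := product_formula hk
  calc (1 : ℝ) = _ := h3.symm
    _ ≤ _ := mul_le_mul h1 h2 (finprod_nonneg fun v ↦ v.val.nonneg k)
      ((Multiset.prod_nonneg (by simp)).trans h1)
    _ = c ^ totalWeight K * (mulHeight₁ α ^ a * mulHeight₁ α⁻¹ ^ b) := by
      rw [mulHeight₁_eq, mulHeight₁_eq, mul_zpow, mul_zpow]; ring
    _ = _ := by
      rw [mulHeight₁_inv, zpow_add₀ (mulHeight₁_ne_zero α)]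


/-- `y` is an integral combination, of coefficient size at most `c`, of powers of `α` with
exponents in `P`. -/
def IsLaurentValue {K : Type*} [Field K] (α : Kˣ) (c : ℝ) (P : Set ℤ) (y : K) : Prop :=
  ∃ (ι : Type) (s : Finset ι) (r e : ι → ℤ), (∀ i ∈ s, e i ∈ P) ∧ ∑ i ∈ s, |(r i : ℝ)| ≤ c ∧
    y = ∑ i ∈ s, (r i : K) * (α : K) ^ e i

theorem IsLaurentValue.abv_le {K : Type*} [Field K] {α : Kˣ} {c : ℝ} {P : Set ℤ} {y : K}
    (h : IsLaurentValue α c P y) (v : AbsoluteValue K ℝ) (hv : ∀ n : ℤ, v n ≤ |(n : ℝ)|)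
    {B : ℝ} (hB0 : 0 ≤ B) (hB : ∀ n ∈ P, v α ^ n ≤ B) : v y ≤ c * B := by
  obtain ⟨ι, s, r, e, he, hc, rfl⟩ := h
  calc v (∑ i ∈ s, (r i : K) * (α : K) ^ e i)
      ≤ ∑ i ∈ s, v ((r i : K) * (α : K) ^ e i) := v.sum_le _ _
    _ ≤ ∑ i ∈ s, |(r i : ℝ)| * B := Finset.sum_le_sum fun i hi ↦ by
        rw [map_mul, map_zpow₀]
        exact mul_le_mul (hv _) (hB _ (he i hi)) (zpow_nonneg (v.nonneg _) _) (abs_nonneg _)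
    _ = (∑ i ∈ s, |(r i : ℝ)|) * B := by rw [Finset.sum_mul]
    _ ≤ c * B := by gcongr

theorem abv_le_of_mem_closure_zpow {K : Type*} [Field K] {α : Kˣ} {P : Set ℤ} {y : K}
    (h : y ∈ AddSubgroup.closure ((fun n : ℤ ↦ (α : K) ^ n) '' P)) (v : AbsoluteValue K ℝ)
    (hv : IsNonarchimedean v) {B : ℝ} (hB0 : 0 ≤ B) (hB : ∀ n ∈ P, v α ^ n ≤ B) : v y ≤ B := by
  induction h using AddSubgroup.closure_induction with
  | mem x hx =>
    obtain ⟨n, hn, rfl⟩ := hx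
    simpa using hB n hn
  | zero => simpa using hB0
  | add x y _ _ hx hy => exact (hv x y).trans (max_le hx hy)
  | neg x _ hx => simpa using hx

theorem exists_height_bound {K : Type*} [Field K] [NumberField K] (α : Kˣ) :
    ∃ h : ℝ, 0 ≤ h ∧ ∀ (y k : K) (ℓ : ℕ) (a b : ℤ) (c : ℝ), 0 < ℓ → y ≠ 0 → y = ℓ * k →
      IsLaurentValue α c (Set.Iic a) y → IsLaurentValue α c (Set.Ici (-b)) y →
      k ∈ AddSubgroup.closure ((fun n : ℤ ↦ (α : K) ^ n) '' Set.Iic a) →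
      k ∈ AddSubgroup.closure ((fun n : ℤ ↦ (α : K) ^ n) '' Set.Ici (-b)) →
      Real.log ℓ ≤ Real.log c + (a + b) * h := by
  have hd : 0 < Height.totalWeight K := by
    rw [NumberField.totalWeight_eq_finrank]; exact Module.finrank_pos
  refine ⟨Height.logHeight₁ (α : K) / Height.totalWeight K,
    div_nonneg (Height.zero_le_logHeight₁ _) (Nat.cast_nonneg _), ?_⟩
  intro y k ℓ a b c hℓ hy hyk h1 h2 h3 h4
  have hℓ' : (0 : ℝ) < ℓ := by exact_mod_cast hℓ
  have hα : (α : K) ≠ 0 := α.ne_zero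
  have hk : k ≠ 0 := by rintro rfl; simp_all
  have hc : 0 < c := by
    obtain ⟨ι, s, r, e, he, hc, hs⟩ := h1
    refine lt_of_lt_of_le ?_ hc
    by_contra! hle
    have h0 := (Finset.sum_eq_zero_iff_of_nonneg fun i _ ↦ abs_nonneg _).1
      (le_antisymm hle (Finset.sum_nonneg fun i _ ↦ abs_nonneg _))
    refine hy (hs.trans (Finset.sum_eq_zero fun i hi ↦ ?_))
    have := h0 i hi
    simp_all
  have key (v : AbsoluteValue K ℝ) :
      ((∀ n ∈ Set.Iic a, v α ^ n ≤ max (v α) 1 ^ a * max (v (α : K)⁻¹) 1 ^ b) ∨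
      (∀ n ∈ Set.Ici (-b), v α ^ n ≤ max (v α) 1 ^ a * max (v (α : K)⁻¹) 1 ^ b)) := by
    have hpos : 0 < v α := v.pos hα
    rcases le_total 1 (v α) with h | h
    · left
      intro n hn
      rw [max_eq_left h, max_eq_right (by rw [map_inv₀]; exact inv_le_one_of_one_le₀ h), one_zpow,
        mul_one]
      exact zpow_le_zpow_right₀ h hn
    · right
      intro n hn
      rw [max_eq_right h, max_eq_left (by rw [map_inv₀]; exact (one_le_inv₀ hpos).2 h), one_zpow,
        one_mul, map_inv₀, inv_zpow']
      exact zpow_le_zpow_right_of_le_one₀ hpos h hn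
  have hB0 (v : AbsoluteValue K ℝ) : 0 ≤ max (v α) 1 ^ a * max (v (α : K)⁻¹) 1 ^ b := by
    positivity
  have main := one_le_pow_totalWeight_mul_zpow_mulHeight₁ (α := (α : K)) hk (a := a) (b := b)
    (c := c / ℓ) ?_ ?_
  · have := Real.log_nonneg main
    rw [Real.log_mul (by positivity) (zpow_ne_zero _ (Height.mulHeight₁_ne_zero _)), Real.log_pow,
      Real.log_zpow, Real.log_div hc.ne' hℓ'.ne'] at this
    push_cast at this
    rw [← Height.logHeight₁_eq_log_mulHeight₁] at this
    have hd' : (0 : ℝ) < Height.totalWeight K := by exact_mod_cast hd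
    rw [← mul_div_assoc, ← sub_nonneg]
    have h5 := div_nonneg this hd'.le
    refine h5.trans_eq ?_
    field_simp
    ring
  · intro v hv
    have hv : NumberField.IsInfinitePlace v := NumberField.mem_multisetInfinitePlace.1 hv
    have hvn (n : ℤ) : v n = |(n : ℝ)| := by
      obtain ⟨φ, rfl⟩ := hv
      simp
    have : v y = ℓ * v k := by
      rw [hyk, map_mul]
      have := hvn ℓ
      simp_all
    rw [div_mul_eq_mul_div, le_div_iff₀ hℓ', mul_comm, ← this]
    rcases key v with h | h
    · exact h1.abv_le v (fun n ↦ (hvn n).le) (hB0 v) h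
    · exact h2.abv_le v (fun n ↦ (hvn n).le) (hB0 v) h
  · intro v hv
    have hv := Height.AdmissibleAbsValues.isNonarchimedean v hv
    rcases key v with h | h
    · exact abv_le_of_mem_closure_zpow h3 v hv (hB0 v) h
    · exact abv_le_of_mem_closure_zpow h4 v hv (hB0 v) h

end

section

section Basics

instance uniqueSums_of_free (M : Type*) [AddCommGroup M] [Module.Free ℤ M] : UniqueSums M := by
  refine UniqueSums.of_injective_addHom (G := Module.Free.ChooseBasisIndex ℤ M →₀ ℤ)
    ((Module.Free.chooseBasis ℤ M).repr : M →+ _).toAddHom ?_ inferInstance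
  exact (Module.Free.chooseBasis ℤ M).repr.injective

theorem isUFD_laurent {R : Type*} [CommRing R] [IsDomain R] [UniqueFactorizationMonoid R] :
    UniqueFactorizationMonoid R[ℤ] := by
  have : IsLocalization.Away (Polynomial.X : Polynomial R) (LaurentPolynomial R) :=
    LaurentPolynomial.isLocalization
  exact UniqueFactorizationMonoid.of_isLocalization (Submonoid.powers (Polynomial.X : Polynomial R))
    (LaurentPolynomial R)

theorem isUFD_fin {R : Type*} [CommRing R] [IsDomain R] [UniqueFactorizationMonoid R] (n : ℕ) :
    UniqueFactorizationMonoid R[Fin n → ℤ] := by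
  induction n with
  | zero =>
    have e : R[Fin 0 → ℤ] ≃+* R :=
      RingEquiv.symm (RingEquiv.ofBijective (AddMonoidAlgebra.singleZeroRingHom)
        ⟨fun a b h ↦ by simpa using h, fun f ↦ ⟨f.coeff 0, 
        AddMonoidAlgebra.coeff_injective (Finsupp.ext fun m ↦ by
          rw [Subsingleton.elim m 0]
          exact Finsupp.single_eq_same)⟩⟩)
    exact e.symm.toMulEquiv.uniqueFactorizationMonoid inferInstance
  | succ n ih =>
    have e : R[Fin (n + 1) → ℤ] ≃+* R[Fin n → ℤ][ℤ] :=
      (AddMonoidAlgebra.mapDomainRingEquiv R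
        (Fin.consLinearEquiv ℤ (fun _ ↦ ℤ)).symm.toAddEquiv).trans AddMonoidAlgebra.curryRingEquiv
    have : UniqueFactorizationMonoid R[Fin n → ℤ][ℤ] := isUFD_laurent
    exact e.symm.toMulEquiv.uniqueFactorizationMonoid this

instance isUFD_free (R M : Type*) [CommRing R] [IsDomain R] [UniqueFactorizationMonoid R]
    [AddCommGroup M] [Module.Free ℤ M] [Module.Finite ℤ M] :
    UniqueFactorizationMonoid R[M] := by
  have := isUFD_fin (R := R) (Module.finrank ℤ M)
  exact (AddMonoidAlgebra.mapDomainRingEquiv R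
    (Module.finBasis ℤ M).equivFun.toAddEquiv).symm.toMulEquiv.uniqueFactorizationMonoid this

instance isNoetherian_free (R M : Type*) [CommRing R] [IsNoetherianRing R]
    [AddCommGroup M] [Module.Finite ℤ M] : IsNoetherianRing R[M] := by
  have : AddMonoid.FG M := AddGroup.fg_iff_addMonoid_fg.1
    (Module.Finite.iff_addGroup_fg.1 inferInstance)
  exact Algebra.FiniteType.isNoetherianRing R _

end Basics

section Width

variable {R M : Type*} [CommRing R] [AddCommGroup M]

/-- The length of the image of the support of `f` under the linear form `u`. -/
def width (u : M →ₗ[ℤ] ℤ) (f : R[M]) : ℕ :=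
  (f.coeff.support ×ˢ f.coeff.support).sup fun p ↦ (u p.1 - u p.2).toNat

theorem width_le_iff {u : M →ₗ[ℤ] ℤ} {f : R[M]} {N : ℕ} :
    width u f ≤ N ↔ ∀ m ∈ f.coeff.support, ∀ m' ∈ f.coeff.support, u m - u m' ≤ N := by
  rw [width, Finset.sup_le_iff]
  constructor
  · intro h m hm m' hm'
    have := h (m, m') (Finset.mem_product.2 ⟨hm, hm'⟩)
    simpa using this
  · rintro h ⟨m, m'⟩ hp
    have := h m (Finset.mem_product.1 hp).1 m' (Finset.mem_product.1 hp).2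
    simpa using this

theorem sub_le_width (u : M →ₗ[ℤ] ℤ) {f : R[M]} {m m' : M} (hm : m ∈ f.coeff.support)
    (hm' : m' ∈ f.coeff.support) : u m - u m' ≤ width u f :=
  width_le_iff.1 le_rfl m hm m' hm'

theorem exists_max (u : M →ₗ[ℤ] ℤ) {f : R[M]} (hf : f ≠ 0) :
    ∃ m ∈ f.coeff.support, ∀ x ∈ f.coeff.support, u x ≤ u m :=
  Finset.exists_max_image _ _ (Finsupp.support_nonempty_iff.2
    (by simpa using hf))

variable [NoZeroDivisors R] [UniqueSums M]

theorem exists_max_add_mem_support (u : M →ₗ[ℤ] ℤ) {f g : R[M]} (hf : f ≠ 0) (hg : g ≠ 0) :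
    ∃ m ∈ f.coeff.support, ∃ m' ∈ g.coeff.support, (∀ x ∈ f.coeff.support, u x ≤ u m) ∧
      (∀ x ∈ g.coeff.support, u x ≤ u m') ∧ m + m' ∈ (f * g).coeff.support := by
  classical
  obtain ⟨a, ha, ha'⟩ := exists_max u hf
  obtain ⟨b, hb, hb'⟩ := exists_max u hg
  obtain ⟨m, hm, m', hm', h⟩ := UniqueSums.uniqueAdd_of_nonempty
    (A := f.coeff.support.filter (u · = u a)) (B := g.coeff.support.filter (u · = u b))
    ⟨a, by simp_all⟩ ⟨b, by simp_all⟩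
  rw [Finset.mem_filter] at hm hm'
  have h' : UniqueAdd f.coeff.support g.coeff.support m m' := by
    intro x y hx hy hxy
    have h1 := ha' x hx
    have h2 := hb' y hy
    have h3 : u x + u y = u m + u m' := by rw [← map_add, hxy, map_add]
    exact h (by rw [Finset.mem_filter]; exact ⟨hx, by omega⟩)
      (by rw [Finset.mem_filter]; exact ⟨hy, by omega⟩) hxy
  refine ⟨m, hm.1, m', hm'.1, hm.2 ▸ ha', hm'.2 ▸ hb', ?_⟩
  rw [Finsupp.mem_support_iff, AddMonoidAlgebra.coeff_mul_add_of_uniqueAdd h']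
  exact mul_ne_zero (Finsupp.mem_support_iff.1 hm.1) (Finsupp.mem_support_iff.1 hm'.1)

theorem width_mul (u : M →ₗ[ℤ] ℤ) {f g : R[M]} (hf : f ≠ 0) (hg : g ≠ 0) :
    width u (f * g) = width u f + width u g := by
  classical
  apply le_antisymm
  · rw [width_le_iff]
    intro m hm m' hm'
    obtain ⟨a, ha, b, hb, rfl⟩ := Finset.mem_add.1
      (AddMonoidAlgebra.support_coeff_mul_subset f g hm)
    obtain ⟨a', ha', b', hb', rfl⟩ := Finset.mem_add.1
      (AddMonoidAlgebra.support_coeff_mul_subset f g hm')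
    have := sub_le_width u ha ha'
    have := sub_le_width u hb hb'
    simp only [map_add, Nat.cast_add]
    omega
  · obtain ⟨m, hm, m', hm', h1, h2, h3⟩ := exists_max_add_mem_support u hf hg
    obtain ⟨b, hb, b', hb', h4, h5, h6⟩ := exists_max_add_mem_support (-u) hf hg
    have h7 := sub_le_width u h3 h6
    have h8 : width u f ≤ (u m - u b).toNat := by
      rw [width_le_iff]
      intro x hx y hy
      have := h1 x hx
      have := h4 y hy
      simp only [LinearMap.neg_apply] at this
      omega
    have h9 : width u g ≤ (u m' - u b').toNat := by
      rw [width_le_iff]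
      intro x hx y hy
      have := h2 x hx
      have := h5 y hy
      simp only [LinearMap.neg_apply] at this
      omega
    have h10 := h1 _ hb
    have h11 := h2 _ hb'
    simp only [map_add] at h7
    omega

theorem width_le_of_dvd (u : M →ₗ[ℤ] ℤ) {f g : R[M]} (hg : g ≠ 0) (h : f ∣ g) :
    width u f ≤ width u g := by
  obtain ⟨k, rfl⟩ := h
  rw [width_mul u (left_ne_zero_of_mul hg) (right_ne_zero_of_mul hg)]
  omega

theorem width_one (u : M →ₗ[ℤ] ℤ) : width u (1 : R[M]) = 0 := by
  rw [← Nat.le_zero, width_le_iff]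
  intro m hm m' hm'
  have h1 := AddMonoidAlgebra.support_coeff_one_subset hm
  have h2 := AddMonoidAlgebra.support_coeff_one_subset hm'
  simp_all

theorem width_prod [Nontrivial R] {ι : Type*} (u : M →ₗ[ℤ] ℤ) (s : Finset ι) (f : ι → R[M])
    (hf : ∀ i ∈ s, f i ≠ 0) : width u (∏ i ∈ s, f i) = ∑ i ∈ s, width u (f i) := by
  classical
  induction s using Finset.induction_on with
  | empty => simp [width_one]
  | insert a s ha ih =>
    rw [Finset.prod_insert ha, Finset.sum_insert ha, width_mul, ih]
    · exact fun i hi ↦ hf i (Finset.mem_insert_of_mem hi)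
    · exact hf a (Finset.mem_insert_self _ _)
    · exact Finset.prod_ne_zero_iff.2 fun i hi ↦ hf i (Finset.mem_insert_of_mem hi)

theorem width_eq_zero_of_isUnit [Nontrivial R] (u : M →ₗ[ℤ] ℤ) {f : R[M]} (hf : IsUnit f) :
    width u f = 0 := by
  have := width_le_of_dvd u one_ne_zero hf.dvd
  rwa [width_one, Nat.le_zero] at this

theorem width_eq_of_associated [Nontrivial R] (u : M →ₗ[ℤ] ℤ) {f g : R[M]} (h : Associated f g) :
    width u f = width u g := by
  obtain ⟨k, rfl⟩ := h
  by_cases hf : f = 0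
  · simp [hf]
  · rw [width_mul u hf k.ne_zero, width_eq_zero_of_isUnit u k.isUnit, add_zero]

end Width

section Units

variable {R M : Type*} [CommRing R] [IsDomain R] [AddCommGroup M] [Module.Free ℤ M]
  [Module.Finite ℤ M]

theorem eq_of_width_eq_zero {f : R[M]} (h : ∀ u : M →ₗ[ℤ] ℤ, width u f = 0)
    {m m' : M} (hm : m ∈ f.coeff.support) (hm' : m' ∈ f.coeff.support) : m = m' := by
  refine (Module.finBasis ℤ M).ext_elem fun i ↦ ?_
  have h1 := width_le_iff.1 (h ((Module.finBasis ℤ M).coord i)).le m hm m' hm'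
  have h2 := width_le_iff.1 (h ((Module.finBasis ℤ M).coord i)).le m' hm' m hm
  simp only [Module.Basis.coord_apply] at h1 h2
  push_cast at h1 h2
  omega

theorem eq_single_of_isUnit {f : R[M]} (h : IsUnit f) :
    ∃ m c, IsUnit c ∧ f = AddMonoidAlgebra.single m c := by
  obtain ⟨m, hm⟩ := Finsupp.support_nonempty_iff.2 (by simpa using h.ne_zero : f.coeff ≠ 0)
  have h1 : f = AddMonoidAlgebra.single m (f.coeff m) := by
    ext x
    by_cases hx : x ∈ f.coeff.support
    · obtain rfl := eq_of_width_eq_zero (fun u ↦ width_eq_zero_of_isUnit u h) hm hx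
      simp
    · have : m ≠ x := by rintro rfl; exact hx hm
      simp_all
  refine ⟨m, _, ?_, h1⟩
  obtain ⟨g, hg⟩ := h.exists_right_inv
  have h3 := congrArg (AddMonoidAlgebra.lift R R M 1) hg
  rw [h1] at h3
  simp only [map_mul, map_one, AddMonoidAlgebra.lift_single] at h3
  exact IsUnit.of_mul_eq_one _ (by simpa using h3)

theorem isUnit_single (m : M) {c : R} (hc : IsUnit c) :
    IsUnit (AddMonoidAlgebra.single m c : R[M]) := by
  obtain ⟨d, hd⟩ := hc.exists_right_inv
  exact IsUnit.of_mul_eq_one (AddMonoidAlgebra.single (-m) d)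
    (by rw [AddMonoidAlgebra.single_mul_single, hd, add_neg_cancel, AddMonoidAlgebra.one_def])

end Units

end

section

abbrev QBar : Type := AlgebraicClosure ℚ

/-- `h` serves as a height of `α` in the form needed for the product formula. -/
def IsHeightBound {K : Type*} [Field K] (α : Kˣ) (h : ℝ) : Prop :=
  0 ≤ h ∧ ∀ (y k : K) (ℓ : ℕ) (a b : ℤ) (c : ℝ), 0 < ℓ → y ≠ 0 → y = ℓ * k →
    IsLaurentValue α c (Set.Iic a) y → IsLaurentValue α c (Set.Ici (-b)) y →
    k ∈ AddSubgroup.closure ((fun n : ℤ ↦ (α : K) ^ n) '' Set.Iic a) →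
    k ∈ AddSubgroup.closure ((fun n : ℤ ↦ (α : K) ^ n) '' Set.Ici (-b)) →
    Real.log ℓ ≤ Real.log c + (a + b) * h

open IntermediateField in
theorem exists_isHeightBound (α : QBarˣ) : ∃ h, IsHeightBound α h := by
  have h_int : IsIntegral ℚ (α : QBar) :=
    (AlgebraicClosure.isAlgebraic ℚ).isAlgebraic _ |>.isIntegral
  have : FiniteDimensional ℚ ℚ⟮(α : QBar)⟯ := adjoin.finiteDimensional h_int
  have : NumberField ℚ⟮(α : QBar)⟯ := ⟨⟩
  have hne : AdjoinSimple.gen ℚ (α : QBar) ≠ 0 := by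
    intro h
    have := congrArg (algebraMap ℚ⟮(α : QBar)⟯ QBar) h
    rw [AdjoinSimple.algebraMap_gen, map_zero] at this
    exact α.ne_zero this
  set β : ℚ⟮(α : QBar)⟯ˣ := Units.mk0 _ hne with hβ
  have hβα (n : ℤ) : algebraMap ℚ⟮(α : QBar)⟯ QBar ((β : ℚ⟮(α : QBar)⟯) ^ n) = (α : QBar) ^ n := by
    rw [map_zpow₀, hβ, Units.val_mk0, AdjoinSimple.algebraMap_gen]
  have hinj := (algebraMap ℚ⟮(α : QBar)⟯ QBar).injective
  obtain ⟨h, h0, H⟩ := exists_height_bound β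
  have hcl (P : Set ℤ) (k : QBar)
      (hk : k ∈ AddSubgroup.closure ((fun n : ℤ ↦ (α : QBar) ^ n) '' P)) :
      ∃ k', algebraMap ℚ⟮(α : QBar)⟯ QBar k' = k ∧
        k' ∈ AddSubgroup.closure ((fun n : ℤ ↦ (β : ℚ⟮(α : QBar)⟯) ^ n) '' P) := by
    have : (fun n : ℤ ↦ (α : QBar) ^ n) '' P =
        (algebraMap ℚ⟮(α : QBar)⟯ QBar : _ →+ _) ''
          ((fun n : ℤ ↦ (β : ℚ⟮(α : QBar)⟯) ^ n) '' P) := by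
      rw [Set.image_image]
      exact Set.image_congr fun n _ ↦ (hβα n).symm
    rw [this, ← AddMonoidHom.map_closure] at hk
    obtain ⟨k', hk', h2⟩ := hk
    exact ⟨k', h2, hk'⟩
  have hlv (c : ℝ) (P : Set ℤ) (y : QBar) (hy : IsLaurentValue α c P y) :
      ∃ y', algebraMap ℚ⟮(α : QBar)⟯ QBar y' = y ∧ IsLaurentValue β c P y' := by
    obtain ⟨ι, s, r, e, he, hc, rfl⟩ := hy
    refine ⟨_, ?_, ι, s, r, e, he, hc, rfl⟩
    simp only [map_sum, map_mul, hβα, map_intCast]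
  refine ⟨h, h0, fun y k ℓ a b c hℓ hy hyk h1 h2 h3 h4 ↦ ?_⟩
  obtain ⟨y', hy', h1⟩ := hlv _ _ _ h1
  obtain ⟨y'', hy'', h2⟩ := hlv _ _ _ h2
  obtain rfl := hinj (hy'.trans hy''.symm)
  obtain ⟨k', hk', h3⟩ := hcl _ _ h3
  obtain ⟨k'', hk'', h4⟩ := hcl _ _ h4
  obtain rfl := hinj (hk'.trans hk''.symm)
  refine H y' k' ℓ a b c hℓ (by rintro rfl; simp_all) (hinj ?_) h1 h2 h3 h4
  rw [hy', hyk, map_mul, map_natCast, hk']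

section Eval

variable (R : Type*) {L M : Type*} [CommRing R] [Field L] [Algebra R L] [AddCommGroup M]

/-- Evaluation at the point `m ↦ α ^ κ m` of the torus with character group `M`. -/
def evalAt (κ : M →ₗ[ℤ] ℤ) (α : Lˣ) : R[M] →ₐ[R] L :=
  AddMonoidAlgebra.lift R L M
    ((Units.coeHom L).comp ((zpowersHom Lˣ α).comp κ.toAddMonoidHom.toMultiplicative))

variable {R}

@[simp] theorem evalAt_single (κ : M →ₗ[ℤ] ℤ) (α : Lˣ) (m : M) (r : R) :
    evalAt R κ α (AddMonoidAlgebra.single m r) = algebraMap R L r * (α : L) ^ κ m := by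
  simp [evalAt, AddMonoidAlgebra.lift_single, Algebra.smul_def]

theorem evalAt_apply (κ : M →ₗ[ℤ] ℤ) (α : Lˣ) (f : R[M]) :
    evalAt R κ α f = ∑ m ∈ f.coeff.support, algebraMap R L (f.coeff m) * (α : L) ^ κ m := by
  conv_lhs => rw [← AddMonoidAlgebra.sum_coeff_single f, Finsupp.sum, map_sum]
  simp

theorem evalAt_mapRingHom {S : Type*} [CommRing S] [Algebra S L] [Algebra R S]
    [IsScalarTower R S L] (κ : M →ₗ[ℤ] ℤ) (α : Lˣ) (f : R[M]) :
    evalAt S κ α (AddMonoidAlgebra.mapRingHom M (algebraMap R S) f) = evalAt R κ α f := by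
  induction f using AddMonoidAlgebra.induction_linear with
  | zero => simp
  | add f g hf hg => simp [hf, hg]
  | single m r => simp [← IsScalarTower.algebraMap_apply]

theorem evalAt_mapDomainRingHom {N : Type*} [AddCommGroup N] (ι : N →ₗ[ℤ] M)
    (κ : M →ₗ[ℤ] ℤ) (α : Lˣ) (f : R[N]) :
    evalAt R κ α (AddMonoidAlgebra.mapDomainRingHom R (ι : N →+ M) f) =
      evalAt R (κ ∘ₗ ι) α f := by
  induction f using AddMonoidAlgebra.induction_linear with
  | zero => simp
  | add f g hf hg => simp only [map_add, hf, hg]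
  | single m r => simp

end Eval

section Generic

/-- The filter of linear forms avoiding any given finite set of nonzero vectors in their kernel. -/
def generic (M : Type*) [AddCommGroup M] : Filter (M →ₗ[ℤ] ℤ) :=
  ⨅ b : {b : M // b ≠ 0}, 𝓟 {κ | κ b ≠ 0}

theorem eventually_generic {M : Type*} [AddCommGroup M] {b : M} (hb : b ≠ 0) :
    ∀ᶠ κ in generic M, κ b ≠ 0 :=
  mem_iInf_of_mem ⟨b, hb⟩ (mem_principal_self _)

theorem exists_finset_of_eventually_generic {M : Type*} [AddCommGroup M]
    {p : (M →ₗ[ℤ] ℤ) → Prop} (h : ∀ᶠ κ in generic M, p κ) :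
    ∃ s : Finset M, (∀ b ∈ s, b ≠ 0) ∧ ∀ κ : M →ₗ[ℤ] ℤ, (∀ b ∈ s, κ b ≠ 0) → p κ := by
  classical
  obtain ⟨t, ht, h⟩ := (hasBasis_iInf_principal_finite _).eventually_iff.1 h
  refine ⟨ht.toFinset.image Subtype.val, ?_, fun κ hκ ↦ h ?_⟩
  · intro b hb
    obtain ⟨x, -, rfl⟩ := Finset.mem_image.1 hb
    exact x.2
  · simp only [Set.mem_iInter, Set.mem_ofPred_eq]
    intro b hb
    exact hκ _ (Finset.mem_image.2 ⟨b, ht.mem_toFinset.2 hb, rfl⟩)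

theorem tendsto_generic {M N : Type*} [AddCommGroup M] [AddCommGroup N] (ι : N →ₗ[ℤ] M)
    (hι : Function.Injective ι) :
    Tendsto (fun κ : M →ₗ[ℤ] ℤ ↦ κ ∘ₗ ι) (generic M) (generic N) := by
  refine tendsto_iInf.2 fun b ↦ tendsto_principal.2 ?_
  exact eventually_generic (b := ι b) (by simpa using hι.ne b.2)

end Generic

section Retraction

variable {R M : Type*} [CommRing R] [AddCommGroup M] (N : Submodule ℤ M)

/-- The inclusion of group rings induced by `N ⊆ M`. -/
def emb (R : Type*) [CommRing R] : R[N] →+* R[M] :=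
  AddMonoidAlgebra.mapDomainRingHom R (N.subtype : N →+ M)

variable {N}

@[simp] theorem emb_single (m : N) (r : R) :
    emb N R (AddMonoidAlgebra.single m r) = AddMonoidAlgebra.single (m : M) r := by
  simp [emb]

@[simp] theorem coeff_emb (f : R[N]) (m : N) : (emb N R f).coeff (m : M) = f.coeff m :=
  Finsupp.mapDomain_apply N.injective_subtype _ _

theorem coeff_emb_of_notMem (f : R[N]) {m : M} (hm : m ∉ N) : (emb N R f).coeff m = 0 :=
  Finsupp.mapDomain_of_notMem_range _ _ (by simpa using hm)

theorem evalAt_emb {L : Type*} [Field L] [Algebra R L] (κ : M →ₗ[ℤ] ℤ) (α : Lˣ) (f : R[N]) :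
    evalAt R κ α (emb N R f) = evalAt R (κ ∘ₗ N.subtype) α f :=
  evalAt_mapDomainRingHom _ _ _ _

theorem emb_mapRingHom {S : Type*} [CommRing S] (φ : R →+* S) (f : R[N]) :
    emb N S (AddMonoidAlgebra.mapRingHom N φ f) = AddMonoidAlgebra.mapRingHom M φ (emb N R f) := by
  induction f using AddMonoidAlgebra.induction_linear with
  | zero => simp
  | add f g hf hg => simp [hf, hg]
  | single m r => simp

variable (N) in
/-- The `R[N]`-linear retraction of the inclusion `R[N] ⊆ R[M]`. -/
def retr (R : Type*) [CommRing R] : R[M] →+ R[N] :=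
  AddMonoidAlgebra.comapDomainAddMonoidHom N.subtype N.injective_subtype

@[simp] theorem coeff_retr (f : R[M]) (m : N) : (retr N R f).coeff m = f.coeff m := rfl

theorem retr_emb_mul (a : R[N]) (b : R[M]) : retr N R (emb N R a * b) = a * retr N R b := by
  classical
  induction a using AddMonoidAlgebra.induction_linear with
  | zero => simp
  | add f g hf hg => simp [hf, hg, add_mul]
  | single m r =>
    ext x
    rw [coeff_retr, emb_single, ← sub_add_cancel x m, add_comm (x - m) m]
    simp
    

theorem isUnit_of_isUnit_emb {a : R[N]} (h : IsUnit (emb N R a)) : IsUnit a := by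
  obtain ⟨b, hb⟩ := h.exists_right_inv
  refine IsUnit.of_mul_eq_one (retr N R b) ?_
  rw [← retr_emb_mul, hb]
  ext m
  rw [coeff_retr, ← map_one (emb N R), coeff_emb]

theorem coeff_single_mul_eq (m : M) (r : R) (f : R[M]) (x : M) :
    (AddMonoidAlgebra.single m r * f).coeff x = r * f.coeff (x - m) := by
  conv_lhs => rw [← sub_add_cancel x m, add_comm (x - m) m]
  simp [sub_eq_neg_add]

theorem eq_sum_single_mul_emb_retr (v : M →ₗ[ℤ] ℤ) (f : R[M]) :
    ∃ (t : Finset ℤ) (σ : ℤ → M), f = ∑ c ∈ t, AddMonoidAlgebra.single (σ c) 1 *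
      emb (LinearMap.ker v) R (retr _ R (AddMonoidAlgebra.single (-σ c) 1 * f)) := by
  classical
  have (c : ℤ) : ∃ m : M, c ∈ f.coeff.support.image v → v m = c := by
    by_cases hc : c ∈ f.coeff.support.image v
    · obtain ⟨m, -, hm⟩ := Finset.mem_image.1 hc
      exact ⟨m, fun _ ↦ hm⟩
    · exact ⟨0, fun h ↦ absurd h hc⟩
  choose σ hσ using this
  refine ⟨f.coeff.support.image v, σ, ?_⟩
  ext x
  rw [AddMonoidAlgebra.coeff_sum, Finset.sum_apply']
  simp only [coeff_single_mul_eq, one_mul]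
  have key (c : ℤ) (hc : c ∈ f.coeff.support.image v) :
      (emb (LinearMap.ker v) R (retr _ R (AddMonoidAlgebra.single (-σ c) 1 * f))).coeff (x - σ c) =
        if c = v x then f.coeff x else 0 := by
    split_ifs with h
    · have hx : x - σ c ∈ LinearMap.ker v := by
        rw [LinearMap.mem_ker, map_sub, hσ c hc, h, sub_self]
      rw [show x - σ c = ((⟨x - σ c, hx⟩ : LinearMap.ker v) : M) from rfl, coeff_emb, coeff_retr,
        coeff_single_mul_eq]
      simp
    · refine coeff_emb_of_notMem _ fun hx ↦ h ?_
      rw [LinearMap.mem_ker, map_sub, hσ c hc, sub_eq_zero] at hx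
      exact hx.symm
  rw [Finset.sum_congr rfl key, Finset.sum_ite_eq']
  split_ifs with h
  · rfl
  · by_contra hx
    exact h (Finset.mem_image.2 ⟨x, Finsupp.mem_support_iff.2 hx, rfl⟩)

theorem emb_dvd_of_forall_dvd_retr (v : M →ₗ[ℤ] ℤ) {f : R[M]} {D : R[LinearMap.ker v]}
    (h : ∀ m, D ∣ retr _ R (AddMonoidAlgebra.single m 1 * f)) : emb _ R D ∣ f := by
  obtain ⟨t, σ, ht⟩ := eq_sum_single_mul_emb_retr v f
  rw [ht]
  exact Finset.dvd_sum fun c _ ↦ ((map_dvd (emb _ R) (h _)).mul_left _)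

theorem evalAt_retr {L : Type*} [Field L] [Algebra R L] (v κ : M →ₗ[ℤ] ℤ) (α : Lˣ) (m : M)
    (f : R[M]) : evalAt R (κ ∘ₗ (LinearMap.ker v).subtype) α
      (retr _ R (AddMonoidAlgebra.single (-m) 1 * f)) =
      ∑ x ∈ f.coeff.support with v x = v m, algebraMap R L (f.coeff x) * (α : L) ^ (κ (x - m)) := by
  rw [evalAt_apply]
  refine Finset.sum_nbij (fun n ↦ (n : M) + m) ?_ ?_ ?_ ?_
  · intro n hn
    rw [Finsupp.mem_support_iff, coeff_retr, coeff_single_mul_eq] at hn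
    rw [Finset.mem_filter, Finsupp.mem_support_iff]
    refine ⟨by simpa using hn, ?_⟩
    rw [map_add, LinearMap.mem_ker.1 n.2, zero_add]
  · intro n _ n' _ h
    simpa using h
  · intro x hx
    rw [Finset.mem_coe, Finset.mem_filter, Finsupp.mem_support_iff] at hx
    refine ⟨⟨x - m, by rw [LinearMap.mem_ker, map_sub, hx.2, sub_self]⟩, ?_, by simp⟩
    rw [Finset.mem_coe, Finsupp.mem_support_iff, coeff_retr, coeff_single_mul_eq]
    simpa using hx.1
  · intro n _
    rw [coeff_retr, coeff_single_mul_eq]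
    simp

end Retraction

end

section

/-- For all but finitely many conditions `κ b ≠ 0`, the elements of an ideal without common
factor do not all vanish at a nontorsion point of the one-parameter subgroup `κ`. -/
def GenericallyNonvanishing (M : Type) [AddCommGroup M] : Prop :=
  ∀ I : Ideal ℚ[M], (∀ D, (∀ g ∈ I, D ∣ g) → IsUnit D) →
    ∀ᶠ κ in generic M, ∀ α : QBarˣ, ¬ IsOfFinOrder α → ∃ g ∈ I, evalAt ℚ κ α g ≠ 0

section Dirichlet

variable {M : Type*} [AddCommGroup M] [Module.Free ℤ M] [Module.Finite ℤ M]

/-- The sup norm of a linear form in the chosen basis. -/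
def supNorm (κ : M →ₗ[ℤ] ℤ) : ℕ :=
  Finset.univ.sup fun i ↦ (κ (Module.finBasis ℤ M i)).natAbs

/-- The sum norm of a vector in the chosen basis. -/
def sumNorm (m : M) : ℤ := ∑ i, |(Module.finBasis ℤ M).repr m i|

theorem abs_le_supNorm (κ : M →ₗ[ℤ] ℤ) (i) : |κ (Module.finBasis ℤ M i)| ≤ supNorm κ := by
  have := Finset.le_sup (f := fun i ↦ (κ (Module.finBasis ℤ M i)).natAbs) (Finset.mem_univ i)
  rw [supNorm, Int.abs_eq_natAbs]
  exact_mod_cast this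

theorem supNorm_pos {κ : M →ₗ[ℤ] ℤ} (hκ : κ ≠ 0) : 0 < supNorm κ := by
  by_contra! h
  refine hκ ((Module.finBasis ℤ M).ext fun i ↦ ?_)
  have := abs_le_supNorm κ i
  have h0 : supNorm κ = 0 := by omega
  rw [h0] at this
  simpa using this

theorem exists_eq_supNorm {κ : M →ₗ[ℤ] ℤ} (hκ : κ ≠ 0) :
    ∃ i, |κ (Module.finBasis ℤ M i)| = supNorm κ := by
  have hne : (Finset.univ : Finset (Fin (Module.finrank ℤ M))).Nonempty := by
    by_contra h
    have := supNorm_pos hκ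
    rw [supNorm, Finset.not_nonempty_iff_eq_empty.1 h] at this
    simp at this
  obtain ⟨i, -, hi⟩ := Finset.exists_mem_eq_sup Finset.univ hne
    fun i ↦ (κ (Module.finBasis ℤ M i)).natAbs
  exact ⟨i, by rw [supNorm, hi, Int.abs_eq_natAbs]⟩

theorem exists_simultaneous_approx {κ : M →ₗ[ℤ] ℤ} (hκ : κ ≠ 0) {T : ℕ} (hT : 2 ≤ T) :
    ∃ (q : ℕ) (v : M →ₗ[ℤ] ℤ), 1 ≤ q ∧ q ≤ T ^ Module.finrank ℤ M ∧ v ≠ 0 ∧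
      (∀ i, |v (Module.finBasis ℤ M i)| ≤ q) ∧
      ∀ i, T * |q * κ (Module.finBasis ℤ M i) - supNorm κ * v (Module.finBasis ℤ M i)| ≤
        supNorm κ := by
  classical
  have hK := supNorm_pos hκ
  set K : ℤ := ((supNorm κ : ℕ) : ℤ) with hKdef
  have hK : 0 < K := by omega
  set b := Module.finBasis ℤ M with hb
  let F : ℕ → Fin (Module.finrank ℤ M) → ℤ := fun j i ↦ (T * ((j * κ (b i)) % K)) / K
  obtain ⟨j, hj, j', hj', hne, hF⟩ := Finset.exists_ne_map_eq_of_card_lt_of_maps_to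
    (s := Finset.range (T ^ Module.finrank ℤ M + 1)) (t := Fintype.piFinset fun _ : Fin (Module.finrank ℤ M) ↦ Finset.Ico (0 : ℤ) T)
    (f := F) (by simp) (by
      intro j _
      rw [Finset.mem_coe, Fintype.mem_piFinset]
      intro i
      have h1 := Int.emod_nonneg (j * κ (b i)) hK.ne'
      have h2 := Int.emod_lt_of_pos (j * κ (b i)) hK
      rw [Finset.mem_Ico]
      refine ⟨Int.ediv_nonneg (by positivity) hK.le, ?_⟩
      apply Int.ediv_lt_of_lt_mul hK
      have : (0 : ℤ) < T := by omega
      nlinarith)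
  wlog hlt : j < j' generalizing j j'
  · exact this j' hj' j hj hne.symm hF.symm (by omega)
  set v : M →ₗ[ℤ] ℤ := b.constr ℤ fun i ↦ (j' * κ (b i)) / K - (j * κ (b i)) / K with hv
  have hvi (i) : v (b i) = (j' * κ (b i)) / K - (j * κ (b i)) / K := by
    rw [hv, Module.Basis.constr_basis]
  have happ (i) : T * |((j' - j : ℕ) : ℤ) * κ (b i) - K * v (b i)| ≤ K := by
    have h1 := congrFun hF i
    simp only [F] at h1
    have h3 := Int.emod_add_mul_ediv (j * κ (b i)) K
    have h4 := Int.emod_add_mul_ediv (j' * κ (b i)) K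
    have h5 : ((j' - j : ℕ) : ℤ) * κ (b i) - K * v (b i) =
        (j' * κ (b i)) % K - (j * κ (b i)) % K := by
      rw [hvi]; push_cast [hlt.le]; linarith
    rw [h5, ← Nat.abs_cast (T), ← abs_mul, mul_sub, abs_le]
    have h6 := Int.emod_add_mul_ediv (T * ((j * κ (b i)) % K)) K
    have h7 := Int.emod_add_mul_ediv (T * ((j' * κ (b i)) % K)) K
    have h8 := Int.emod_nonneg (T * ((j * κ (b i)) % K)) hK.ne'
    have h9 := Int.emod_lt_of_pos (T * ((j * κ (b i)) % K)) hK
    have h10 := Int.emod_nonneg (T * ((j' * κ (b i)) % K)) hK.ne'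
    have h11 := Int.emod_lt_of_pos (T * ((j' * κ (b i)) % K)) hK
    rw [h1] at h6
    constructor <;> linarith
  rw [Finset.mem_range] at hj'
  have hT' : (2 : ℤ) ≤ T := by omega
  have happ2 (i) : 2 * |((j' - j : ℕ) : ℤ) * κ (b i) - K * v (b i)| ≤ K := by
    refine le_trans ?_ (happ i)
    gcongr
  refine ⟨j' - j, v, by omega, by omega, ?_, ?_, happ⟩
  · intro h0
    obtain ⟨i, hi⟩ := exists_eq_supNorm hκ
    have h2 := happ2 i
    rw [h0, LinearMap.zero_apply, mul_zero, sub_zero, abs_mul, hi, Nat.abs_cast] at h2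
    have : (1 : ℤ) ≤ (j' - j : ℕ) := by omega
    nlinarith
  · intro i
    have h2 := happ2 i
    have h3 := abs_le_supNorm κ i
    have h4 : K * |v (b i)| ≤ ((j' - j : ℕ) : ℤ) * K + |((j' - j : ℕ) : ℤ) * κ (b i) - K * v (b i)| := by
      have h5 := abs_sub_abs_le_abs_sub (K * v (b i)) (((j' - j : ℕ) : ℤ) * κ (b i))
      rw [abs_sub_comm, abs_mul, abs_of_pos hK, abs_mul, Nat.abs_cast] at h5
      have h6 : ((j' - j : ℕ) : ℤ) * |κ (b i)| ≤ ((j' - j : ℕ) : ℤ) * K := by gcongr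
      linarith
    by_contra! h7
    have h8 : K * (((j' - j : ℕ) : ℤ) + 1) ≤ K * |v (b i)| := by gcongr; omega
    nlinarith

theorem approx_apply_le {κ v : M →ₗ[ℤ] ℤ} {T q K : ℤ}
    (h : ∀ i, T * |q * κ (Module.finBasis ℤ M i) - K * v (Module.finBasis ℤ M i)| ≤ K)
    (hT : 0 ≤ T) (m : M) : T * |q * κ m - K * v m| ≤ K * sumNorm m := by
  set b := Module.finBasis ℤ M
  have h1 : q * κ m - K * v m = ∑ i, b.repr m i * (q * κ (b i) - K * v (b i)) := by
    conv_lhs => rw [← b.sum_repr m]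
    simp only [map_sum, map_smul, smul_eq_mul, Finset.mul_sum, mul_sub, Finset.sum_sub_distrib]
    congr 1 <;> exact Finset.sum_congr rfl fun i _ ↦ by ring
  rw [h1, sumNorm, Finset.mul_sum]
  calc _ ≤ T * ∑ i, |b.repr m i * (q * κ (b i) - K * v (b i))| := by
        gcongr; exact Finset.abs_sum_le_sum_abs _ _
    _ = ∑ i, |b.repr m i| * (T * |q * κ (b i) - K * v (b i)|) := by
        rw [Finset.mul_sum]
        exact Finset.sum_congr rfl fun i _ ↦ by rw [abs_mul]; ring
    _ ≤ _ := Finset.sum_le_sum fun i _ ↦ 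
        (mul_le_mul_of_nonneg_left (h i) (abs_nonneg _)).trans_eq (mul_comm _ _)

variable (M) in
theorem finite_setOf_abs_le (B : ℤ) :
    {v : M →ₗ[ℤ] ℤ | ∀ i, |v (Module.finBasis ℤ M i)| ≤ B}.Finite := by
  refine Set.Finite.of_finite_image (f := fun v i ↦ v (Module.finBasis ℤ M i)) ?_ ?_
  · refine (Set.finite_Icc (fun _ ↦ -B) (fun _ ↦ B)).subset ?_
    rintro _ ⟨v, hv, rfl⟩
    exact ⟨fun i ↦ (abs_le.1 (hv i)).1, fun i ↦ (abs_le.1 (hv i)).2⟩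
  · intro v _ w _ h
    exact (Module.finBasis ℤ M).ext fun i ↦ congrFun h i

end Dirichlet

end

section

/-- The sum of the absolute values of the coefficients. -/
def coeffNorm {M : Type*} [AddCommGroup M] (f : ℤ[M]) : ℝ :=
  ∑ m ∈ f.coeff.support, |(f.coeff m : ℝ)|

theorem IsLaurentValue.mem_closure {K : Type*} [Field K] {α : Kˣ} {c : ℝ} {P : Set ℤ} {y : K}
    (h : IsLaurentValue α c P y) :
    y ∈ AddSubgroup.closure ((fun n : ℤ ↦ (α : K) ^ n) '' P) := by
  obtain ⟨ι, s, r, e, he, -, rfl⟩ := h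
  refine sum_mem fun i hi ↦ ?_
  rw [← zsmul_eq_mul]
  exact zsmul_mem (AddSubgroup.subset_closure (Set.mem_image_of_mem _ (he i hi))) _

theorem retr_mapRingHom {R S M : Type*} [CommRing R] [CommRing S] [AddCommGroup M]
    (N : Submodule ℤ M) (φ : R →+* S) (f : R[M]) (m : M) :
    retr N S (AddMonoidAlgebra.single m 1 * AddMonoidAlgebra.mapRingHom M φ f) =
      AddMonoidAlgebra.mapRingHom N φ (retr N R (AddMonoidAlgebra.single m 1 * f)) := by
  ext x
  simp

section

variable {M : Type} [AddCommGroup M] [Module.Free ℤ M] [Module.Finite ℤ M]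

theorem height_le_of_cluster {κ v : M →ₗ[ℤ] ℤ} {α : QBarˣ} {h : ℝ} {q K : ℕ} {f : ℤ[M]}
    (hh : IsHeightBound α h) (hq : 1 ≤ q) (hf : evalAt ℤ κ α f = 0)
    (happ : ∀ m ∈ f.coeff.support, ∀ m' ∈ f.coeff.support,
      8 * |q * κ (m' - m) - K * v (m' - m)| ≤ K)
    (hne : ∃ m, evalAt ℤ (κ ∘ₗ (LinearMap.ker v).subtype) α
      (retr _ ℤ (AddMonoidAlgebra.single (-m) 1 * f)) ≠ 0) :
    h * K ≤ 2 * q * Real.log (coeffNorm f) := by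
  classical
  set g : M → QBar := fun m ↦ ∑ x ∈ f.coeff.support with v x = v m,
    (f.coeff x : QBar) * (α : QBar) ^ (κ x) with hg
  have hgv (m m' : M) (hmm : v m = v m') : g m = g m' := by simp only [hg, hmm]
  have hα := α.ne_zero
  obtain ⟨m₁, hm₁⟩ : ∃ m ∈ f.coeff.support, g m ≠ 0 := by
    obtain ⟨m, hm⟩ := hne
    rw [evalAt_retr] at hm
    have hgm : g m ≠ 0 := by
      intro h0
      refine hm ?_
      rw [← mul_zero ((α : QBar) ^ (-κ m)), ← h0, hg, Finset.mul_sum]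
      refine Finset.sum_congr rfl fun x _ ↦ ?_
      rw [map_sub, sub_eq_add_neg, zpow_add₀ hα, eq_intCast (algebraMap ℤ QBar)]
      ring
    obtain ⟨x, hx, -⟩ := Finset.exists_ne_zero_of_sum_ne_zero hgm
    rw [Finset.mem_filter] at hx
    exact ⟨x, hx.1, by rwa [hgv x m hx.2]⟩
  obtain ⟨m, hm, hmax⟩ := Finset.exists_max_image (f.coeff.support.filter (g · ≠ 0)) v
    ⟨m₁, Finset.mem_filter.2 hm₁⟩
  rw [Finset.mem_filter] at hm
  have hzero : ∑ x ∈ f.coeff.support with v m < v x,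
      (f.coeff x : QBar) * (α : QBar) ^ (κ x) = 0 := by
    rw [← Finset.sum_fiberwise_of_maps_to (g := v)
      (t := (f.coeff.support.filter (v m < v ·)).image v)
      fun x hx ↦ Finset.mem_image_of_mem _ hx]
    refine Finset.sum_eq_zero fun c hc ↦ ?_
    obtain ⟨x, hx, rfl⟩ := Finset.mem_image.1 hc
    rw [Finset.mem_filter] at hx
    by_contra h0
    have : g x ≠ 0 := by
      convert h0 using 1
      rw [hg, Finset.filter_filter]
      refine Finset.sum_congr (Finset.filter_congr fun y _ ↦ ?_) fun _ _ ↦ rfl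
      constructor
      · intro h1; exact ⟨h1 ▸ hx.2, h1⟩
      · exact fun h1 ↦ h1.2
    have := hmax x (Finset.mem_filter.2 ⟨hx.1, this⟩)
    omega
  have hsplit : g m = -∑ x ∈ f.coeff.support with v x < v m,
      (f.coeff x : QBar) * (α : QBar) ^ (κ x) := by
    rw [eq_neg_iff_add_eq_zero, ← hf, evalAt_apply, ← add_zero (g m + _), ← hzero, hg,
      ← Finset.sum_union, ← Finset.sum_union]
    · refine Finset.sum_congr ?_ fun x _ ↦ by rw [eq_intCast (algebraMap ℤ QBar)]
      ext x
      simp only [Finset.mem_union, Finset.mem_filter]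
      have := lt_trichotomy (v x) (v m)
      tauto
    · rw [Finset.disjoint_left]
      intro x hx
      simp only [Finset.mem_union, Finset.mem_filter] at hx ⊢
      omega
    · rw [Finset.disjoint_left]
      intro x hx
      simp only [Finset.mem_filter] at hx ⊢
      omega
  set y : QBar := (α : QBar) ^ (-κ m) * g m with hy
  have hy0 : y ≠ 0 := mul_ne_zero (zpow_ne_zero _ hα) hm.2
  have hcn (s : Finset M) (hs : s ⊆ f.coeff.support) :
      ∑ x ∈ s, |(f.coeff x : ℝ)| ≤ coeffNorm f :=
    Finset.sum_le_sum_of_subset_of_nonneg hs fun _ _ _ ↦ abs_nonneg _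
  have hq' : (0 : ℤ) < 8 * q := by omega
  have h1 : IsLaurentValue α (coeffNorm f) (Set.Ici (-((K : ℤ) / (8 * q)))) y := by
    refine ⟨M, f.coeff.support.filter (fun x ↦ v x = v m), f.coeff, fun x ↦ κ x - κ m, ?_,
      hcn _ (Finset.filter_subset _ _), ?_⟩
    · intro x hx
      rw [Finset.mem_filter] at hx
      have h1 := happ m hm.1 x hx.1
      rw [map_sub, map_sub, hx.2, sub_self, mul_zero, sub_zero] at h1
      rw [Set.mem_Ici, neg_le, Int.le_ediv_iff_mul_le hq']
      have := neg_abs_le (q * (κ x - κ m))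
      linarith
    · rw [hy, hg, Finset.mul_sum]
      refine Finset.sum_congr rfl fun x _ ↦ ?_
      simp only [sub_eq_add_neg, zpow_add₀ hα]
      ring
  have h2 : IsLaurentValue α (coeffNorm f) (Set.Iic ((-7 * K : ℤ) / (8 * q))) y := by
    refine ⟨M, f.coeff.support.filter (fun x ↦ v x < v m), fun x ↦ -f.coeff x,
      fun x ↦ κ x - κ m, ?_, ?_, ?_⟩
    · intro x hx
      rw [Finset.mem_filter] at hx
      have h1 := happ m hm.1 x hx.1
      rw [map_sub, map_sub] at h1
      rw [Set.mem_Iic, Int.le_ediv_iff_mul_le hq']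
      have h3 := le_abs_self (q * (κ x - κ m) - K * (v x - v m))
      have h4 : (K : ℤ) * (v x - v m) ≤ K * (-1) := by gcongr; omega
      linarith
    · simpa using hcn _ (Finset.filter_subset _ _)
    · rw [hy, hsplit, mul_neg, Finset.mul_sum, ← Finset.sum_neg_distrib]
      refine Finset.sum_congr rfl fun x _ ↦ ?_
      simp only [sub_eq_add_neg, zpow_add₀ hα]
      push_cast
      ring
  have h3 := hh.2 y y 1 _ _ _ one_pos hy0 (by simp) h2 h1 h2.mem_closure h1.mem_closure
  rw [Nat.cast_one, Real.log_one] at h3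
  have h4 : (((-7 * K : ℤ) / (8 * q) : ℤ) : ℝ) ≤ -7 * K / (8 * q) := by
    rw [le_div_iff₀ (by exact_mod_cast hq')]
    exact_mod_cast Int.ediv_mul_le (-7 * K : ℤ) hq'.ne'
  have h5 : (((K : ℤ) / (8 * q) : ℤ) : ℝ) ≤ K / (8 * q) := by
    rw [le_div_iff₀ (by exact_mod_cast hq')]
    exact_mod_cast Int.ediv_mul_le (K : ℤ) hq'.ne'
  have h6 : ((((-7 * K : ℤ) / (8 * q) : ℤ) : ℝ) + (((K : ℤ) / (8 * q) : ℤ) : ℝ)) * h ≤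
      -(6 * K / (8 * q)) * h := by
    refine mul_le_mul_of_nonneg_right ?_ hh.1
    refine (add_le_add h4 h5).trans_eq ?_
    ring
  have h7 : 6 * K / (8 * q) * h ≤ Real.log (coeffNorm f) := by linarith
  have hq1 : (1 : ℝ) ≤ q := by exact_mod_cast hq
  rw [div_mul_eq_mul_div, div_le_iff₀ (by positivity)] at h7
  have h8 : 0 ≤ h * K := mul_nonneg hh.1 (Nat.cast_nonneg _)
  nlinarith

theorem exists_height_le_of_coprime [Nontrivial M]
    (hM : ∀ v : M →ₗ[ℤ] ℤ, v ≠ 0 → GenericallyNonvanishing (LinearMap.ker v)) (P Q : ℤ[M])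
    (hPQ : ∀ D : ℚ[M], D ∣ AddMonoidAlgebra.mapRingHom M (algebraMap ℤ ℚ) P →
      D ∣ AddMonoidAlgebra.mapRingHom M (algebraMap ℤ ℚ) Q → IsUnit D) :
    ∃ C : ℝ, ∀ᶠ κ in generic M, ∀ α : QBarˣ, ¬ IsOfFinOrder α → evalAt ℤ κ α P = 0 →
      evalAt ℤ κ α Q = 0 → ∀ h, IsHeightBound α h → h * supNorm κ ≤ C := by
  classical
  obtain ⟨T, hT2, hT⟩ : ∃ T : ℕ, 2 ≤ T ∧ ∀ f ∈ ({P, Q} : Finset ℤ[M]), ∀ m ∈ f.coeff.support,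
      ∀ m' ∈ f.coeff.support, 8 * sumNorm (m' - m) ≤ T := by
    set S := P.coeff.support ∪ Q.coeff.support with hS
    refine ⟨(S ×ˢ S).sup (fun p ↦ (8 * sumNorm (p.2 - p.1)).toNat) + 2, by omega, ?_⟩
    intro f hf m hm m' hm'
    have hsub : f.coeff.support ⊆ S := by
      simp only [Finset.mem_insert, Finset.mem_singleton] at hf
      rcases hf with rfl | rfl
      · exact Finset.subset_union_left
      · exact Finset.subset_union_right
    have := Finset.le_sup (f := fun p : M × M ↦ (8 * sumNorm (p.2 - p.1)).toNat)
      (Finset.mem_product.2 ⟨hsub hm, hsub hm'⟩ : (m, m') ∈ S ×ˢ S)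
    simp only at this
    omega
  set n := Module.finrank ℤ M with hn
  obtain ⟨m₀, hm₀⟩ := exists_ne (0 : M)
  have hfin := (finite_setOf_abs_le M (T ^ n)).subset
    (Set.sep_subset _ (fun v : M →ₗ[ℤ] ℤ ↦ v ≠ 0))
  have hev : ∀ᶠ κ in generic M, ∀ v ∈ {v ∈ {v : M →ₗ[ℤ] ℤ | ∀ i,
      |v (Module.finBasis ℤ M i)| ≤ T ^ n} | v ≠ 0}, ∀ α : QBarˣ, ¬ IsOfFinOrder α →
      ∃ f ∈ ({P, Q} : Finset ℤ[M]), ∃ m, evalAt ℤ (κ ∘ₗ (LinearMap.ker v).subtype) α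
      (retr _ ℤ (AddMonoidAlgebra.single (-m) 1 * f)) ≠ 0 := by
    refine (eventually_all_finite hfin).2 fun v hv ↦ ?_
    set 𝒢 : Set ℚ[LinearMap.ker v] := {g | ∃ f ∈ ({P, Q} : Finset ℤ[M]), ∃ m,
      g = AddMonoidAlgebra.mapRingHom _ (algebraMap ℤ ℚ)
        (retr _ ℤ (AddMonoidAlgebra.single (-m) 1 * f))} with h𝒢
    have := hM v hv.2 (Ideal.span 𝒢) (fun D hD ↦ by
      have key (f) (hf : f ∈ ({P, Q} : Finset ℤ[M])) :
          emb _ ℚ D ∣ AddMonoidAlgebra.mapRingHom M (algebraMap ℤ ℚ) f := by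
        refine emb_dvd_of_forall_dvd_retr v fun m ↦ ?_
        rw [retr_mapRingHom]
        refine hD _ (Ideal.subset_span ⟨f, hf, -m, ?_⟩)
        rw [neg_neg]
      exact isUnit_of_isUnit_emb (hPQ _ (key P (by simp)) (key Q (by simp))))
    filter_upwards [(tendsto_generic (LinearMap.ker v).subtype
      (LinearMap.ker v).injective_subtype).eventually this] with κ hκ α hα
    by_contra! hcon
    obtain ⟨g, hg, hg0⟩ := hκ α hα
    refine hg0 ?_
    rw [← RingHom.mem_ker]
    refine Ideal.span_le.2 ?_ hg
    rintro _ ⟨f, hf, m, rfl⟩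
    rw [SetLike.mem_coe, RingHom.mem_ker, evalAt_mapRingHom]
    exact hcon f hf m
  refine ⟨max (2 * T ^ n * Real.log (coeffNorm P)) (2 * T ^ n * Real.log (coeffNorm Q)), ?_⟩
  filter_upwards [hev, eventually_generic hm₀] with κ hκ hκ0 α hα hP hQ h hh
  have hκne : κ ≠ 0 := by rintro rfl; exact hκ0 rfl
  obtain ⟨q, v, hq1, hqT, hv0, hvq, happ⟩ := exists_simultaneous_approx hκne hT2
  obtain ⟨f, hf, hne⟩ := hκ v ⟨fun i ↦ (hvq i).trans (by exact_mod_cast hqT), hv0⟩ α hα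
  have hf0 : evalAt ℤ κ α f = 0 := by
    simp only [Finset.mem_insert, Finset.mem_singleton] at hf
    rcases hf with rfl | rfl <;> assumption
  have h1 := height_le_of_cluster (K := supNorm κ) hh hq1 hf0 (fun m hm m' hm' ↦ ?_) hne
  · have hK : 0 ≤ h * supNorm κ := mul_nonneg hh.1 (Nat.cast_nonneg _)
    have hqpos : (0 : ℝ) < q := by exact_mod_cast hq1
    have h2 : 0 ≤ Real.log (coeffNorm f) := by
      by_contra! h3
      have := mul_neg_of_pos_of_neg (by positivity : (0 : ℝ) < 2 * q) h3
      linarith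
    have h3 : h * supNorm κ ≤ 2 * T ^ n * Real.log (coeffNorm f) := by
      refine h1.trans ?_
      gcongr
      exact_mod_cast hqT
    simp only [Finset.mem_insert, Finset.mem_singleton] at hf
    rcases hf with rfl | rfl
    · exact h3.trans (le_max_left _ _)
    · exact h3.trans (le_max_right _ _)
  · have h2 := approx_apply_le happ (by omega) (m' - m)
    have h3 := hT f hf m hm m' hm'
    set X := |(q : ℤ) * κ (m' - m) - (supNorm κ : ℕ) * v (m' - m)| with hX
    have hX0 : 0 ≤ X := abs_nonneg _
    have h4 : (T : ℤ) * (8 * X) ≤ T * (supNorm κ : ℕ) := by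
      calc (T : ℤ) * (8 * X) = 8 * (T * X) := by ring
        _ ≤ 8 * ((supNorm κ : ℕ) * sumNorm (m' - m)) := by linarith
        _ = (supNorm κ : ℕ) * (8 * sumNorm (m' - m)) := by ring
        _ ≤ (supNorm κ : ℕ) * T := by gcongr
        _ = _ := by ring
    exact le_of_mul_le_mul_left h4 (by omega)

end

end

section

section Slice

variable {R M : Type*} [CommRing R] [AddCommGroup M] {v : M →ₗ[ℤ] ℤ} {w : M}

theorem coeff_emb_retr (f : R[M]) (x : M) :
    (emb (LinearMap.ker v) R (retr _ R f)).coeff x = if v x = 0 then f.coeff x else 0 := by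
  split_ifs with h
  · rw [show x = ((⟨x, h⟩ : LinearMap.ker v) : M) from rfl, coeff_emb, coeff_retr]
  · exact coeff_emb_of_notMem _ h

/-- The homomorphism identifying a polynomial over the group ring of `ker v` with an element of the
group ring of the ambient group, where `X` goes to the group element `w`. -/
def unslice (R : Type*) [CommRing R] (v : M →ₗ[ℤ] ℤ) (w : M) :
    Polynomial R[LinearMap.ker v] →+* R[M] :=
  Polynomial.eval₂RingHom (emb _ R) (AddMonoidAlgebra.single w 1)

/-- The polynomial whose coefficients are the slices of `f` along the levels of `v`. -/
def slice (v : M →ₗ[ℤ] ℤ) (w : M) (a : ℤ) (N : ℕ) (f : R[M]) : Polynomial R[LinearMap.ker v] :=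
  ∑ j ∈ Finset.range (N + 1), Polynomial.monomial j
    (retr _ R (AddMonoidAlgebra.single (-((a + j) • w)) 1 * f))

theorem unslice_monomial (j : ℕ) (c : R[LinearMap.ker v]) :
    unslice R v w (Polynomial.monomial j c) =
      AddMonoidAlgebra.single ((j : ℤ) • w) 1 * emb _ R c := by
  rw [unslice, Polynomial.coe_eval₂RingHom, Polynomial.eval₂_monomial,
    AddMonoidAlgebra.single_pow, one_pow, mul_comm, natCast_zsmul]

theorem coeff_slice {a : ℤ} {N : ℕ} (f : R[M]) {j : ℕ} (hj : j ≤ N) :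
    (slice v w a N f).coeff j = retr _ R (AddMonoidAlgebra.single (-((a + j) • w)) 1 * f) := by
  rw [slice, Polynomial.finsetSum_coeff, Finset.sum_eq_single j]
  · simp
  · intro b _ hb
    rw [Polynomial.coeff_monomial, if_neg hb]
  · simp; omega

theorem natDegree_slice_le (a : ℤ) (N : ℕ) (f : R[M]) : (slice v w a N f).natDegree ≤ N := by
  refine Polynomial.natDegree_sum_le_of_forall_le _ _ fun j hj ↦ ?_
  exact (Polynomial.natDegree_monomial_le _).trans (by simpa [Nat.lt_succ_iff] using hj)

theorem coeff_unslice (hw : v w = 1) (D : Polynomial R[LinearMap.ker v]) (j : ℕ)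
    (x : LinearMap.ker v) :
    (unslice R v w D).coeff (x + (j : ℤ) • w) = (D.coeff j).coeff x := by
  induction D using Polynomial.induction_on' with
  | add f g hf hg =>
    rw [map_add (unslice R v w), AddMonoidAlgebra.coeff_add, Finsupp.add_apply, hf, hg,
      Polynomial.coeff_add, AddMonoidAlgebra.coeff_add, Finsupp.add_apply]
  | monomial n c =>
    rw [unslice_monomial, coeff_single_mul_eq, one_mul, Polynomial.coeff_monomial]
    split_ifs with h
    · subst h
      rw [add_sub_cancel_right, coeff_emb]
    · rw [coeff_emb_of_notMem]
      · simp
      · intro hx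
        have h0 := LinearMap.mem_ker.1 hx
        rw [map_sub, map_add, LinearMap.mem_ker.1 x.2, map_smul, map_smul, hw] at h0
        simp at h0
        omega

theorem unslice_slice (hw : v w = 1) {a : ℤ} {N : ℕ} {f : R[M]}
    (hf : ∀ x ∈ f.coeff.support, a ≤ v x ∧ v x ≤ a + N) :
    unslice R v w (slice v w a N f) = AddMonoidAlgebra.single (-(a • w)) 1 * f := by
  ext x
  rw [slice, map_sum, AddMonoidAlgebra.coeff_sum, Finset.sum_apply']
  simp only [unslice_monomial, coeff_single_mul_eq, one_mul, coeff_emb_retr]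
  have h1 (j : ℕ) : x - (j : ℤ) • w - -((a + j) • w) = x - -(a • w) := by
    rw [add_smul]; abel
  simp only [h1]
  by_cases hx : x - -(a • w) ∈ f.coeff.support
  · have := hf _ hx
    rw [sub_neg_eq_add, map_add, map_smul, hw, smul_eq_mul, mul_one] at this
    rw [Finset.sum_eq_single (v x).toNat]
    · rw [if_pos]
      rw [map_sub, map_smul, hw, smul_eq_mul, mul_one]
      omega
    · intro j _ hj
      rw [if_neg]
      rw [map_sub, map_smul, hw, smul_eq_mul, mul_one]
      omega
    · simp; omega
  · rw [Finsupp.notMem_support_iff] at hx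
    simp only [hx, ite_self, Finset.sum_const_zero]

end Slice

section Det

variable {R M : Type*} [CommRing R] [AddCommGroup M]

theorem sum_support_subset {ι : Type*} {s : Finset ι} {f : ι → R[M]} {S : Set M}
    (h : ∀ i ∈ s, ∀ x ∈ (f i).coeff.support, x ∈ S) {x : M}
    (hx : x ∈ (∑ i ∈ s, f i).coeff.support) : x ∈ S := by
  rw [Finsupp.mem_support_iff, AddMonoidAlgebra.coeff_sum, Finset.sum_apply'] at hx
  obtain ⟨i, hi, h0⟩ := Finset.exists_ne_zero_of_sum_ne_zero hx
  exact h i hi x (Finsupp.mem_support_iff.2 h0)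

theorem prod_support_bounds {ι : Type*} (u : M →ₗ[ℤ] ℤ) {s : Finset ι} {f : ι → R[M]} {a b : ι → ℤ}
    (h : ∀ i ∈ s, ∀ x ∈ (f i).coeff.support, a i ≤ u x ∧ u x ≤ b i) {x : M}
    (hx : x ∈ (∏ i ∈ s, f i).coeff.support) :
    ∑ i ∈ s, a i ≤ u x ∧ u x ≤ ∑ i ∈ s, b i := by
  classical
  induction s using Finset.induction_on generalizing x with
  | empty =>
    have := AddMonoidAlgebra.support_coeff_one_subset hx
    simp_all
  | insert i s hi ih =>
    rw [Finset.prod_insert hi] at hx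
    obtain ⟨y, hy, z, hz, rfl⟩ := Finset.mem_add.1 (AddMonoidAlgebra.support_coeff_mul_subset _ _ hx)
    have h1 := h i (Finset.mem_insert_self _ _) y hy
    have h2 := ih (fun j hj ↦ h j (Finset.mem_insert_of_mem hj)) hz
    rw [Finset.sum_insert hi, Finset.sum_insert hi, map_add]
    omega

theorem width_det_le {ι : Type*} [Fintype ι] [DecidableEq ι] (u : M →ₗ[ℤ] ℤ) (A : Matrix ι ι R[M])
    (r c : ι → ℤ) (S : ℕ)
    (h : ∀ i j, ∀ x ∈ (A i j).coeff.support, r i + c j ≤ u x ∧ u x ≤ r i + c j + S) :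
    width u A.det ≤ Fintype.card ι * S := by
  have key : ∀ x ∈ A.det.coeff.support, ∑ i, (r i + c i) ≤ u x ∧
      u x ≤ ∑ i, (r i + c i) + Fintype.card ι * S := by
    intro x hx
    rw [Matrix.det_apply] at hx
    refine sum_support_subset (S := {x | ∑ i, (r i + c i) ≤ u x ∧
      u x ≤ ∑ i, (r i + c i) + Fintype.card ι * S}) (fun σ _ y hy ↦ ?_) hx
    have hy' : y ∈ (∏ i, A (σ i) i).coeff.support := by
      rw [Finsupp.mem_support_iff] at hy ⊢
      rcases Int.units_eq_one_or (Equiv.Perm.sign σ) with h1 | h1 <;> rw [h1] at hy <;> simpa using hy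
    have h2 := prod_support_bounds u (fun i _ ↦ h (σ i) i) hy'
    simp only [Finset.sum_add_distrib, Equiv.sum_comp σ r, Finset.sum_const,
      Finset.card_univ, nsmul_eq_mul] at h2
    simpa only [Set.mem_ofPred_eq, Finset.sum_add_distrib] using h2
  rw [width_le_iff]
  intro m hm m' hm'
  have h1 := key m hm
  have h2 := key m' hm'
  push_cast
  linarith

end Det

section Elimination

variable {R : Type*} [Field R]

open Polynomial in
theorem isCoprime_map_of_isRelPrime {A : Type*} [CommRing A] [IsDomain A]
    [UniqueFactorizationMonoid A] {f g : A[X]} (hf : f ≠ 0)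
    (h : ∀ D : A[X], D ∣ f → D ∣ g → D.natDegree = 0) :
    IsCoprime (f.map (algebraMap A (FractionRing A))) (g.map (algebraMap A (FractionRing A))) := by
  let : NormalizedGCDMonoid A := Nonempty.some inferInstance
  have hinj := IsFractionRing.injective A (FractionRing A)
  refine isCoprime_of_irreducible_dvd (fun h0 ↦ hf ((Polynomial.map_eq_zero_iff hinj).1 h0.1))
    fun z hz h1 h2 ↦ ?_
  obtain ⟨c, hc0, hc⟩ := IsLocalization.integerNormalization_spec (nonZeroDivisors A) z
  set I := IsLocalization.integerNormalization (nonZeroDivisors A) z with hI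
  rw [Algebra.smul_def, Polynomial.algebraMap_apply] at hc
  have hc' : algebraMap A (FractionRing A) c ≠ 0 := by
    simpa using nonZeroDivisors.ne_zero hc0
  have hD : I.primPart.map (algebraMap A (FractionRing A)) ∣ z := by
    have h3 : I.primPart.map (algebraMap A (FractionRing A)) ∣ I.map (algebraMap A _) :=
      Polynomial.map_dvd _ (Polynomial.primPart_dvd I)
    rwa [hc, (Polynomial.isUnit_C.2 hc'.isUnit).dvd_mul_left] at h3
  have h3 := h I.primPart
    (I.isPrimitive_primPart.dvd_of_fraction_map_dvd_fraction_map (hD.trans h1))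
    (I.isPrimitive_primPart.dvd_of_fraction_map_dvd_fraction_map (hD.trans h2))
  rw [Polynomial.natDegree_primPart, ← Polynomial.natDegree_map_eq_of_injective hinj, hc,
    Polynomial.natDegree_C_mul hc'] at h3
  exact hz.natDegree_pos.ne' h3

variable {M : Type} [AddCommGroup M] [Module.Free ℤ M] [Module.Finite ℤ M]

theorem natDegree_eq_zero_of_dvd_slice {v : M →ₗ[ℤ] ℤ} {w : M} (hw : v w = 1) {P Q : R[M]}
    (hPQ : ∀ D : R[M], D ∣ P → D ∣ Q → IsUnit D) {a b : ℤ} {m n : ℕ}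
    (hP : ∀ x ∈ P.coeff.support, a ≤ v x ∧ v x ≤ a + m)
    (hQ : ∀ x ∈ Q.coeff.support, b ≤ v x ∧ v x ≤ b + n) 
    (h0 : (slice v w a m P).coeff 0 ≠ 0) {D : Polynomial R[LinearMap.ker v]}
    (h1 : D ∣ slice v w a m P) (h2 : D ∣ slice v w b n Q) : D.natDegree = 0 := by
  have hu (c : ℤ) : IsUnit (AddMonoidAlgebra.single (-(c • w)) (1 : R)) := isUnit_single _ isUnit_one
  have h3 := map_dvd (unslice R v w) h1
  have h4 := map_dvd (unslice R v w) h2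
  rw [unslice_slice hw hP, (hu a).dvd_mul_left] at h3
  rw [unslice_slice hw hQ, (hu b).dvd_mul_left] at h4
  obtain ⟨μ, c, hc, hD⟩ := eq_single_of_isUnit (hPQ _ h3 h4)
  have key (j : ℕ) (hj : D.coeff j ≠ 0) : v μ = j := by
    obtain ⟨x, hx⟩ := Finsupp.support_nonempty_iff.2 (by simpa using hj : (D.coeff j).coeff ≠ 0)
    rw [Finsupp.mem_support_iff, ← coeff_unslice hw, hD, AddMonoidAlgebra.coeff_single,
      Finsupp.single_apply_ne_zero] at hx
    rw [← hx.1, map_add, LinearMap.mem_ker.1 x.2, map_smul, hw]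
    simp
  have hD0 : D.coeff 0 ≠ 0 := by
    obtain ⟨E, hE⟩ := h1
    rw [hE, Polynomial.mul_coeff_zero] at h0
    exact left_ne_zero_of_mul h0
  have h5 := key 0 hD0
  have h6 := key D.natDegree (by
    rw [Polynomial.coeff_natDegree, Polynomial.leadingCoeff_ne_zero]
    rintro rfl
    simp at hD0)
  omega

theorem slice_coeff_bounds {v : M →ₗ[ℤ] ℤ} {w : M} {a : ℤ} {N : ℕ} {f : R[M]} {u : M →ₗ[ℤ] ℤ}
    {L S : ℤ} (h : ∀ x ∈ f.coeff.support, L ≤ u x ∧ u x ≤ L + S) (j : ℕ) :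
    ∀ x ∈ ((slice v w a N f).coeff j).coeff.support,
      L - (a + j) * u w ≤ u (x : M) ∧ u (x : M) ≤ L - (a + j) * u w + S := by
  intro x hx
  by_cases hj : j ≤ N
  · rw [coeff_slice f hj, Finsupp.mem_support_iff, coeff_retr, coeff_single_mul_eq, one_mul,
      ← Finsupp.mem_support_iff] at hx
    have := h _ hx
    rw [map_sub, map_neg, map_smul, smul_eq_mul] at this
    constructor <;> linarith
  · rw [Polynomial.coeff_eq_zero_of_natDegree_lt ((natDegree_slice_le _ _ _).trans_lt (by omega))] at hx
    simp at hx

theorem emb_mem_span_pair_of_apply_eq_one {P Q : R[M]} (hP : P ≠ 0) (hQ : Q ≠ 0)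
    (hPQ : ∀ D : R[M], D ∣ P → D ∣ Q → IsUnit D) {S : ℕ} (hS : 1 ≤ S)
    (hPS : ∀ x ∈ P.coeff.support, ∀ y ∈ P.coeff.support, sumNorm (x - y) ≤ S)
    (hQS : ∀ x ∈ Q.coeff.support, ∀ y ∈ Q.coeff.support, sumNorm (x - y) ≤ S)
    {v : M →ₗ[ℤ] ℤ} {w : M} (hw : v w = 1) {q : ℕ} (hq : 1 ≤ q)
    (hv : ∀ i, |v (Module.finBasis ℤ M i)| ≤ q) :
    ∃ F : R[LinearMap.ker v], F ≠ 0 ∧ emb _ R F ∈ Ideal.span {P, Q} ∧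
      ∀ i, width ((Module.finBasis ℤ M).coord i ∘ₗ (LinearMap.ker v).subtype) F ≤
        2 * S ^ 2 * q := by
  have hcoord (f : R[M]) (hf : f ≠ 0) (h : ∀ x ∈ f.coeff.support, ∀ y ∈ f.coeff.support,
      sumNorm (x - y) ≤ S) (i) : ∃ L : ℤ, ∀ x ∈ f.coeff.support,
      L ≤ (Module.finBasis ℤ M).coord i x ∧ (Module.finBasis ℤ M).coord i x ≤ L + S := by
    obtain ⟨x₀, h0, hx₀⟩ := Finset.exists_min_image f.coeff.support
      ((Module.finBasis ℤ M).coord i) (Finsupp.support_nonempty_iff.2 (by simpa using hf))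
    refine ⟨_, fun x hx ↦ ⟨hx₀ x hx, ?_⟩⟩
    have h1 : |(Module.finBasis ℤ M).repr (x - x₀) i| ≤ sumNorm (x - x₀) :=
      Finset.single_le_sum (f := fun i ↦ |(Module.finBasis ℤ M).repr (x - x₀) i|)
        (fun _ _ ↦ abs_nonneg _) (Finset.mem_univ i)
    have h2 := (le_abs_self _).trans (h1.trans (h x hx x₀ h0))
    rw [map_sub, Finsupp.sub_apply] at h2
    rw [Module.Basis.coord_apply, Module.Basis.coord_apply]
    linarith
  have hlev (f : R[M]) (hf : f ≠ 0) (h : ∀ x ∈ f.coeff.support, ∀ y ∈ f.coeff.support,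
      sumNorm (x - y) ≤ S) : ∃ a : ℤ, (∀ x ∈ f.coeff.support, a ≤ v x ∧ v x ≤ a + (S * q : ℕ)) ∧
        (slice v w a (S * q) f).coeff 0 ≠ 0 := by
    obtain ⟨x₀, h0, hx₀⟩ := Finset.exists_min_image f.coeff.support v
      (Finsupp.support_nonempty_iff.2 (by simpa using hf))
    refine ⟨v x₀, fun x hx ↦ ⟨hx₀ x hx, ?_⟩, ?_⟩
    · have h1 := approx_apply_le (κ := v) (v := 0) (T := 1) (q := 1) (K := q)
        (fun i ↦ by simpa using hv i) zero_le_one (x - x₀)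
      simp only [one_mul, LinearMap.zero_apply, mul_zero, sub_zero, map_sub] at h1
      have h2 := (le_abs_self _).trans h1
      have h3 : (q : ℤ) * sumNorm (x - x₀) ≤ q * S := by gcongr; exact h x hx x₀ h0
      push_cast
      linarith
    · rw [coeff_slice f (Nat.zero_le _)]
      intro h1
      have h2 : (retr (LinearMap.ker v) R (AddMonoidAlgebra.single
        (-((v x₀ + (0 : ℕ)) • w)) 1 * f)).coeff ⟨x₀ - v x₀ • w, by simp [hw]⟩ = 0 := by
        rw [h1]; rfl
      rw [coeff_retr, coeff_single_mul_eq] at h2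
      rw [Finsupp.mem_support_iff] at h0
      simp at h2
      exact h0 h2
  obtain ⟨a, ha, ha0⟩ := hlev P hP hPS
  obtain ⟨b, hb, hb0⟩ := hlev Q hQ hQS
  set f := slice v w a (S * q) P with hf
  set g := slice v w b (S * q) Q with hg
  have hunit (c : ℤ) : IsUnit (AddMonoidAlgebra.single (-(c • w)) (1 : R)) :=
    isUnit_single _ isUnit_one
  have hPm : unslice R v w f ∈ Ideal.span {P, Q} := by
    rw [hf, unslice_slice hw ha]
    exact Ideal.mul_mem_left _ _ (Ideal.subset_span (by simp))
  have hQm : unslice R v w g ∈ Ideal.span {P, Q} := by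
    rw [hg, unslice_slice hw hb]
    exact Ideal.mul_mem_left _ _ (Ideal.subset_span (by simp))
  have hfd : f.natDegree ≤ S * q := natDegree_slice_le _ _ _
  have hgd : g.natDegree ≤ S * q := natDegree_slice_le _ _ _
  by_cases hd : f.natDegree = 0
  · refine ⟨f.coeff 0, ha0, ?_, fun i ↦ ?_⟩
    · rw [Polynomial.eq_C_of_natDegree_eq_zero hd] at hPm
      simpa [unslice] using hPm
    · obtain ⟨L, hL⟩ := hcoord P hP hPS i
      have h1 := slice_coeff_bounds (v := v) (w := w) (a := a) (N := S * q) hL 0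
      rw [width_le_iff]
      intro x hx y hy
      have hx := h1 x hx
      have hy := h1 y hy
      have : S ≤ 2 * S ^ 2 * q := by nlinarith [Nat.mul_le_mul hS hq]
      simp only [LinearMap.comp_apply, Submodule.subtype_apply]
      zify at this
      push_cast
      linarith
  · refine ⟨f.resultant g, ?_, ?_, fun i ↦ ?_⟩
    · have hcop := isCoprime_map_of_isRelPrime (f := f) (g := g) (by rintro h; simp [h] at hd)
        fun D h1 h2 ↦ natDegree_eq_zero_of_dvd_slice hw hPQ ha hb ha0 h1 h2
      have h2 := Polynomial.resultant_ne_zero _ _ hcop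
      have hinj := IsFractionRing.injective R[LinearMap.ker v] (FractionRing R[LinearMap.ker v])
      rw [Polynomial.natDegree_map_eq_of_injective hinj,
        Polynomial.natDegree_map_eq_of_injective hinj, Polynomial.resultant_map_map] at h2
      exact fun h ↦ h2 (by rw [h, map_zero])
    · obtain ⟨p, r, -, -, h⟩ := Polynomial.exists_mul_add_mul_eq_C_resultant f g le_rfl le_rfl
        (Or.inl hd)
      have h1 : unslice R v w (f * p + g * r) = emb _ R (f.resultant g) := by
        rw [h]; simp [unslice]
      rw [← h1, map_add, map_mul, map_mul]
      exact add_mem (Ideal.mul_mem_right _ _ hPm) (Ideal.mul_mem_right _ _ hQm)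
    · obtain ⟨L, hL⟩ := hcoord P hP hPS i
      obtain ⟨L', hL'⟩ := hcoord Q hQ hQS i
      set u := (Module.finBasis ℤ M).coord i with hu
      have h1 := slice_coeff_bounds (v := v) (w := w) (a := a) (N := S * q) hL
      have h2 := slice_coeff_bounds (v := v) (w := w) (a := b) (N := S * q) hL'
      rw [← hf] at h1
      rw [← hg] at h2
      have h3 := width_det_le (u ∘ₗ (LinearMap.ker v).subtype)
        (f.sylvester g f.natDegree g.natDegree) (fun i ↦ -(i : ℕ) * u w)
        (fun j ↦ j.addCases (fun j₁ ↦ L' - (b - (j₁ : ℕ)) * u w)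
          (fun j₁ ↦ L - (a - (j₁ : ℕ)) * u w)) S (by
          intro i j x hx
          induction j using Fin.addCases with
          | left j =>
            simp only [Polynomial.sylvester, Matrix.of_apply, Fin.addCases_left] at hx ⊢
            split_ifs at hx with hij
            · have h4 := h2 _ x hx
              rw [Set.mem_Icc] at hij
              rw [Nat.cast_sub hij.1] at h4
              simp only [LinearMap.comp_apply, Submodule.subtype_apply]
              constructor <;> linarith
            · simp at hx
          | right j =>
            simp only [Polynomial.sylvester, Matrix.of_apply, Fin.addCases_right] at hx ⊢
            split_ifs at hx with hij
            · have h4 := h1 _ x hx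
              rw [Set.mem_Icc] at hij
              rw [Nat.cast_sub hij.1] at h4
              simp only [LinearMap.comp_apply, Submodule.subtype_apply]
              constructor <;> linarith
            · simp at hx)
      refine h3.trans ?_
      rw [Fintype.card_fin]
      calc _ ≤ (S * q + S * q) * S := by gcongr
        _ = _ := by ring

theorem exists_emb_mem_span_pair {P Q : R[M]} (hP : P ≠ 0) (hQ : Q ≠ 0)
    (hPQ : ∀ D : R[M], D ∣ P → D ∣ Q → IsUnit D) :
    ∃ A : ℕ, ∀ (v : M →ₗ[ℤ] ℤ) (q : ℕ), v ≠ 0 → 1 ≤ q → (∀ i, |v (Module.finBasis ℤ M i)| ≤ q) →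
      ∃ F : R[LinearMap.ker v], F ≠ 0 ∧ emb _ R F ∈ Ideal.span {P, Q} ∧
        ∀ i, width ((Module.finBasis ℤ M).coord i ∘ₗ (LinearMap.ker v).subtype) F ≤ A * q := by
  classical
  obtain ⟨S, hS1, hS⟩ : ∃ S : ℕ, 1 ≤ S ∧ ∀ f ∈ ({P, Q} : Finset R[M]), ∀ m ∈ f.coeff.support,
      ∀ m' ∈ f.coeff.support, sumNorm (m - m') ≤ S := by
    refine ⟨(({P, Q} : Finset R[M]).sup fun f ↦ (f.coeff.support ×ˢ f.coeff.support).sup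
      fun p ↦ (sumNorm (p.1 - p.2)).toNat) + 1, by omega, ?_⟩
    intro f hf m hm m' hm'
    have h1 := Finset.le_sup (f := fun f : R[M] ↦ (f.coeff.support ×ˢ f.coeff.support).sup
      fun p ↦ (sumNorm (p.1 - p.2)).toNat) hf
    have h2 := Finset.le_sup (f := fun p : M × M ↦ (sumNorm (p.1 - p.2)).toNat)
      (Finset.mem_product.2 ⟨hm, hm'⟩ :
        (m, m') ∈ f.coeff.support ×ˢ f.coeff.support)
    simp only at h1 h2
    omega
  refine ⟨2 * S ^ 2, fun v q hv hq hvq ↦ ?_⟩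
  obtain ⟨d, hd⟩ := (inferInstance : (LinearMap.range v).IsPrincipal).principal
  have hdvd (x : M) : d ∣ v x := by
    have : v x ∈ LinearMap.range v := LinearMap.mem_range_self v x
    rw [hd] at this
    exact Ideal.mem_span_singleton.1 this
  have hd0 : d ≠ 0 := by
    rintro rfl
    exact hv (LinearMap.ext fun x ↦ zero_dvd_iff.1 (hdvd x))
  let v' : M →ₗ[ℤ] ℤ :=
    { toFun := fun x ↦ v x / d
      map_add' := fun x y ↦ by rw [map_add, Int.add_ediv_of_dvd_left (hdvd x)]
      map_smul' := fun c x ↦ by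
        rw [map_smul, smul_eq_mul, Int.mul_ediv_assoc _ (hdvd x), RingHom.id_apply, smul_eq_mul] }
  have hv' (x : M) : v x = d * v' x := (Int.mul_ediv_cancel' (hdvd x)).symm
  have hker : LinearMap.ker v' = LinearMap.ker v := by
    ext x
    rw [LinearMap.mem_ker, LinearMap.mem_ker, hv', mul_eq_zero, or_iff_right hd0]
  obtain ⟨w, hw⟩ : ∃ w, v w = d := by
    have : d ∈ LinearMap.range v := by rw [hd]; exact Submodule.mem_span_singleton_self d
    exact this
  rw [← hker]
  refine emb_mem_span_pair_of_apply_eq_one hP hQ hPQ hS1 (hS P (by simp)) (hS Q (by simp))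
    (w := w) ?_ hq fun i ↦ le_trans ?_ (hvq i)
  · rw [hv' w] at hw
    exact mul_left_cancel₀ hd0 (hw.trans (mul_one d).symm)
  · rw [hv', abs_mul]
    exact le_mul_of_one_le_left (abs_nonneg _) (Int.one_le_abs hd0)

end Elimination

end

section

theorem exists_small_of_large_ker {ι V : Type*} [Fintype ι] [AddCommGroup V]
    [Module.IsTorsionFree ℤ V] (J : (ι → ℤ) →ₗ[ℤ] V) {s θ X : ℕ} (hX : 2 ≤ X)
    (hs : s ≤ Module.finrank ℤ (LinearMap.ker J))
    (hθ : θ * (Fintype.card ι - s) < Fintype.card ι) :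
    ∃ G G' : ι → ℤ, G ≠ 0 ∧ (∀ i, |G i| ≤ X) ∧ J G = X ^ θ • J G' := by
  classical
  have hrank : Module.finrank ℤ (LinearMap.range J) ≤ Fintype.card ι - s := by
    have h1 := (LinearMap.ker J).finrank_quotient_add_finrank
    rw [J.quotKerEquivRange.finrank_eq, Module.finrank_fintype_fun_eq_card] at h1
    omega
  let b := Module.finBasis ℤ (LinearMap.range J)
  have : NeZero X := ⟨by omega⟩
  obtain ⟨x, y, hxy, h⟩ := Fintype.exists_ne_map_eq_of_card_lt
    (fun (x : ι → Fin X) (k : Fin (Module.finrank ℤ (LinearMap.range J))) ↦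
      ((b.repr (J.rangeRestrict fun i ↦ ((x i : ℕ) : ℤ)) k : ℤ) : ZMod (X ^ θ))) (by
    rw [Fintype.card_fun, Fintype.card_fun, ZMod.card, Fintype.card_fin, Fintype.card_fin,
      ← pow_mul]
    exact Nat.pow_lt_pow_right (by omega) ((Nat.mul_le_mul_left _ hrank).trans_lt hθ))
  have hdvd (k) : ((X ^ θ : ℕ) : ℤ) ∣ b.repr (J.rangeRestrict fun i ↦ ((x i : ℕ) : ℤ) - (y i : ℕ)) k := by
    have h1 := congrFun h k
    simp only [ZMod.intCast_eq_intCast_iff_dvd_sub] at h1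
    rw [← neg_sub, dvd_neg, ← Finsupp.sub_apply, ← map_sub, ← map_sub] at h1
    exact h1
  choose c hc using hdvd
  obtain ⟨⟨_, G', rfl⟩, hG'⟩ : ∃ z : LinearMap.range J, b.repr z = Finsupp.equivFunOnFinite.symm c :=
    b.repr.surjective _
  refine ⟨fun i ↦ ((x i : ℕ) : ℤ) - (y i : ℕ), G', ?_, fun i ↦ ?_, ?_⟩
  · intro h0
    refine hxy (funext fun i ↦ Fin.ext ?_)
    have := congrFun h0 i
    simp only [Pi.zero_apply] at this
    omega
  · have := (x i).2
    have := (y i).2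
    change |((x i : ℕ) : ℤ) - (y i : ℕ)| ≤ X
    rw [abs_le]
    omega
  · have : J.rangeRestrict (fun i ↦ ((x i : ℕ) : ℤ) - (y i : ℕ)) =
        X ^ θ • (⟨J G', G', rfl⟩ : LinearMap.range J) := by
      apply b.repr.injective
      ext k
      rw [hc, map_nsmul, hG']
      simp
    exact congrArg Subtype.val this

section MonomialDerivation

variable {R M : Type*} [CommRing R] [AddCommGroup M]

/-- The derivation multiplying each monomial `m` by `u m`. -/
def monDeriv (u : M →ₗ[ℤ] ℤ) (f : R[M]) : R[M] :=
  ∑ m ∈ f.coeff.support, AddMonoidAlgebra.single m ((u m : R) * f.coeff m)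

@[simp] theorem coeff_monDeriv (u : M →ₗ[ℤ] ℤ) (f : R[M]) (m : M) :
    (monDeriv u f).coeff m = u m * f.coeff m := by
  classical
  rw [monDeriv, AddMonoidAlgebra.coeff_sum, Finset.sum_apply']
  simp only [AddMonoidAlgebra.coeff_single, Finsupp.single_apply, Finset.sum_ite_eq']
  split_ifs with h
  · rfl
  · rw [Finsupp.notMem_support_iff.1 h, mul_zero]

theorem monDeriv_add (u : M →ₗ[ℤ] ℤ) (f g : R[M]) :
    monDeriv u (f + g) = monDeriv u f + monDeriv u g := by
  ext; simp [mul_add]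

theorem monDeriv_mul (u : M →ₗ[ℤ] ℤ) (f g : R[M]) :
    monDeriv u (f * g) = monDeriv u f * g + f * monDeriv u g := by
  have hs (m : M) (r : R) : monDeriv u (AddMonoidAlgebra.single m r) =
      AddMonoidAlgebra.single m (u m * r) := by
    classical
    ext x
    simp only [coeff_monDeriv, AddMonoidAlgebra.coeff_single, Finsupp.single_apply]
    split_ifs with h <;> simp [h]
  have h0 : monDeriv u (0 : R[M]) = 0 := by ext; simp
  induction f using AddMonoidAlgebra.induction_linear with
  | zero => simp [h0]
  | add f g hf hg => rw [add_mul, monDeriv_add, hf, hg, monDeriv_add]; ring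
  | single m r =>
    induction g using AddMonoidAlgebra.induction_linear with
    | zero => simp [h0]
    | add f g hf hg => rw [mul_add, monDeriv_add, hf, hg, monDeriv_add]; ring
    | single n s =>
      rw [AddMonoidAlgebra.single_mul_single, hs, hs, hs, AddMonoidAlgebra.single_mul_single,
        AddMonoidAlgebra.single_mul_single, ← AddMonoidAlgebra.single_add]
      congr 1
      rw [map_add]
      push_cast
      ring

theorem pow_dvd_monDeriv (u : M →ₗ[ℤ] ℤ) {f g : R[M]} {k : ℕ} (h : f ^ (k + 1) ∣ g) :
    f ^ k ∣ monDeriv u g := by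
  obtain ⟨c, rfl⟩ := h
  rw [monDeriv_mul]
  refine dvd_add (Dvd.dvd.mul_right ?_ _) ((pow_dvd_pow f k.le_succ).mul_right _)
  clear c
  induction k with
  | zero => simp
  | succ k ih =>
    rw [pow_succ f (k + 1), monDeriv_mul]
    refine dvd_add ?_ (dvd_mul_right _ _)
    rw [pow_succ]
    exact mul_dvd_mul_right ih _

theorem pow_dvd_foldr_monDeriv (l : List (M →ₗ[ℤ] ℤ)) {f g : R[M]} {k : ℕ}
    (h : f ^ (k + l.length) ∣ g) : f ^ k ∣ l.foldr monDeriv g := by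
  induction l generalizing k with
  | nil => simpa using h
  | cons u l ih =>
    rw [List.foldr_cons]
    refine pow_dvd_monDeriv _ (ih ?_)
    rwa [List.length_cons, add_comm l.length, ← add_assoc] at h

theorem coeff_foldr_monDeriv (l : List (M →ₗ[ℤ] ℤ)) (f : R[M]) (m : M) :
    (l.foldr monDeriv f).coeff m = (l.map fun u ↦ ((u m : ℤ) : R)).prod * f.coeff m := by
  induction l with
  | nil => simp
  | cons u l ih => rw [List.foldr_cons, coeff_monDeriv, ih, List.map_cons, List.prod_cons, mul_assoc]

end MonomialDerivation

section AuxiliaryPolynomial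

variable {K M : Type} [Field K] [CharZero K] [AddCommGroup M] [Module.Free ℤ M] [Module.Finite ℤ M]

theorem exists_small_vanishing_jets {κ : M →ₗ[ℤ] ℤ} {α : Kˣ} {h : ℝ} (hh : IsHeightBound α h)
    {F : ℤ[M]} (hF : F ≠ 0) (hF0 : evalAt ℤ κ α F = 0) {e θ : ℕ} {S S' : Finset M}
    (hSS' : ∀ m ∈ S', ∀ x ∈ (F ^ e).coeff.support, m + x ∈ S)
    (hcard : θ * (S.card - S'.card) < S.card) {ι : Type} [Fintype ι]
    (l : ι → List (M →ₗ[ℤ] ℤ)) (hl : ∀ j, (l j).length < e) {B : ℝ}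
    (hB : ∀ j, ∀ m ∈ S, |((((l j).map fun u ↦ u m).prod : ℤ) : ℝ)| ≤ B) {W : ℤ} (hW : ∀ m ∈ S, |κ m| ≤ W)
    {X : ℕ} (hX : 2 ≤ X)
    (hlog : Real.log (S.card * X * B) + 2 * W * h < θ * Real.log X) :
    ∃ G : M → ℤ, (∃ m ∈ S, G m ≠ 0) ∧ (∀ m ∈ S, |G m| ≤ X) ∧
      ∀ j, ∑ m ∈ S, (G m : K) * (((l j).map fun u ↦ u m).prod : ℤ) * (α : K) ^ κ m = 0 := by
  classical
  let J : (S → ℤ) →ₗ[ℤ] (ι → K) :=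
    { toFun := fun G j ↦ ∑ m : S, (G m : K) * (((l j).map fun u ↦ u (m : M)).prod : ℤ) *
        (α : K) ^ κ m
      map_add' := fun x y ↦ by
        ext j
        simp only [Pi.add_apply, ← Finset.sum_add_distrib]
        refine Finset.sum_congr rfl fun m _ ↦ ?_
        push_cast
        ring
      map_smul' := fun c x ↦ by
        ext j
        simp only [Pi.smul_apply, smul_eq_mul, RingHom.id_apply, zsmul_eq_mul, Finset.mul_sum]
        refine Finset.sum_congr rfl fun m _ ↦ ?_
        push_cast
        ring }
  let hat : (S' → ℤ) → ℤ[M] := fun c ↦ ∑ m : S', AddMonoidAlgebra.single (m : M) (c m)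
  have hat_coeff (c : S' → ℤ) (m : S') : (hat c).coeff m = c m := by
    simp only [hat, AddMonoidAlgebra.coeff_sum, Finset.sum_apply',
      AddMonoidAlgebra.coeff_single, Finsupp.single_apply]
    rw [Finset.sum_eq_single m]
    · simp
    · intro b _ hb
      rw [if_neg]
      exact fun h ↦ hb (Subtype.ext h)
    · simp
  have hat_supp (c : S' → ℤ) {x : M} (hx : x ∈ (F ^ e * hat c).coeff.support) : x ∈ S := by
    obtain ⟨y, hy, z, hz, rfl⟩ := Finset.mem_add.1 (AddMonoidAlgebra.support_coeff_mul_subset _ _ hx)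
    rw [add_comm]
    refine hSS' z ?_ y hy
    refine sum_support_subset (S := (S' : Set M)) (fun i _ w hw ↦ ?_) hz
    rw [AddMonoidAlgebra.coeff_single] at hw
    have := Finsupp.support_single_subset hw
    rw [Finset.mem_singleton] at this
    rw [this]
    exact i.2
  let L : (S' → ℤ) →ₗ[ℤ] LinearMap.ker J :=
    LinearMap.codRestrict _
    { toFun := fun c m ↦ (F ^ e * hat c).coeff m
      map_add' := fun c d ↦ by
        ext m
        have : hat (c + d) = hat c + hat d := by
          simp [hat, Finset.sum_add_distrib]
        simp [this, mul_add]
      map_smul' := fun c x ↦ by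
        ext m
        have : hat (c • x) = c • hat x := by
          simp [hat, Finset.smul_sum]
        rw [this, mul_smul_comm]
        rfl } (fun c ↦ by
      rw [LinearMap.mem_ker]
      ext j
      have h1 : evalAt ℤ κ α ((l j).foldr monDeriv (F ^ e * hat c)) = 0 := by
        have h2 : F ^ 1 ∣ (l j).foldr monDeriv (F ^ e * hat c) :=
          pow_dvd_foldr_monDeriv _ ((pow_dvd_pow F (by have := hl j; omega)).mul_right _)
        rw [pow_one] at h2
        obtain ⟨r, hr⟩ := h2
        rw [hr, map_mul, hF0, zero_mul]
      rw [evalAt_apply] at h1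
      rw [Pi.zero_apply, ← h1]
      change ∑ m : S, ((F ^ e * hat c).coeff m : K) * (((l j).map fun u ↦ u (m : M)).prod : ℤ) *
        (α : K) ^ κ m = _
      rw [Finset.sum_coe_sort S fun m ↦ ((F ^ e * hat c).coeff m : K) *
        (((l j).map fun u ↦ u (m : M)).prod : ℤ) * (α : K) ^ κ m]
      symm
      have h3 (m : M) : ((F ^ e * hat c).coeff m : K) *
          (((l j).map fun u ↦ u (m : M)).prod : ℤ) * (α : K) ^ κ m =
          algebraMap ℤ K (((l j).foldr monDeriv (F ^ e * hat c)).coeff m) * (α : K) ^ κ m := by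
        rw [coeff_foldr_monDeriv, eq_intCast]
        push_cast
        ring
      simp only [h3]
      refine Finset.sum_subset (fun m hm ↦ hat_supp c ?_) fun m _ hm ↦ ?_
      · rw [Finsupp.mem_support_iff, coeff_foldr_monDeriv] at hm
        exact Finsupp.mem_support_iff.2 (right_ne_zero_of_mul hm)
      · rw [Finsupp.notMem_support_iff.1 hm, map_zero, zero_mul])
  have hL : Function.Injective L := by
    rw [injective_iff_map_eq_zero]
    intro c hc
    have h1 : F ^ e * hat c = 0 := by
      ext m
      by_cases hm : m ∈ S
      · exact congrFun (congrArg Subtype.val hc) ⟨m, hm⟩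
      · exact Finsupp.notMem_support_iff.1 fun h ↦ hm (hat_supp c h)
    have h2 := (mul_eq_zero.1 h1).resolve_left (pow_ne_zero _ hF)
    ext m
    rw [← hat_coeff c m, h2]
    rfl
  have hs := LinearMap.finrank_le_finrank_of_injective hL
  rw [Module.finrank_fintype_fun_eq_card, Fintype.card_coe] at hs
  obtain ⟨G, G', hG0, hGX, hGJ⟩ := exists_small_of_large_ker J (θ := θ) hX hs
    (by rwa [Fintype.card_coe])
  have hSne : S.Nonempty := Finset.card_pos.1 (by omega)
  have hW0 : 0 ≤ W := (abs_nonneg _).trans (hW _ hSne.choose_spec)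
  refine ⟨fun m ↦ if hm : m ∈ S then G ⟨m, hm⟩ else 0, ?_, ?_, fun j ↦ ?_⟩
  · obtain ⟨m, hm⟩ := Function.ne_iff.1 hG0
    exact ⟨m, m.2, by simpa using hm⟩
  · intro m hm
    simpa [hm] using hGX ⟨m, hm⟩
  · rw [← Finset.sum_coe_sort]
    have h1 : J G j = 0 := by
      by_contra hne
      have hlv (P : Set ℤ) (hP : ∀ m ∈ S, κ m ∈ P) :
          IsLaurentValue α (S.card * X * B) P (J G j) := by
        refine ⟨S, Finset.univ, fun m ↦ G m * ((l j).map fun u ↦ u (m : M)).prod, fun m ↦ κ m,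
          fun m _ ↦ hP m m.2, ?_, ?_⟩
        · calc _ ≤ ∑ m : S, (X : ℝ) * B := by
                refine Finset.sum_le_sum fun m _ ↦ ?_
                rw [Int.cast_mul, abs_mul]
                exact mul_le_mul (by exact_mod_cast hGX m) (hB j m m.2) (abs_nonneg _)
                  (Nat.cast_nonneg _)
            _ = _ := by simp [mul_assoc]
        · simp [J]
      have hcl (P : Set ℤ) (hP : ∀ m ∈ S, κ m ∈ P) :
          J G' j ∈ AddSubgroup.closure ((fun n : ℤ ↦ (α : K) ^ n) '' P) := by
        refine sum_mem fun m _ ↦ ?_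
        rw [← Int.cast_mul, ← zsmul_eq_mul]
        exact zsmul_mem (AddSubgroup.subset_closure (Set.mem_image_of_mem _ (hP m m.2))) _
      have h2 := hh.2 (J G j) (J G' j) (X ^ θ) W W _ (by positivity) hne (by
        rw [hGJ]
        simp) (hlv _ fun m hm ↦ (abs_le.1 (hW m hm)).2) (hlv _ fun m hm ↦ (abs_le.1 (hW m hm)).1)
        (hcl _ fun m hm ↦ (abs_le.1 (hW m hm)).2) (hcl _ fun m hm ↦ (abs_le.1 (hW m hm)).1)
      push_cast at h2
      rw [Real.log_pow] at h2
      linarith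
    rw [← h1]
    refine Finset.sum_congr rfl fun m _ ↦ ?_
    simp

end AuxiliaryPolynomial

end

section

section FrobeniusTwist

open Polynomial

variable {K : Type*} [Field K] [CharZero K]

theorem exists_generator_of_isAlgebraic {α : K} (hα : IsAlgebraic ℚ α) :
    ∃ f : Polynomial ℤ, aeval α f = 0 ∧ aeval α (derivative f) ≠ 0 ∧
      ∀ c : Polynomial ℤ, aeval α c = 0 → f ∣ c := by
  obtain ⟨b, hb, hN⟩ := IsLocalization.integerNormalization_spec (nonZeroDivisors ℤ) (minpoly ℚ α)
  set N := IsLocalization.integerNormalization (nonZeroDivisors ℤ) (minpoly ℚ α)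
  have hb0 : b ≠ 0 := nonZeroDivisors.ne_zero hb
  have hm0 : minpoly ℚ α ≠ 0 := minpoly.ne_zero hα.isIntegral
  have hN0 : N ≠ 0 := by
    intro h
    rw [h, Polynomial.map_zero, eq_comm, smul_eq_zero] at hN
    exact hN.elim hb0 hm0
  have hdvd : N.primPart.map (algebraMap ℤ ℚ) ∣ minpoly ℚ α := by
    have h1 : N.primPart.map (algebraMap ℤ ℚ) ∣ N.map (algebraMap ℤ ℚ) :=
      Polynomial.map_dvd _ N.primPart_dvd
    rw [hN, ← Int.cast_smul_eq_zsmul ℚ, smul_eq_C_mul] at h1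
    exact (isUnit_C.2 (by simpa using hb0)).dvd_mul_left.1 h1
  have hgen (c : Polynomial ℤ) (hc : aeval α c = 0) : N.primPart ∣ c := by
    refine N.isPrimitive_primPart.dvd_of_fraction_map_dvd_fraction_map (K := ℚ)
      (hdvd.trans (minpoly.dvd _ _ ?_))
    rwa [aeval_map_algebraMap]
  have hroot : aeval α N.primPart = 0 := by
    have h1 : aeval α N = 0 := by
      rw [← aeval_map_algebraMap ℚ, hN, map_zsmul, minpoly.aeval, smul_zero]
    rw [N.eq_C_content_mul_primPart, map_mul, aeval_C] at h1
    refine (mul_eq_zero.1 h1).resolve_left ?_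
    rw [eq_intCast]
    exact Int.cast_ne_zero.2 (mt content_eq_zero_iff.1 hN0)
  refine ⟨N.primPart, hroot, fun h ↦ ?_, hgen⟩
  have h1 := hgen _ h
  have h0 : N.primPart ≠ 0 := N.isPrimitive_primPart.ne_zero
  have h2 : derivative N.primPart = 0 :=
    eq_zero_of_dvd_of_degree_lt h1 (degree_derivative_lt h0)
  rw [Polynomial.derivative_eq_zero] at h2
  rw [eq_C_of_natDegree_eq_zero h2, aeval_C, eq_intCast, Int.cast_eq_zero] at hroot
  apply h0
  rw [eq_C_of_natDegree_eq_zero h2, hroot, C_0]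

theorem pow_dvd_of_iterate_derivative {α : K} {f : Polynomial ℤ} (hf : aeval α f = 0)
    (hf' : aeval α (derivative f) ≠ 0) (hgen : ∀ c : Polynomial ℤ, aeval α c = 0 → f ∣ c) (e : ℕ)
    {g : Polynomial ℤ} (hg : ∀ i < e, aeval α (derivative^[i] g) = 0) : f ^ e ∣ g := by
  induction e with
  | zero => simp
  | succ e ih =>
    obtain ⟨c, rfl⟩ := ih fun i hi ↦ hg i (by omega)
    rcases eq_or_ne (f ^ e * c) 0 with h0 | h0
    · rw [h0]
      exact dvd_zero _
    rw [pow_succ]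
    refine mul_dvd_mul_left _ (hgen _ ?_)
    have hinj : Function.Injective (algebraMap ℤ K) := (algebraMap ℤ K).injective_int
    have h1 : (X - C α) ^ (e + 1) ∣ (f ^ e * c).map (algebraMap ℤ K) := by
      rw [← le_rootMultiplicity_iff ((Polynomial.map_ne_zero_iff hinj).2 h0), Nat.succ_le_iff,
        lt_rootMultiplicity_iff_isRoot_iterate_derivative
          ((Polynomial.map_ne_zero_iff hinj).2 h0)]
      intro i hi
      rw [iterate_derivative_map, IsRoot.def, eval_map_algebraMap]
      exact hg i (by omega)
    obtain ⟨f1, hf1⟩ : X - C α ∣ f.map (algebraMap ℤ K) := by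
      rw [dvd_iff_isRoot, IsRoot.def, eval_map_algebraMap, hf]
    have hf1' : f1.eval α ≠ 0 := by
      intro h
      apply hf'
      rw [← eval_map_algebraMap, ← derivative_map, hf1, derivative_mul]
      simp [h]
    rw [Polynomial.map_mul, Polynomial.map_pow, hf1, mul_pow, mul_assoc, pow_succ] at h1
    have h2 := (mul_dvd_mul_iff_left (pow_ne_zero e (X_sub_C_ne_zero α))).1 h1
    rw [dvd_iff_isRoot, IsRoot.def, eval_mul, eval_pow, eval_map_algebraMap] at h2
    exact (mul_eq_zero.1 h2).resolve_left (pow_ne_zero _ hf1')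

theorem exists_expand_eq_pow_add (p : ℕ) [Fact p.Prime] (f : Polynomial ℤ) :
    ∃ r : Polynomial ℤ, expand ℤ p f = f ^ p + C (p : ℤ) * r ∧
      r.natDegree ≤ p * f.natDegree := by
  have hp := (Fact.out : p.Prime)
  have h1 : C (p : ℤ) ∣ expand ℤ p f - f ^ p := by
    rw [C_dvd_iff_dvd_coeff]
    intro i
    rw [← ZMod.intCast_zmod_eq_zero_iff_dvd, ← eq_intCast (Int.castRingHom (ZMod p)), ← coeff_map,
      Polynomial.map_sub, map_expand, Polynomial.map_pow, ZMod.expand_card, sub_self, coeff_zero]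
  obtain ⟨r, hr⟩ := h1
  refine ⟨r, by rw [← hr]; ring, ?_⟩
  have h2 : (C (p : ℤ) * r).natDegree = r.natDegree :=
    natDegree_C_mul (by exact_mod_cast hp.ne_zero)
  rw [← h2, ← hr]
  refine (natDegree_sub_le _ _).trans (max_le ?_ ?_)
  · rw [natDegree_expand, mul_comm]
  · exact natDegree_pow_le

theorem exists_aeval_pow_eq (p : ℕ) [Fact p.Prime] {α : K} {f c : Polynomial ℤ}
    (hf : aeval α f = 0) {e : ℕ} (h0 : f ^ e * c ≠ 0) :
    ∃ k : Polynomial ℤ, aeval (α ^ p) (f ^ e * c) = (p : K) ^ e * aeval α k ∧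
      k.natDegree ≤ p * (f ^ e * c).natDegree := by
  obtain ⟨r, hr, hrd⟩ := exists_expand_eq_pow_add p f
  refine ⟨r ^ e * expand ℤ p c, ?_, ?_⟩
  · rw [← expand_aeval, map_mul, map_pow, hr]
    simp only [map_mul, map_pow, map_add, hf, zero_pow (Fact.out : p.Prime).ne_zero, zero_add,
      map_natCast]
    ring
  · refine natDegree_mul_le.trans ?_
    rw [natDegree_mul (left_ne_zero_of_mul h0) (right_ne_zero_of_mul h0), natDegree_pow f,
      natDegree_expand, mul_add, mul_comm c.natDegree]
    have h1 : (r ^ e).natDegree ≤ p * (e * f.natDegree) :=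
      calc (r ^ e).natDegree ≤ e * r.natDegree := natDegree_pow_le
        _ ≤ e * (p * f.natDegree) := by gcongr
        _ = _ := by ring
    exact Nat.add_le_add_right h1 _

theorem aeval_iterate_derivative_eq_zero {M : Type*} {S : Finset M} {G : M → ℤ} {κ : M → ℤ} {W : ℕ}
    (hW : ∀ m ∈ S, |κ m| ≤ W) {α : Kˣ} {e : ℕ}
    (hvan : ∀ q : Polynomial ℤ, q.natDegree < e →
      ∑ m ∈ S, (G m : K) * (q.eval (κ m) : ℤ) * (α : K) ^ κ m = 0) {i : ℕ} (hi : i < e) :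
    aeval (α : K) (derivative^[i] (∑ m ∈ S, C (G m) * X ^ (κ m + W).toNat)) = 0 := by
  have h1 := hvan ((descPochhammer ℤ i).comp (X + C (W : ℤ))) (by
    rw [natDegree_comp, descPochhammer_natDegree, natDegree_X_add_C, mul_one]
    exact hi)
  have h2 : (α : K) ^ i * aeval (α : K)
      (derivative^[i] (∑ m ∈ S, C (G m) * X ^ (κ m + W).toNat)) = (α : K) ^ W * 0 := by
    rw [← h1, iterate_derivative_sum, map_sum, Finset.mul_sum, Finset.mul_sum]
    refine Finset.sum_congr rfl fun m hm ↦ ?_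
    have hk : ((κ m + W).toNat : ℤ) = κ m + W := by
      have := (abs_le.1 (hW m hm)).1
      omega
    have h3 : (α : K) ^ W * (α : K) ^ κ m = (α : K) ^ (κ m + W).toNat := by
      rw [← zpow_natCast, ← zpow_natCast, hk, add_comm, zpow_add₀ α.ne_zero]
    rw [iterate_derivative_C_mul, iterate_derivative_X_pow_eq_natCast_mul, eval_comp, eval_add,
      eval_X, eval_C]
    generalize (κ m + W).toNat = k at hk h3 ⊢
    rw [← hk, descPochhammer_eval_eq_descFactorial, mul_left_comm _ _ ((α : K) ^ κ m), h3]
    simp only [map_mul, map_natCast, map_pow, aeval_X, eq_intCast, Int.cast_natCast, map_intCast]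
    rcases lt_or_ge k i with hlt | hle
    · simp only [Nat.descFactorial_eq_zero_iff_lt.2 hlt]
      simp
    · nth_rewrite 4 [← Nat.sub_add_cancel hle]
      rw [pow_add]
      ring
  rw [mul_zero] at h2
  exact (mul_eq_zero.1 h2).resolve_left (pow_ne_zero _ α.ne_zero)

theorem sum_zpow_prime_mul_eq_zero {M : Type} {S : Finset M} {G : M → ℤ} {κ : M → ℤ} {W : ℕ}
    (hW : ∀ m ∈ S, |κ m| ≤ W) {α : Kˣ} (hα : IsAlgebraic ℚ (α : K)) {e : ℕ}
    (hvan : ∀ q : Polynomial ℤ, q.natDegree < e →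
      ∑ m ∈ S, (G m : K) * (q.eval (κ m) : ℤ) * (α : K) ^ κ m = 0)
    {B : ℕ} (hG : ∀ m ∈ S, |G m| ≤ B) {h : ℝ} (hh : IsHeightBound α h) {p : ℕ} (hp : p.Prime)
    (hlog : Real.log (S.card * B) + 2 * p * W * h < e * Real.log p) :
    ∑ m ∈ S, (G m : K) * (α : K) ^ (p * κ m) = 0 := by
  have : Fact p.Prime := ⟨hp⟩
  by_contra hne
  set g : Polynomial ℤ := ∑ m ∈ S, C (G m) * X ^ (κ m + W).toNat with hg
  have hk (m) (hm : m ∈ S) : ((κ m + W).toNat : ℤ) = κ m + W := by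
    have := (abs_le.1 (hW m hm)).1
    omega
  have hgd : g.natDegree ≤ 2 * W := by
    refine natDegree_sum_le_of_forall_le _ _ fun m hm ↦ (natDegree_C_mul_X_pow_le _ _).trans ?_
    have := (abs_le.1 (hW m hm)).2
    omega
  have hval : aeval ((α : K) ^ p) g = (α : K) ^ (p * W : ℤ) *
      ∑ m ∈ S, (G m : K) * (α : K) ^ (p * κ m) := by
    rw [hg, map_sum, Finset.mul_sum]
    refine Finset.sum_congr rfl fun m hm ↦ ?_
    simp only [map_mul, map_pow, aeval_X, eq_intCast, map_intCast]
    rw [← pow_mul, ← zpow_natCast _ (p * _), Nat.cast_mul, hk m hm, mul_add, zpow_add₀ α.ne_zero]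
    ring
  have hz (n : ℤ) : (α : K) ^ n ≠ 0 := zpow_ne_zero _ α.ne_zero
  have hg0 : g ≠ 0 := by
    intro h0
    rw [h0, map_zero] at hval
    exact mul_ne_zero (hz _) hne hval.symm
  obtain ⟨f, hf, hf', hgen⟩ := exists_generator_of_isAlgebraic hα
  obtain ⟨c, hc⟩ := pow_dvd_of_iterate_derivative hf hf' hgen e (g := g)
    fun i hi ↦ aeval_iterate_derivative_eq_zero hW hvan hi
  obtain ⟨k, hk1, hk2⟩ := exists_aeval_pow_eq p hf (hc ▸ hg0)
  rw [← hc] at hk1 hk2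
  rw [hval] at hk1
  have hlv (P : Set ℤ) (hP : ∀ m ∈ S, p * κ m ∈ P) :
      IsLaurentValue α (S.card * B) P (∑ m ∈ S, (G m : K) * (α : K) ^ (p * κ m)) := by
    refine ⟨M, S, G, fun m ↦ p * κ m, hP, ?_, rfl⟩
    rw [← nsmul_eq_mul]
    refine Finset.sum_le_card_nsmul _ _ _ fun m hm ↦ ?_
    exact_mod_cast hG m hm
  have hcl (P : Set ℤ) (hP : Set.Icc (-(p * W : ℤ)) (p * W) ⊆ P) :
      (α : K) ^ (-(p * W : ℤ)) * aeval (α : K) k ∈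
        AddSubgroup.closure ((fun n : ℤ ↦ (α : K) ^ n) '' P) := by
    rw [aeval_eq_sum_range, Finset.mul_sum]
    refine sum_mem fun i hi ↦ ?_
    rw [mul_smul_comm]
    have hin : (-(p * W : ℤ) + i) ∈ P ∧
        (α : K) ^ (-(p * W : ℤ) + i) = (α : K) ^ (-(p * W : ℤ)) * (α : K) ^ i := by
      refine ⟨hP ?_, by rw [zpow_add₀ α.ne_zero, zpow_natCast]⟩
      have h1 := (Finset.mem_range_succ_iff.1 hi).trans (hk2.trans (Nat.mul_le_mul_left p hgd))
      zify at h1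
      constructor <;> linarith [(Nat.cast_nonneg i : (0 : ℤ) ≤ i)]
    have hmem : (α : K) ^ (-(p * W : ℤ)) * (α : K) ^ i ∈
        AddSubgroup.closure ((fun n : ℤ ↦ (α : K) ^ n) '' P) :=
      AddSubgroup.subset_closure ⟨_, hin⟩
    exact zsmul_mem hmem _
  have hpW (m) (hm : m ∈ S) : |(p : ℤ) * κ m| ≤ p * W := by
    rw [abs_mul, Nat.abs_cast]
    gcongr
    exact hW m hm
  have h2 := hh.2 _ ((α : K) ^ (-(p * W : ℤ)) * aeval (α : K) k) (p ^ e) (p * W) (p * W)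
    (S.card * B) (pow_pos hp.pos e) hne (by
      push_cast
      rw [mul_left_comm, ← hk1, ← mul_assoc, ← zpow_add₀ α.ne_zero, neg_add_cancel, zpow_zero,
        one_mul])
    (hlv _ fun m hm ↦ (abs_le.1 (hpW m hm)).2) (hlv _ fun m hm ↦ (abs_le.1 (hpW m hm)).1)
    (hcl _ fun n hn ↦ hn.2) (hcl _ fun n hn ↦ hn.1)
  push_cast at h2
  rw [Real.log_pow] at h2
  linarith

end FrobeniusTwist

end

section

theorem exists_small_vanishing_twists {K M : Type} [Field K] [CharZero K] [AddCommGroup M]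
    [Module.Free ℤ M] [Module.Finite ℤ M] {ι : Type} [Fintype ι] (u : ι → M →ₗ[ℤ] ℤ) (c : ι → ℤ)
    {κ : M →ₗ[ℤ] ℤ} (hκ : κ = ∑ a, c a • u a) {α : Kˣ} (hα : IsAlgebraic ℚ (α : K)) {h : ℝ}
    (hh : IsHeightBound α h) {F : ℤ[M]} (hF : F ≠ 0) (hF0 : evalAt ℤ κ α F = 0) {e θ : ℕ}
    {S S' : Finset M} (hSS' : ∀ m ∈ S', ∀ x ∈ (F ^ e).coeff.support, m + x ∈ S)
    (hcard : θ * (S.card - S'.card) < S.card) {N : ℕ} (hN : 1 ≤ N)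
    (hu : ∀ a, ∀ m ∈ S, |u a m| ≤ N) {W : ℕ} (hW : ∀ m ∈ S, |κ m| ≤ W) {X : ℕ} (hX : 2 ≤ X)
    (hlog : Real.log (S.card * X * N ^ e) + 2 * W * h < θ * Real.log X) :
    ∃ G : ℤ[M], G ≠ 0 ∧ G.coeff.support ⊆ S ∧ (∀ m, |G.coeff m| ≤ X) ∧ ∀ p : ℕ, p.Prime →
      Real.log (S.card * X) + 2 * p * W * h < e * Real.log p →
      evalAt ℤ ((p : ℤ) • κ) α G = 0 := by
  classical
  obtain ⟨G, ⟨m₀, hm₀, hGm₀⟩, hGX, hG⟩ := exists_small_vanishing_jets (B := N ^ e) hh hF hF0 hSS'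
    hcard (ι := Σ i : Fin e, (Fin i → ι)) (fun j ↦ List.ofFn fun k ↦ u (j.2 k))
    (fun j ↦ by rw [List.length_ofFn]; exact j.1.2) (fun j m hm ↦ by
      rw [List.map_ofFn, List.prod_ofFn]
      push_cast
      rw [Finset.abs_prod]
      calc _ ≤ ∏ _k : Fin j.1, (N : ℝ) := by
            refine Finset.prod_le_prod (fun _ _ ↦ abs_nonneg _) fun k _ ↦ ?_
            exact_mod_cast hu _ m hm
        _ = (N : ℝ) ^ (j.1 : ℕ) := by simp
        _ ≤ _ := pow_le_pow_right₀ (by exact_mod_cast hN) j.1.2.le) (W := W) hW hX hlog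
  have hpow (i : ℕ) (hi : i < e) : ∑ m ∈ S, (G m : K) * ((κ m ^ i : ℤ) : K) * (α : K) ^ κ m = 0 := by
    have h1 (m : M) : κ m ^ i = ∑ w : Fin i → ι, (∏ k, c (w k)) * ∏ k, u (w k) m := by
      rw [hκ]
      simp only [LinearMap.sum_apply, LinearMap.smul_apply, smul_eq_mul]
      rw [Fintype.sum_pow]
      simp only [Finset.prod_mul_distrib]
    have h2 (w : Fin i → ι) : ∑ m ∈ S, (G m : K) * ((∏ k, u (w k) m : ℤ) : K) * (α : K) ^ κ m = 0 := by
      have := hG ⟨⟨i, hi⟩, w⟩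
      simp only [List.map_ofFn, List.prod_ofFn, Function.comp_apply] at this
      exact this
    calc _ = ∑ w : Fin i → ι, ((∏ k, c (w k) : ℤ) : K) *
          ∑ m ∈ S, (G m : K) * ((∏ k, u (w k) m : ℤ) : K) * (α : K) ^ κ m := by
            simp only [h1, Finset.mul_sum]
            rw [Finset.sum_comm]
            refine Finset.sum_congr rfl fun m _ ↦ ?_
            rw [Int.cast_sum, Finset.mul_sum, Finset.sum_mul]
            refine Finset.sum_congr rfl fun w _ ↦ ?_
            rw [Int.cast_mul]
            ring
      _ = 0 := by simp only [h2, mul_zero, Finset.sum_const_zero]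
  have hvan (q : Polynomial ℤ) (hq : q.natDegree < e) :
      ∑ m ∈ S, (G m : K) * (q.eval (κ m) : ℤ) * (α : K) ^ κ m = 0 := by
    calc _ = ∑ i ∈ Finset.range (q.natDegree + 1), ((q.coeff i : ℤ) : K) *
          ∑ m ∈ S, (G m : K) * ((κ m ^ i : ℤ) : K) * (α : K) ^ κ m := by
            simp only [Finset.mul_sum]
            rw [Finset.sum_comm]
            refine Finset.sum_congr rfl fun m _ ↦ ?_
            rw [Polynomial.eval_eq_sum_range, Int.cast_sum, Finset.mul_sum, Finset.sum_mul]
            refine Finset.sum_congr rfl fun w _ ↦ ?_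
            rw [Int.cast_mul]
            ring
      _ = 0 := Finset.sum_eq_zero fun i hi ↦ by
        rw [hpow i ((Finset.mem_range_succ_iff.1 hi).trans_lt hq), mul_zero]
  refine ⟨∑ m ∈ S, AddMonoidAlgebra.single m (G m), fun h0 ↦ hGm₀ ?_, ?_, fun m ↦ ?_, fun p hp hlp ↦ ?_⟩
  · have h1 : (∑ m ∈ S, AddMonoidAlgebra.single m (G m) : ℤ[M]).coeff m₀ = 0 := by rw [h0]; rfl
    rw [AddMonoidAlgebra.coeff_sum, Finset.sum_apply'] at h1
    simpa [AddMonoidAlgebra.coeff_single, Finsupp.single_apply, hm₀] using h1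
  · intro x hx
    refine sum_support_subset (S := (S : Set M)) (fun i hi w hw ↦ ?_) hx
    rw [AddMonoidAlgebra.coeff_single] at hw
    have := Finsupp.support_single_subset hw
    rw [Finset.mem_singleton] at this
    rwa [this]
  · rw [AddMonoidAlgebra.coeff_sum, Finset.sum_apply']
    by_cases hm : m ∈ S
    · simpa [AddMonoidAlgebra.coeff_single, Finsupp.single_apply, hm] using hGX m hm
    · simp [AddMonoidAlgebra.coeff_single, Finsupp.single_apply, hm]
  · rw [map_sum, ← sum_zpow_prime_mul_eq_zero (M := M) hW hα hvan hGX hh hp hlp]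
    refine Finset.sum_congr rfl fun m _ ↦ ?_
    rw [evalAt_single]
    simp

end

section

section Slab

variable {Λ ι : Type*} [AddCommGroup Λ] [Fintype ι]

/-- The box of radius `r` with respect to a separating family of functionals. -/
def slab (u : ι → Λ →ₗ[ℤ] ℤ) (hu : ∀ x, (∀ i, u i x = 0) → x = 0) (r : ℕ) : Finset Λ :=
  Set.Finite.toFinset (s := {x | ∀ i, u i x ∈ Set.Icc (-(r : ℤ)) r}) <| by
    have h1 : {f : ι → ℤ | ∀ i, f i ∈ Set.Icc (-(r : ℤ)) r}.Finite :=
      Set.Finite.pi' fun _ ↦ Set.finite_Icc _ _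
    refine Set.Finite.of_injOn (f := fun x i ↦ u i x) (t := _) (fun x hx ↦ hx) ?_ h1
    intro x _ y _ hxy
    rw [← sub_eq_zero]
    refine hu _ fun i ↦ ?_
    rw [map_sub, sub_eq_zero]
    exact congrFun hxy i

variable {u : ι → Λ →ₗ[ℤ] ℤ} {hu : ∀ x, (∀ i, u i x = 0) → x = 0}

theorem mem_slab {r : ℕ} {x : Λ} : x ∈ slab u hu r ↔ ∀ i, |u i x| ≤ r := by
  simp [slab, abs_le]

theorem zero_mem_slab (r : ℕ) : 0 ∈ slab u hu r := by
  simp [mem_slab]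

theorem slab_mono {r s : ℕ} (h : r ≤ s) : slab u hu r ⊆ slab u hu s := fun x hx ↦ by
  rw [mem_slab] at *
  exact fun i ↦ (hx i).trans (by exact_mod_cast h)

theorem card_slab_mul_le (j w : ℕ) :
    (slab u hu (j * w)).card ≤ (slab u hu w).card * (2 * j + 1) ^ Fintype.card ι := by
  classical
  let f : Λ → ι → ℤ := fun x i ↦ (u i x + j * w) / (w + 1)
  have h1 := Finset.card_le_mul_card_image (f := f) (slab u hu (j * w)) (slab u hu w).card (by
    intro a ha
    obtain ⟨x, hx, rfl⟩ := Finset.mem_image.1 ha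
    refine Finset.card_le_card_of_injOn (fun y ↦ y - x) ?_ (sub_left_injective.injOn)
    intro y hy
    rw [Finset.mem_coe, mem_slab]
    intro i
    have h2 := congrFun (Finset.mem_filter.1 (Finset.mem_coe.1 hy)).2 i
    simp only [f] at h2
    have h3 := Int.emod_add_mul_ediv (u i x + j * w) (w + 1)
    have h4 := Int.emod_add_mul_ediv (u i y + j * w) (w + 1)
    have h5 := Int.emod_nonneg (u i x + j * w) (b := w + 1) (by omega)
    have h6 := Int.emod_lt_of_pos (u i x + j * w) (b := w + 1) (by omega)
    have h7 := Int.emod_nonneg (u i y + j * w) (b := w + 1) (by omega)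
    have h8 := Int.emod_lt_of_pos (u i y + j * w) (b := w + 1) (by omega)
    rw [h2] at h4
    simp only [map_sub]
    rw [abs_le]
    constructor <;> linarith)
  refine h1.trans (Nat.mul_le_mul_left _ ?_)
  calc _ ≤ (Fintype.piFinset fun _ : ι ↦ Finset.Icc (0 : ℤ) (2 * j)).card := by
        refine Finset.card_le_card fun a ha ↦ ?_
        obtain ⟨x, hx, rfl⟩ := Finset.mem_image.1 ha
        rw [Fintype.mem_piFinset]
        intro i
        rw [mem_slab] at hx
        have h2 := abs_le.1 (hx i)
        push_cast at h2
        rw [Finset.mem_Icc]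
        constructor
        · exact Int.ediv_nonneg (by linarith) (by omega)
        · rw [← Int.lt_add_one_iff]
          refine Int.ediv_lt_of_lt_mul (by omega) ?_
          nlinarith
    _ = _ := by
      rw [Fintype.card_piFinset]
      simp only [Int.card_Icc, Finset.prod_const, Finset.card_univ]
      congr 1

theorem card_slab_le (r : ℕ) : (slab u hu r).card ≤ (2 * r + 1) ^ Fintype.card ι := by
  classical
  calc _ ≤ (Fintype.piFinset fun _ : ι ↦ Finset.Icc (-r : ℤ) r).card := by
        refine Finset.card_le_card_of_injOn (fun x i ↦ u i x) ?_ ?_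
        · intro x hx
          rw [Finset.mem_coe, Fintype.mem_piFinset]
          intro i
          rw [Finset.mem_Icc, ← abs_le]
          exact mem_slab.1 hx i
        · intro x _ y _ hxy
          rw [← sub_eq_zero]
          refine hu _ fun i ↦ ?_
          rw [map_sub, sub_eq_zero]
          exact congrFun hxy i
    _ = _ := by
      rw [Fintype.card_piFinset]
      simp only [Int.card_Icc, Finset.prod_const, Finset.card_univ]
      congr 1
      omega

end Slab

theorem exists_slow_growth (n e θ : ℕ) (he : 1 ≤ e) (hθ : 2 ≤ θ) :
    ∃ A : ℕ, ∀ c : ℕ → ℕ, 0 < c 1 → (∀ j, c 1 ≤ c (j + 1)) → (∀ j, c j ≤ c 1 * (2 * j + 1) ^ n) →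
      ∃ j, e ≤ j ∧ j ≤ A ∧ θ * (c j - c (j - e)) < c j := by
  have hθ' : (2 : ℝ) ≤ θ := by exact_mod_cast hθ
  have he' : (1 : ℝ) ≤ e := by exact_mod_cast he
  have hlim := (tendsto_pow_const_div_const_pow_of_one_lt n (r := (θ : ℝ) / (θ - 1)) (by
    rw [one_lt_div (by linarith)]
    linarith)).const_mul ((5 * e : ℝ) ^ n)
  rw [mul_zero] at hlim
  obtain ⟨i₀, hi₁, hi₀⟩ := ((hlim.eventually (gt_mem_nhds zero_lt_one)).and
    (eventually_ge_atTop 1)).exists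
  replace hi₀ : (1 : ℝ) ≤ i₀ := by exact_mod_cast hi₀
  refine ⟨e * (i₀ + 1), fun c h0 h1 hc ↦ ?_⟩
  by_contra! hcon
  have key (i : ℕ) (hi : i ≤ i₀) : (c 1 : ℝ) * ((θ : ℝ) / (θ - 1)) ^ i ≤ c (e * (i + 1)) := by
    induction i with
    | zero =>
      obtain ⟨e', rfl⟩ := Nat.exists_eq_add_of_le' he
      simpa using h1 e'
    | succ i ih =>
      have h2 := hcon (e * (i + 1 + 1)) (by nlinarith) (by gcongr)
      have h3 : e * (i + 1 + 1) - e = e * (i + 1) := by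
        rw [mul_add e (i + 1) 1, mul_one, Nat.add_sub_cancel]
      rw [h3] at h2
      have h4 : (θ : ℝ) * c (e * (i + 1)) ≤ (θ - 1) * c (e * (i + 1 + 1)) := by
        have h5 : c 1 ≤ c (e * (i + 1 + 1)) := by
          have := h1 (e * (i + 1 + 1) - 1)
          rwa [Nat.sub_add_cancel (by nlinarith)] at this
        have h6 : c (e * (i + 1)) ≤ c (e * (i + 1 + 1)) := by
          by_contra! hlt
          rw [Nat.sub_eq_zero_of_le hlt.le] at h2
          omega
        have h7 : ((c (e * (i + 1 + 1)) : ℕ) : ℝ) ≤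
            θ * (c (e * (i + 1 + 1)) - c (e * (i + 1))) := by
          rw [← Nat.cast_sub h6]
          exact_mod_cast h2
        linarith
      rw [pow_succ, ← mul_assoc]
      calc _ ≤ (c (e * (i + 1)) : ℝ) * ((θ : ℝ) / (θ - 1)) := by
            refine mul_le_mul_of_nonneg_right (ih (by omega)) (div_nonneg (by linarith) (by linarith))
        _ ≤ _ := by
          rw [mul_div_assoc', div_le_iff₀ (by linarith)]
          linarith
  have h2 := key i₀ le_rfl
  have h3 : (c (e * (i₀ + 1)) : ℝ) ≤ c 1 * (2 * e * (i₀ + 1) + 1) ^ n := by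
    have := hc (e * (i₀ + 1))
    rw [← mul_assoc] at this
    exact_mod_cast this
  rw [mul_div_assoc', ← mul_pow,
    div_lt_one (pow_pos (div_pos (by linarith) (by linarith)) _)] at hi₁
  have h4 : (0 : ℝ) < c 1 := by exact_mod_cast h0
  have h5 : (2 * e * (i₀ + 1) + 1 : ℝ) ^ n ≤ (5 * e * i₀) ^ n := by
    refine pow_le_pow_left₀ (by positivity) ?_ _
    nlinarith
  have h6 := mul_lt_mul_of_pos_left (h5.trans_lt hi₁) h4
  linarith

end

section

section Support

variable {R M : Type*} [CommRing R] [IsDomain R] [AddCommGroup M] [Module.Free ℤ M]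
  [Module.Finite ℤ M]

theorem eq_zero_of_add_mem (S : Finset M) (hS : S.Nonempty) {μ : M} (h : ∀ m ∈ S, m + μ ∈ S) :
    μ = 0 := by
  have h1 : S.map (addRightEmbedding μ) = S := by
    refine Finset.eq_of_subset_of_card_le (fun x hx ↦ ?_) (by rw [Finset.card_map])
    obtain ⟨y, hy, rfl⟩ := Finset.mem_map.1 hx
    exact h y hy
  have h2 : ∑ m ∈ S, (m + μ) = ∑ m ∈ S, m := by
    conv_rhs => rw [← h1, Finset.sum_map]
    rfl
  rw [Finset.sum_add_distrib, Finset.sum_const, add_eq_left] at h2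
  have h3 : (S.card : ℤ) • μ = 0 := by rwa [natCast_zsmul]
  exact (smul_eq_zero.1 h3).resolve_left (by simpa using hS.ne_empty)

theorem exists_coeff_eq_of_associated {f g : R[M]} (hf : f ≠ 0) (h : Associated f g)
    (hfg : f.coeff.support = g.coeff.support) :
    ∃ c : R, IsUnit c ∧ ∀ m, g.coeff m = c * f.coeff m := by
  obtain ⟨u, hu⟩ := h
  obtain ⟨μ, c, hc, hμ⟩ := eq_single_of_isUnit u.isUnit
  have h1 (m : M) : g.coeff m = c * f.coeff (m - μ) := by
    rw [← hu, hμ, mul_comm, coeff_single_mul_eq]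
  have h2 : μ = 0 := by
    refine eq_zero_of_add_mem f.coeff.support
      (Finsupp.support_nonempty_iff.2 fun h ↦ hf (AddMonoidAlgebra.coeff_injective h))
      fun m hm ↦ ?_
    rw [hfg, Finsupp.mem_support_iff, h1, add_sub_cancel_right]
    exact mul_ne_zero hc.ne_zero (Finsupp.mem_support_iff.1 hm)
  refine ⟨c, hc, fun m ↦ ?_⟩
  rw [h1, h2, sub_zero]

end Support

section Twist

variable {K M : Type*} [Field K] [AddCommGroup M]

/-- Translation of the torus by the point `m ↦ χ m`. -/
def twistHom (χ : M → Kˣ) (hχ : ∀ m n, χ (m + n) = χ m * χ n) : K[M] →ₐ[K] K[M] :=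
  AddMonoidAlgebra.lift K K[M] M
    { toFun := fun m ↦ AddMonoidAlgebra.single m.toAdd (χ m.toAdd : K)
      map_one' := by
        have h0 : χ 0 = 1 := by simpa using hχ 0 0
        simp [h0, AddMonoidAlgebra.one_def]
      map_mul' := fun m n ↦ by
        rw [AddMonoidAlgebra.single_mul_single, toAdd_mul, hχ]
        simp }

theorem coeff_twistHom (χ : M → Kˣ) (hχ : ∀ m n, χ (m + n) = χ m * χ n) (f : K[M]) (m : M) :
    (twistHom χ hχ f).coeff m = χ m * f.coeff m := by
  classical
  induction f using AddMonoidAlgebra.induction_linear with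
  | zero => simp
  | add f g hf hg => rw [map_add, AddMonoidAlgebra.coeff_add, Finsupp.add_apply, hf, hg,
      AddMonoidAlgebra.coeff_add, Finsupp.add_apply, mul_add]
  | single n r =>
    simp only [twistHom, AddMonoidAlgebra.lift_single, MonoidHom.coe_mk, OneHom.coe_mk,
      toAdd_ofAdd, AddMonoidAlgebra.coeff_smul, Finsupp.smul_apply, AddMonoidAlgebra.coeff_single,
      Finsupp.single_apply, smul_eq_mul]
    split_ifs with h
    · rw [h, mul_comm]
    · simp

theorem support_twistHom (χ : M → Kˣ) (hχ : ∀ m n, χ (m + n) = χ m * χ n) (f : K[M]) :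
    (twistHom χ hχ f).coeff.support = f.coeff.support := by
  ext m
  simp [coeff_twistHom]

theorem irreducible_twistHom (χ : M → Kˣ) (hχ : ∀ m n, χ (m + n) = χ m * χ n) {f : K[M]}
    (hf : Irreducible f) : Irreducible (twistHom χ hχ f) := by
  have hχ' (m n : M) : (χ (m + n))⁻¹ = (χ m)⁻¹ * (χ n)⁻¹ := by rw [hχ, mul_inv]
  let E : K[M] ≃ₐ[K] K[M] := AlgEquiv.ofAlgHom (twistHom χ hχ) (twistHom (fun m ↦ (χ m)⁻¹) hχ')
    (by
      refine AlgHom.ext fun f ↦ AddMonoidAlgebra.coeff_injective (Finsupp.ext fun m ↦ ?_)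
      simp [coeff_twistHom])
    (by
      refine AlgHom.ext fun f ↦ AddMonoidAlgebra.coeff_injective (Finsupp.ext fun m ↦ ?_)
      simp [coeff_twistHom])
  exact (MulEquiv.irreducible_iff E.toMulEquiv).2 hf

/-- The ring homomorphism multiplying exponents by `p`. -/
def expandHom (R M : Type*) [CommRing R] [AddCommGroup M] (p : ℕ) : R[M] →+* R[M] :=
  AddMonoidAlgebra.mapDomainRingHom R
    (((p : ℤ) • (LinearMap.id : M →ₗ[ℤ] M) : M →ₗ[ℤ] M) : M →+ M)

theorem expandHom_single {R : Type*} [CommRing R] (p : ℕ) (m : M) (r : R) :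
    expandHom R M p (AddMonoidAlgebra.single m r) = AddMonoidAlgebra.single ((p : ℤ) • m) r := by
  simp [expandHom]

theorem evalAt_expandHom {R L : Type*} [CommRing R] [Field L] [Algebra R L] (κ : M →ₗ[ℤ] ℤ)
    (α : Lˣ) (p : ℕ) (f : R[M]) :
    evalAt R κ α (expandHom R M p f) = evalAt R ((p : ℤ) • κ) α f := by
  rw [expandHom, evalAt_mapDomainRingHom]
  congr 1
  ext m
  simp

theorem expandHom_mapRingHom {R S : Type*} [CommRing R] [CommRing S] (φ : R →+* S) (p : ℕ)
    (f : R[M]) : expandHom S M p (AddMonoidAlgebra.mapRingHom M φ f) =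
      AddMonoidAlgebra.mapRingHom M φ (expandHom R M p f) := by
  induction f using AddMonoidAlgebra.induction_linear with
  | zero => simp
  | add f g hf hg => simp only [map_add, hf, hg]
  | single m r => simp [expandHom_single]

theorem exists_of_mem_support_expandHom {R : Type*} [CommRing R] {p : ℕ} {f : R[M]} {m : M}
    (hm : m ∈ (expandHom R M p f).coeff.support) : ∃ x ∈ f.coeff.support, m = (p : ℤ) • x := by
  classical
  have := Finsupp.mapDomain_support hm
  obtain ⟨x, hx, rfl⟩ := Finset.mem_image.1 this
  exact ⟨x, hx, rfl⟩

theorem expandHom_injective {R : Type*} [CommRing R] [Module.IsTorsionFree ℤ M] {p : ℕ}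
    (hp : p ≠ 0) : Function.Injective (expandHom R M p) := by
  have h1 : Function.Injective ((p : ℤ) • (LinearMap.id : M →ₗ[ℤ] M) : M →ₗ[ℤ] M) := by
    intro x y hxy
    exact smul_right_injective M (r := (p : ℤ)) (by exact_mod_cast hp) hxy
  exact AddMonoidAlgebra.mapDomain_injective h1

theorem twistHom_expandHom (χ : M → Kˣ) (hχ : ∀ m n, χ (m + n) = χ m * χ n) {p : ℕ}
    (hp : ∀ m, χ ((p : ℤ) • m) = 1) (f : K[M]) :
    twistHom χ hχ (expandHom K M p f) = expandHom K M p f := by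
  refine AddMonoidAlgebra.coeff_injective (Finsupp.ext fun m ↦ ?_)
  rw [coeff_twistHom]
  by_cases h : m ∈ (expandHom K M p f).coeff.support
  · obtain ⟨x, -, rfl⟩ := exists_of_mem_support_expandHom h
    rw [hp, Units.val_one, one_mul]
  · rw [Finsupp.notMem_support_iff.1 h, mul_zero]

end Twist

section ZeroEstimate

variable {K M : Type*} [Field K] [AddCommGroup M] [Module.Free ℤ M] [Module.Finite ℤ M]

theorem width_expandHom_le {R : Type*} [CommRing R] [IsDomain R] (u : M →ₗ[ℤ] ℤ) (p : ℕ)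
    (f : R[M]) : width u (expandHom R M p f) ≤ p * width u f := by
  rw [width_le_iff]
  intro m hm m' hm'
  obtain ⟨x, hx, rfl⟩ := exists_of_mem_support_expandHom hm
  obtain ⟨y, hy, rfl⟩ := exists_of_mem_support_expandHom hm'
  have := sub_le_width u hx hy
  push_cast
  simp only [map_smul, smul_eq_mul]
  nlinarith [(Nat.cast_nonneg p : (0 : ℤ) ≤ p)]

theorem width_eq_of_support_eq {R : Type*} [CommRing R] [IsDomain R] (u : M →ₗ[ℤ] ℤ) {f g : R[M]}
    (h : f.coeff.support = g.coeff.support) : width u f = width u g := by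
  apply le_antisymm <;> rw [width_le_iff] <;> intro m hm m' hm'
  · rw [h] at hm hm'
    exact sub_le_width u hm hm'
  · rw [← h] at hm hm'
    exact sub_le_width u hm hm'

/-- If `Φ` divides `G(z^p)` then so do its `p ^ 2` translates by `p`-torsion points. -/
theorem prime_mul_width_le [CharZero K] [IsAlgClosed K] {Φ G : K[M]} (hΦ : Irreducible Φ)
    {m₀ m₁ m₂ : M} (h₀ : m₀ ∈ Φ.coeff.support) (h₁ : m₁ ∈ Φ.coeff.support)
    (h₂ : m₂ ∈ Φ.coeff.support) {u₁ u₂ : M →ₗ[ℤ] ℤ} {p : ℕ} (hp : p.Prime)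
    (hΔ : ¬ (p : ℤ) ∣ u₁ (m₁ - m₀) * u₂ (m₂ - m₀) - u₂ (m₁ - m₀) * u₁ (m₂ - m₀)) (hG : G ≠ 0)
    (hdvd : Φ ∣ expandHom K M p G) (u : M →ₗ[ℤ] ℤ) : p * width u Φ ≤ width u G := by
  classical
  have : NeZero p := ⟨hp.ne_zero⟩
  obtain ⟨ζ₀, hζ₀⟩ := HasEnoughRootsOfUnity.exists_primitiveRoot K p
  obtain ⟨ζ, rfl⟩ := hζ₀.isUnit hp.ne_zero
  have hζ : IsPrimitiveRoot ζ p := IsPrimitiveRoot.coe_units_iff.1 hζ₀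
  let χ : Fin p × Fin p → M → Kˣ := fun a m ↦ ζ ^ ((a.1 : ℕ) * u₁ m + (a.2 : ℕ) * u₂ m)
  have hχ (a) (m n : M) : χ a (m + n) = χ a m * χ a n := by
    simp only [χ, ← zpow_add, map_add]
    congr 1
    ring
  have hχp (a) (m : M) : χ a ((p : ℤ) • m) = 1 := by
    simp only [χ, map_smul, smul_eq_mul]
    rw [hζ.zpow_eq_one_iff_dvd]
    exact ⟨(a.1 : ℕ) * u₁ m + (a.2 : ℕ) * u₂ m, by ring⟩
  have hirr (a) := irreducible_twistHom (χ a) (hχ a) hΦ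
  have hG' : expandHom K M p G ≠ 0 := fun h ↦ hG (expandHom_injective hp.ne_zero (by rw [h, map_zero]))
  have hna (a b) (h : Associated (twistHom (χ a) (hχ a) Φ) (twistHom (χ b) (hχ b) Φ)) : a = b := by
    obtain ⟨c, -, hc⟩ := exists_coeff_eq_of_associated (hirr a).ne_zero h (by
      rw [support_twistHom, support_twistHom])
    have h3 (m) (hm : m ∈ Φ.coeff.support) : (χ b m : K) = c * χ a m := by
      have := hc m
      rw [coeff_twistHom, coeff_twistHom, ← mul_assoc] at this
      exact mul_right_cancel₀ (Finsupp.mem_support_iff.1 hm) this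
    have h4 (m) (hm : m ∈ Φ.coeff.support) : (p : ℤ) ∣
        ((a.1 : ℕ) - (b.1 : ℕ)) * u₁ (m - m₀) + ((a.2 : ℕ) - (b.2 : ℕ)) * u₂ (m - m₀) := by
      rw [← hζ.zpow_eq_one_iff_dvd]
      have h5 : χ b m * χ a m₀ = χ b m₀ * χ a m := by
        ext
        push_cast
        rw [h3 m hm, h3 m₀ h₀]
        ring
      simp only [χ, ← zpow_add] at h5
      rw [← mul_inv_eq_one, ← zpow_neg, ← zpow_add] at h5
      rw [← inv_eq_one, ← zpow_neg, ← h5]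
      congr 1
      simp only [map_sub]
      ring
    obtain ⟨k₁, hk₁⟩ := h4 m₁ h₁
    obtain ⟨k₂, hk₂⟩ := h4 m₂ h₂
    have hprime : Prime (p : ℤ) := Nat.prime_iff_prime_int.1 hp
    have hfin (i j : Fin p) (h : (p : ℤ) ∣ (i : ℕ) - (j : ℕ)) : i = j := by
      have h6 := Int.eq_zero_of_abs_lt_dvd h (by
        have := i.2
        have := j.2
        rw [abs_lt]
        omega)
      exact Fin.ext (by omega)
    refine Prod.ext (hfin _ _ ?_) (hfin _ _ ?_)
    · refine (hprime.dvd_or_dvd (a := ((a.1 : ℕ) - (b.1 : ℕ) : ℤ)) ⟨k₁ * u₂ (m₂ - m₀) - k₂ * u₂ (m₁ - m₀), ?_⟩).resolve_right hΔ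
      linear_combination u₂ (m₂ - m₀) * hk₁ - u₂ (m₁ - m₀) * hk₂
    · refine (hprime.dvd_or_dvd (a := ((a.2 : ℕ) - (b.2 : ℕ) : ℤ)) ⟨k₂ * u₁ (m₁ - m₀) - k₁ * u₁ (m₂ - m₀), ?_⟩).resolve_right hΔ
      linear_combination u₁ (m₁ - m₀) * hk₂ - u₁ (m₂ - m₀) * hk₁
  have hprod : ∏ a, twistHom (χ a) (hχ a) Φ ∣ expandHom K M p G := by
    refine Finset.prod_dvd_of_isRelPrime (fun a _ b _ hab ↦ ?_) fun a _ ↦ ?_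
    · refine ((hirr a).isRelPrime_iff_not_dvd).2 fun h ↦ hab (hna a b ?_)
      exact (hirr a).associated_of_dvd (hirr b) h
    · have := map_dvd (twistHom (χ a) (hχ a)) hdvd
      rwa [twistHom_expandHom _ _ (hχp a)] at this
  have h6 := width_le_of_dvd u hG' hprod
  rw [width_prod u _ _ fun a _ ↦ (hirr a).ne_zero] at h6
  simp only [width_eq_of_support_eq u (support_twistHom _ _ Φ), Finset.sum_const, smul_eq_mul,
    Finset.card_univ, Fintype.card_prod, Fintype.card_fin] at h6
  have h7 := h6.trans (width_expandHom_le u p G)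
  rw [mul_assoc] at h7
  exact Nat.le_of_mul_le_mul_left h7 hp.pos

end ZeroEstimate

end

section

section PrimeIdeals

variable {R : Type*} [CommRing R] [IsDomain R] [UniqueFactorizationMonoid R]

theorem exists_irreducible_mem {P : Ideal R} (hP : P.IsPrime) {a : R} (ha : a ∈ P) (ha0 : a ≠ 0) :
    ∃ F, Irreducible F ∧ F ∈ P ∧ F ∣ a := by
  obtain ⟨s, hs, u, hu⟩ := UniqueFactorizationMonoid.exists_prime_factors a ha0
  have h1 : s.prod ∈ P := by
    rw [← hu] at ha
    exact (hP.mem_or_mem ha).resolve_right fun h ↦ hP.ne_top (P.eq_top_of_isUnit_mem h u.isUnit)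
  obtain ⟨F, hFs, hF⟩ := (Ideal.IsPrime.multiset_prod_mem_iff_exists_mem hP s).1 h1
  exact ⟨F, (hs F hFs).irreducible, hF, hu ▸ (Multiset.dvd_prod hFs).mul_right _⟩

theorem eq_span_of_forall_dvd {P : Ideal R} {F g D : R} (hF : Irreducible F) (hFP : F ∈ P)
    (hD : ¬ IsUnit D) (h : ∀ x ∈ P ⊔ Ideal.span {g}, D ∣ x) : P = Ideal.span {F} ∧ F ∣ g := by
  have hFD : F ∣ D := by
    obtain ⟨c, hc⟩ := h F (Ideal.mem_sup_left hFP)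
    have hcu := (hF.isUnit_or_isUnit hc).resolve_left hD
    rw [hc]
    exact (hcu.mul_right_dvd).2 dvd_rfl
  refine ⟨le_antisymm (fun x hx ↦ ?_) ?_, ?_⟩
  · exact Ideal.mem_span_singleton.2 (hFD.trans (h x (Ideal.mem_sup_left hx)))
  · rwa [Ideal.span_singleton_le_iff_mem]
  · exact hFD.trans (h g (Ideal.mem_sup_right (Ideal.mem_span_singleton_self g)))

end PrimeIdeals

section Contraction

variable {M : Type} [AddCommGroup M] [Module.Free ℤ M] [Module.Finite ℤ M]

/-- The contraction to `ℚ[N]` of an ideal of `QBar[M]`, for a submodule `N` of `M`. -/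
def contract (N : Submodule ℤ M) (Q : Ideal QBar[M]) : Ideal ℚ[N] :=
  (Q.comap (emb N QBar)).comap (AddMonoidAlgebra.mapRingHom N (algebraMap ℚ QBar))

theorem eventually_dvd_of_evalAt_eq_zero {N : Submodule ℤ M} (hN : GenericallyNonvanishing N)
    {Q : Ideal QBar[M]} {F : ℚ[N]} (hF : Irreducible F) (hFQ : F ∈ contract N Q) (s : Finset ℤ[N]) :
    ∀ᶠ κ in generic M, ∀ α : QBarˣ, ¬ IsOfFinOrder α →
      (∀ f ∈ Q, evalAt QBar κ α f = 0) → contract N Q = Ideal.span {F} ∧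
      ∀ g ∈ s, evalAt ℤ (κ ∘ₗ N.subtype) α g = 0 →
        F ∣ AddMonoidAlgebra.mapRingHom N (algebraMap ℤ ℚ) g := by
  classical
  have key (g : ℤ[N]) : ∀ᶠ κ in generic M, ∀ α : QBarˣ, ¬ IsOfFinOrder α →
      (∀ f ∈ Q, evalAt QBar κ α f = 0) → evalAt ℤ (κ ∘ₗ N.subtype) α g = 0 →
      contract N Q = Ideal.span {F} ∧ F ∣ AddMonoidAlgebra.mapRingHom N (algebraMap ℤ ℚ) g := by
    by_cases hD : ∀ D, (∀ x ∈ contract N Q ⊔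
        Ideal.span {AddMonoidAlgebra.mapRingHom N (algebraMap ℤ ℚ) g}, D ∣ x) → IsUnit D
    · have := (tendsto_generic N.subtype N.injective_subtype).eventually (hN _ hD)
      filter_upwards [this] with κ hκ α hα hQ hg
      obtain ⟨x, hx, hx0⟩ := hκ α hα
      refine absurd ?_ hx0
      have hle : contract N Q ⊔ Ideal.span {AddMonoidAlgebra.mapRingHom N (algebraMap ℤ ℚ) g} ≤
          RingHom.ker (evalAt ℚ (κ ∘ₗ N.subtype) α) := by
        refine sup_le (fun y hy ↦ ?_) ?_
        · have := hQ _ hy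
          rw [evalAt_emb, evalAt_mapRingHom] at this
          exact this
        · rw [Ideal.span_singleton_le_iff_mem, RingHom.mem_ker, evalAt_mapRingHom]
          exact hg
      exact hle hx
    · push Not at hD
      obtain ⟨D, hD, hDu⟩ := hD
      have := eq_span_of_forall_dvd hF hFQ hDu hD
      exact Eventually.of_forall fun κ α hα hQ hg ↦ this
  have := (Filter.eventually_all_finset (insert 0 s)).2 fun g _ ↦ key g
  filter_upwards [this] with κ hκ α hα hQ
  exact ⟨(hκ 0 (by simp) α hα hQ (map_zero _)).1,
    fun g hg hg0 ↦ (hκ g (Finset.mem_insert_of_mem hg) α hα hQ hg0).2⟩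

end Contraction

section Galois

instance isAlgClosure_qBar : IsAlgClosure ℚ QBar where
  isAlgClosed := inferInstance
  isAlgebraic := by
    have h : (DivisionRing.toRatAlgebra : Algebra ℚ QBar) = AlgebraicClosure.instAlgebra ℚ :=
      Subsingleton.elim _ _
    rw [h]
    exact AlgebraicClosure.isAlgebraic ℚ

instance isAlgebraic_qBar : Algebra.IsAlgebraic ℚ QBar := IsAlgClosure.isAlgebraic

instance isGalois_qBar : IsGalois ℚ QBar where
  to_normal := IsAlgClosure.normal ℚ QBar
  to_isSeparable := inferInstance

theorem exists_mapRingHom_eq {R S N : Type*} [CommRing R] [CommRing S] [AddCommGroup N] (φ : R →+* S)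
    {f : S[N]} (hf : ∀ m, f.coeff m ∈ Set.range φ) :
    ∃ g : R[N], AddMonoidAlgebra.mapRingHom N φ g = f := by
  classical
  choose r hr using hf
  refine ⟨∑ m ∈ f.coeff.support, AddMonoidAlgebra.single m (r m), ?_⟩
  apply AddMonoidAlgebra.coeff_injective
  ext x
  rw [AddMonoidAlgebra.coeff_mapRingHom, AddMonoidAlgebra.coeff_sum, Finset.sum_apply', map_sum]
  simp only [AddMonoidAlgebra.coeff_single, Finsupp.single_apply, apply_ite φ, hr, map_zero]
  simp only [Finset.sum_ite_eq', Finsupp.mem_support_iff, ne_eq, ite_not]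
  split_ifs with h
  · exact h.symm
  · rfl

theorem isIntegral_mapRingHom {R S N : Type*} [CommRing R] [CommRing S] [Algebra R S]
    [Algebra.IsIntegral R S] [AddCommGroup N] :
    (AddMonoidAlgebra.mapRingHom N (algebraMap R S)).IsIntegral := by
  intro f
  induction f using AddMonoidAlgebra.induction_linear with
  | zero => exact RingHom.isIntegralElem_zero _
  | add f g hf hg => exact hf.add _ hg
  | single m r =>
    have h1 : (AddMonoidAlgebra.single m r : S[N]) =
        AddMonoidAlgebra.mapRingHom N (algebraMap R S) (AddMonoidAlgebra.single m 1) *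
          AddMonoidAlgebra.singleZeroRingHom r := by
      simp [AddMonoidAlgebra.single_mul_single]
    rw [h1]
    refine RingHom.IsIntegralElem.mul _ (RingHom.isIntegralElem_map _) ?_
    obtain ⟨p, hp, hpr⟩ := Algebra.IsIntegral.isIntegral (R := R) r
    refine ⟨p.map AddMonoidAlgebra.singleZeroRingHom, hp.map _, ?_⟩
    rw [Polynomial.eval₂_map]
    have h2 : (AddMonoidAlgebra.mapRingHom N (algebraMap R S)).comp
        AddMonoidAlgebra.singleZeroRingHom =
        (AddMonoidAlgebra.singleZeroRingHom : S →+* S[N]).comp (algebraMap R S) := by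
      ext x
      simp
    rw [h2, ← Polynomial.hom_eval₂, hpr, map_zero]

end Galois

end

section

section Orbit

variable {M : Type} [AddCommGroup M] [Module.Free ℤ M] [Module.Finite ℤ M]

theorem comap_mem_minimalPrimes (I : Ideal ℚ[M]) {Q : Ideal QBar[M]}
    (hQ : Q ∈ (I.map (AddMonoidAlgebra.mapRingHom M (algebraMap ℚ QBar))).minimalPrimes)
    (σ : Gal(QBar/ℚ)) :
    Q.comap (AddMonoidAlgebra.mapRingHom M (σ : QBar →+* QBar)) ∈
      (I.map (AddMonoidAlgebra.mapRingHom M (algebraMap ℚ QBar))).minimalPrimes := by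
  have hcomp (τ : Gal(QBar/ℚ)) : (AddMonoidAlgebra.mapRingHom M (τ : QBar →+* QBar)).comp
      (AddMonoidAlgebra.mapRingHom M (algebraMap ℚ QBar)) =
      AddMonoidAlgebra.mapRingHom M (algebraMap ℚ QBar) := by
    rw [← AddMonoidAlgebra.mapRingHom_comp]
    congr 1
    exact RingHom.ext fun x ↦ τ.commutes x
  let e : QBar[M] ≃+* QBar[M] := AddMonoidAlgebra.mapRingEquiv M (σ : QBar ≃+* QBar)
  have he : (e : QBar[M] →+* QBar[M]) = AddMonoidAlgebra.mapRingHom M (σ : QBar →+* QBar) := rfl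
  have he' : (e.symm : QBar[M] →+* QBar[M]) =
    AddMonoidAlgebra.mapRingHom M (σ.symm : QBar →+* QBar) := rfl
  have := Ideal.minimalPrimes_comap_of_surjective (f := (e : QBar[M] →+* QBar[M])) e.surjective hQ
  have h2 : (I.map (AddMonoidAlgebra.mapRingHom M (algebraMap ℚ QBar))).comap
      (e : QBar[M] →+* QBar[M]) = I.map (AddMonoidAlgebra.mapRingHom M (algebraMap ℚ QBar)) := by
    have h3 := Ideal.map_comap_of_equiv
      (I := I.map (AddMonoidAlgebra.mapRingHom M (algebraMap ℚ QBar))) e.symm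
    rw [RingEquiv.symm_symm] at h3
    have h4 := hcomp σ.symm
    rw [← he'] at h4
    refine Eq.trans h3.symm ?_
    rw [Ideal.map_map, h4]
  rw [h2, he] at this
  exact this

/-- A prime ideal of `QBar[N]` lying over a principal one is principal. -/
theorem exists_eq_span_of_comap_eq_span {N : Type*} [AddCommGroup N] [Module.Free ℤ N]
    [Module.Finite ℤ N] {Q : Ideal QBar[N]} (hQ : Q.IsPrime) {F : ℚ[N]} (hF : Irreducible F)
    (hFQ : Q.comap (AddMonoidAlgebra.mapRingHom N (algebraMap ℚ QBar)) = Ideal.span {F}) :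
    ∃ Φ, Irreducible Φ ∧ Φ ∣ AddMonoidAlgebra.mapRingHom N (algebraMap ℚ QBar) F ∧
      Q = Ideal.span {Φ} := by
  have hinj : Function.Injective (AddMonoidAlgebra.mapRingHom N (algebraMap ℚ QBar)) :=
    fun a b h ↦ AddMonoidAlgebra.coeff_injective (Finsupp.ext fun m ↦ (algebraMap ℚ QBar).injective
      (by rw [← AddMonoidAlgebra.coeff_mapRingHom, h, AddMonoidAlgebra.coeff_mapRingHom]))
  have hmem : AddMonoidAlgebra.mapRingHom N (algebraMap ℚ QBar) F ∈ Q := by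
    rw [← Ideal.mem_comap, hFQ]
    exact Ideal.mem_span_singleton_self F
  obtain ⟨Φ, hΦ, hΦQ, hΦF⟩ := exists_irreducible_mem hQ hmem
    ((map_ne_zero_iff _ hinj).2 hF.ne_zero)
  refine ⟨Φ, hΦ, hΦF, ?_⟩
  have hle : Ideal.span {Φ} ≤ Q := (Ideal.span_singleton_le_iff_mem _).2 hΦQ
  by_contra hne
  obtain ⟨x, hx, hx'⟩ := SetLike.exists_of_lt (lt_of_le_of_ne hle (Ne.symm hne))
  let : Algebra ℚ[N] QBar[N] := (AddMonoidAlgebra.mapRingHom N (algebraMap ℚ QBar)).toAlgebra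
  have : (Ideal.span {Φ}).IsPrime := (Ideal.span_singleton_prime hΦ.ne_zero).2 hΦ.prime
  have hlt := Ideal.comap_lt_comap_of_integral_mem_sdiff (R := ℚ[N]) hle ⟨hx, hx'⟩
    (isIntegral_mapRingHom (R := ℚ) x)
  change (Ideal.span {Φ}).comap (AddMonoidAlgebra.mapRingHom N (algebraMap ℚ QBar)) <
    Q.comap (AddMonoidAlgebra.mapRingHom N (algebraMap ℚ QBar)) at hlt
  rw [hFQ] at hlt
  refine hlt.not_ge ((Ideal.span_singleton_le_iff_mem _).2 ?_)
  rw [Ideal.mem_comap, Ideal.mem_span_singleton]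
  exact hΦF

theorem exists_irreducible_dvd_and_width_le (I : Ideal ℚ[M]) {Q : Ideal QBar[M]}
    (hQ : Q ∈ (I.map (AddMonoidAlgebra.mapRingHom M (algebraMap ℚ QBar))).minimalPrimes)
    {N : Submodule ℤ M} {F : ℚ[N]} (hF : Irreducible F) (hFQ : contract N Q = Ideal.span {F}) :
    ∃ Φ : QBar[N], Irreducible Φ ∧ Φ ∣ AddMonoidAlgebra.mapRingHom N (algebraMap ℚ QBar) F ∧
      emb N QBar Φ ∈ Q ∧ ∀ u, width u F ≤
        (I.map (AddMonoidAlgebra.mapRingHom M (algebraMap ℚ QBar))).minimalPrimes.ncard *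
          width u Φ := by
  classical
  have hQp : Q.IsPrime := hQ.1.1
  obtain ⟨Φ₀, hΦ₀, hΦ₀F, hΦ₀Q⟩ := exists_eq_span_of_comap_eq_span
    (hQp.comap (emb N QBar)) hF hFQ
  obtain ⟨m₀, hm₀⟩ := Finsupp.support_nonempty_iff.2
    fun h ↦ hΦ₀.ne_zero (AddMonoidAlgebra.coeff_injective h)
  rw [Finsupp.mem_support_iff] at hm₀
  have hu : IsUnit (AddMonoidAlgebra.single 0 (Φ₀.coeff m₀)⁻¹ : QBar[N]) :=
    isUnit_single _ (inv_ne_zero hm₀).isUnit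
  obtain ⟨Φ, hΦdef⟩ : ∃ Φ, Φ = AddMonoidAlgebra.single 0 (Φ₀.coeff m₀)⁻¹ * Φ₀ := ⟨_, rfl⟩
  have hΦ1 : Φ.coeff m₀ = 1 := by
    rw [hΦdef, coeff_single_mul_eq, sub_zero, inv_mul_cancel₀ hm₀]
  have hass : Associated Φ₀ Φ := by
    rw [hΦdef]
    exact ⟨hu.unit, mul_comm _ _⟩
  have hΦ : Irreducible Φ := hass.irreducible hΦ₀
  have hΦF : Φ ∣ AddMonoidAlgebra.mapRingHom N (algebraMap ℚ QBar) F := hass.dvd_iff_dvd_left.1 hΦ₀F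
  have hΦQ : Q.comap (emb N QBar) = Ideal.span {Φ} := by
    rw [hΦ₀Q]
    exact Ideal.span_singleton_eq_span_singleton.2 hass
  have hmemQ (x : QBar[N]) : emb N QBar x ∈ Q ↔ Φ ∣ x := by
    rw [← Ideal.mem_span_singleton, ← hΦQ, Ideal.mem_comap]
  -- the Galois action
  let s (σ : Gal(QBar/ℚ)) : QBar[N] →+* QBar[N] :=
    AddMonoidAlgebra.mapRingHom N (σ : QBar →+* QBar)
  have hs_coeff (σ : Gal(QBar/ℚ)) (f : QBar[N]) (m : N) : (s σ f).coeff m = σ (f.coeff m) :=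
    AddMonoidAlgebra.coeff_mapRingHom ..
  have hs_mul (σ τ : Gal(QBar/ℚ)) (f : QBar[N]) : s (σ * τ) f = s σ (s τ f) := by
    apply AddMonoidAlgebra.coeff_injective
    ext m
    rw [hs_coeff, hs_coeff, hs_coeff]
    rfl
  have hs_one (f : QBar[N]) : s 1 f = f := by
    apply AddMonoidAlgebra.coeff_injective
    ext m
    rw [hs_coeff]
    rfl
  have hs_supp (σ : Gal(QBar/ℚ)) (f : QBar[N]) : (s σ f).coeff.support = f.coeff.support := by
    ext m
    rw [Finsupp.mem_support_iff, Finsupp.mem_support_iff, hs_coeff, ne_eq, EmbeddingLike.map_eq_zero_iff]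
  let t (σ : Gal(QBar/ℚ)) : Ideal QBar[M] :=
    Q.comap (AddMonoidAlgebra.mapRingHom M (σ : QBar →+* QBar))
  have ht (σ : Gal(QBar/ℚ)) (x : QBar[N]) : emb N QBar x ∈ t σ ↔ s σ⁻¹ Φ ∣ x := by
    rw [Ideal.mem_comap, ← emb_mapRingHom, hmemQ]
    change Φ ∣ s σ x ↔ _
    constructor
    · intro h
      have := map_dvd (s σ⁻¹) h
      rwa [← hs_mul, inv_mul_cancel, hs_one] at this
    · intro h
      have := map_dvd (s σ) h
      rwa [← hs_mul, mul_inv_cancel, hs_one] at this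
  have hdet (σ τ : Gal(QBar/ℚ)) (h : t σ = t τ) : s σ⁻¹ Φ = s τ⁻¹ Φ := by
    have h1 : s σ⁻¹ Φ ∣ s τ⁻¹ Φ := by rw [← ht, h, ht]
    have h2 : s τ⁻¹ Φ ∣ s σ⁻¹ Φ := by rw [← ht, ← h, ht]
    have hne : s σ⁻¹ Φ ≠ 0 := fun h0 ↦ by
      have := hs_coeff σ⁻¹ Φ m₀
      rw [h0, hΦ1, map_one] at this
      exact zero_ne_one this
    obtain ⟨c, -, hc⟩ := exists_coeff_eq_of_associated hne (associated_of_dvd_dvd h1 h2)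
      (by rw [hs_supp, hs_supp])
    have hc1 := hc m₀
    rw [hs_coeff, hs_coeff, hΦ1, map_one, map_one, mul_one] at hc1
    apply AddMonoidAlgebra.coeff_injective
    ext m
    rw [hc m, ← hc1, one_mul]
  have hfin : (I.map (AddMonoidAlgebra.mapRingHom M (algebraMap ℚ QBar))).minimalPrimes.Finite :=
    Ideal.finite_minimalPrimes_of_isNoetherianRing _ _
  let f (Q' : Ideal QBar[M]) : QBar[N] := if h : ∃ σ, t σ = Q' then s h.choose⁻¹ Φ else 0
  have hsub : Set.range (fun σ ↦ s σ Φ) ⊆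
      f '' (I.map (AddMonoidAlgebra.mapRingHom M (algebraMap ℚ QBar))).minimalPrimes := by
    rintro _ ⟨σ, rfl⟩
    refine ⟨t σ⁻¹, comap_mem_minimalPrimes I hQ _, ?_⟩
    have h : ∃ τ, t τ = t σ⁻¹ := ⟨_, rfl⟩
    simp only [f, dif_pos h]
    rw [hdet _ _ h.choose_spec, inv_inv]
  have hOfin : (Set.range (fun σ ↦ s σ Φ)).Finite := (hfin.image f).subset hsub
  have hOcard : hOfin.toFinset.card ≤
      (I.map (AddMonoidAlgebra.mapRingHom M (algebraMap ℚ QBar))).minimalPrimes.ncard := by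
    rw [← Set.ncard_eq_toFinset_card _ hOfin]
    exact (Set.ncard_le_ncard hsub (hfin.image f)).trans (Set.ncard_image_le hfin)
  have hperm (σ : Gal(QBar/ℚ)) : s σ (∏ o ∈ hOfin.toFinset, o) = ∏ o ∈ hOfin.toFinset, o := by
    rw [map_prod]
    refine Finset.prod_nbij' (s σ) (s σ⁻¹) ?_ ?_ ?_ ?_ fun _ _ ↦ rfl
    · intro o ho
      obtain ⟨τ, rfl⟩ := hOfin.mem_toFinset.1 ho
      exact hOfin.mem_toFinset.2 ⟨σ * τ, hs_mul _ _ _⟩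
    · intro o ho
      obtain ⟨τ, rfl⟩ := hOfin.mem_toFinset.1 ho
      exact hOfin.mem_toFinset.2 ⟨σ⁻¹ * τ, hs_mul _ _ _⟩
    · intro o _
      rw [← hs_mul, inv_mul_cancel, hs_one]
    · intro o _
      rw [← hs_mul, mul_inv_cancel, hs_one]
  obtain ⟨p₀, hp₀⟩ := exists_mapRingHom_eq (N := N) (algebraMap ℚ QBar)
    (f := ∏ o ∈ hOfin.toFinset, o) fun m ↦ by
      rw [InfiniteGalois.mem_range_algebraMap_iff_fixed]
      intro σ
      rw [← hs_coeff, hperm]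
  have hΦO : Φ ∈ hOfin.toFinset := hOfin.mem_toFinset.2 ⟨1, hs_one Φ⟩
  have hpF : F ∣ p₀ := by
    rw [← Ideal.mem_span_singleton, ← hFQ]
    change emb N QBar (AddMonoidAlgebra.mapRingHom N (algebraMap ℚ QBar) p₀) ∈ Q
    rw [hmemQ, hp₀]
    exact Finset.dvd_prod_of_mem _ hΦO
  have hO0 : ∀ o ∈ hOfin.toFinset, o ≠ 0 := by
    intro o ho
    obtain ⟨τ, rfl⟩ := hOfin.mem_toFinset.1 ho
    intro h0
    have := hs_coeff τ Φ m₀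
    rw [show s τ Φ = 0 from h0, hΦ1, map_one] at this
    exact zero_ne_one this
  refine ⟨Φ, hΦ, hΦF, (hmemQ Φ).2 dvd_rfl, fun u ↦ ?_⟩
  have hsuppm (g : ℚ[N]) : g.coeff.support =
      (AddMonoidAlgebra.mapRingHom N (algebraMap ℚ QBar) g).coeff.support := by
    ext m
    simp
  calc width u F ≤ width u p₀ := by
        refine width_le_of_dvd u (fun h0 ↦ ?_) hpF
        rw [h0, map_zero] at hp₀
        exact Finset.prod_ne_zero_iff.2 hO0 hp₀.symm
    _ = width u (∏ o ∈ hOfin.toFinset, o) := by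
      rw [← hp₀]
      unfold width
      rw [← hsuppm]
    _ = ∑ o ∈ hOfin.toFinset, width u o := width_prod u _ _ hO0
    _ = ∑ o ∈ hOfin.toFinset, width u Φ := by
      refine Finset.sum_congr rfl fun o ho ↦ ?_
      obtain ⟨τ, rfl⟩ := hOfin.mem_toFinset.1 ho
      exact width_eq_of_support_eq u (hs_supp _ _)
    _ ≤ _ := by
      rw [Finset.sum_const, smul_eq_mul]
      exact Nat.mul_le_mul_right _ hOcard

end Orbit

end

section

section Binomial

variable {K L : Type*} [Field K] [AddCommGroup L]

/-- The binomial `z ^ g - c`. -/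
def binomial (g : L) (c : K) : K[L] :=
  AddMonoidAlgebra.single g 1 - AddMonoidAlgebra.single 0 c

theorem coeff_binomial (g : L) (c : K) (m : L) [Decidable (g = m)] [Decidable (0 = m)] :
    (binomial g c).coeff m = (if g = m then 1 else 0) - if 0 = m then c else 0 := by
  rw [binomial, AddMonoidAlgebra.coeff_sub, AddMonoidAlgebra.coeff_single,
    AddMonoidAlgebra.coeff_single, Finsupp.sub_apply, Finsupp.single_apply, Finsupp.single_apply]

theorem support_binomial_eq {g : L} (hg : g ≠ 0) {c c' : K} (hc : c ≠ 0) (hc' : c' ≠ 0) :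
    (binomial g c).coeff.support = (binomial g c').coeff.support := by
  classical
  ext m
  simp only [Finsupp.mem_support_iff, coeff_binomial]
  by_cases h : g = m <;> by_cases h0 : 0 = m
  · exact absurd (h.trans h0.symm) hg
  · simp [h, h0]
  · simp [h, h0, hc, hc']
  · simp [h, h0]

theorem binomial_ne_zero {g : L} (hg : g ≠ 0) (c : K) : binomial g c ≠ 0 := by
  classical
  intro h
  have := coeff_binomial g c g
  rw [h, if_pos rfl, if_neg hg.symm] at this
  simp at this

theorem isRelPrime_binomial [Module.Free ℤ L] [Module.Finite ℤ L] {g : L} {c c' : K} (h : c ≠ c') :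
    IsRelPrime (binomial g c) (binomial g c') := by
  intro D h1 h2
  have h3 := dvd_sub h2 h1
  have h4 : binomial g c' - binomial g c = AddMonoidAlgebra.single 0 (c - c') := by
    rw [binomial, binomial, AddMonoidAlgebra.single_sub]
    ring
  rw [h4] at h3
  exact isUnit_of_dvd_unit h3 (isUnit_single _ (sub_ne_zero.2 h).isUnit)

theorem binomial_dvd_single_sub {g : L} {c : K} (hc : c ≠ 0) (k : ℤ) :
    binomial g c ∣ AddMonoidAlgebra.single (k • g) 1 - AddMonoidAlgebra.single 0 (c ^ k) := by
  have hnat (j : ℕ) : binomial g c ∣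
      AddMonoidAlgebra.single (j • g) 1 - AddMonoidAlgebra.single 0 (c ^ j) := by
    have := sub_dvd_pow_sub_pow (AddMonoidAlgebra.single g (1 : K)) (AddMonoidAlgebra.single 0 c) j
    rw [AddMonoidAlgebra.single_pow, AddMonoidAlgebra.single_pow, one_pow, smul_zero] at this
    exact this
  obtain ⟨j, rfl | rfl⟩ := k.eq_nat_or_neg
  · simpa using hnat j
  · have h1 : (AddMonoidAlgebra.single ((-(j : ℤ)) • g) (1 : K) -
        AddMonoidAlgebra.single 0 (c ^ (-(j : ℤ))) : K[L]) =
        (AddMonoidAlgebra.single (j • g) 1 - AddMonoidAlgebra.single 0 (c ^ j)) *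
          AddMonoidAlgebra.single ((-(j : ℤ)) • g) (-(c ^ j)⁻¹) := by
      rw [sub_mul, AddMonoidAlgebra.single_mul_single, AddMonoidAlgebra.single_mul_single,
        neg_smul, natCast_zsmul, add_neg_cancel, zero_add, zpow_neg, zpow_natCast, one_mul,
        mul_neg, mul_inv_cancel₀ (pow_ne_zero _ hc), AddMonoidAlgebra.single_neg,
        AddMonoidAlgebra.single_neg]
      ring
    rw [h1]
    exact (hnat j).mul_right _

theorem binomial_dvd_of_evalAt_eq_zero {g : L} (hg : ∀ x : L, ∃ k : ℤ, x = k • g) (κ : L →ₗ[ℤ] ℤ)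
    (α : Kˣ) {f : K[L]} (hf : evalAt K κ α f = 0) : binomial g ((α : K) ^ κ g) ∣ f := by
  have key (f : K[L]) :
      binomial g ((α : K) ^ κ g) ∣ f - AddMonoidAlgebra.single 0 (evalAt K κ α f) := by
    induction f using AddMonoidAlgebra.induction_linear with
    | zero => simp
    | add a b ha hb =>
      rw [map_add, AddMonoidAlgebra.single_add, add_sub_add_comm]
      exact dvd_add ha hb
    | single m r =>
      obtain ⟨k, rfl⟩ := hg m
      have := (binomial_dvd_single_sub (g := g) (zpow_ne_zero (κ g) α.ne_zero) k).mul_right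
        (AddMonoidAlgebra.single 0 r)
      rw [sub_mul, AddMonoidAlgebra.single_mul_single, AddMonoidAlgebra.single_mul_single,
        one_mul, add_zero, add_zero] at this
      rw [evalAt_single, map_smul, smul_eq_mul, mul_comm k, zpow_mul, Algebra.algebraMap_self_apply,
        mul_comm r]
      exact this
  have := key f
  rwa [hf, AddMonoidAlgebra.single_zero, sub_zero] at this

theorem card_mul_width_binomial_le [Module.Free ℤ L] [Module.Finite ℤ L] {g : L}
    (hg : ∀ x : L, ∃ k : ℤ, x = k • g) (hg0 : g ≠ 0) {κ : L →ₗ[ℤ] ℤ} (hκ : κ g ≠ 0) {α : Kˣ}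
    (hα : ¬ IsOfFinOrder α) {f : K[L]} (hf : f ≠ 0) {s : Finset ℕ}
    (hs : ∀ p ∈ s, evalAt K ((p : ℤ) • κ) α f = 0) (u : L →ₗ[ℤ] ℤ) :
    s.card * width u (binomial g ((α : K) ^ κ g)) ≤ width u f := by
  have hinj (p q : ℕ) (hpq : p ≠ q) :
      (α : K) ^ ((p : ℤ) • κ) g ≠ (α : K) ^ ((q : ℤ) • κ) g := by
    intro h
    rw [← Units.val_zpow_eq_zpow_val, ← Units.val_zpow_eq_zpow_val, Units.val_inj] at h
    have h1 := (injective_zpow_iff_not_isOfFinOrder.2 hα) h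
    simp only [LinearMap.smul_apply, smul_eq_mul] at h1
    exact hpq (by exact_mod_cast mul_right_cancel₀ hκ h1)
  have hprod : (∏ p ∈ s, binomial g ((α : K) ^ ((p : ℤ) • κ) g)) ∣ f :=
    Finset.prod_dvd_of_isRelPrime (fun p _ q _ hpq ↦ isRelPrime_binomial (hinj p q hpq))
      fun p hp ↦ binomial_dvd_of_evalAt_eq_zero hg _ α (hs p hp)
  have hle := width_le_of_dvd u hf hprod
  rw [width_prod _ _ _ fun _ _ ↦ binomial_ne_zero hg0 _] at hle
  refine le_trans (le_of_eq ?_) hle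
  rw [← smul_eq_mul, ← Finset.sum_const]
  exact Finset.sum_congr rfl fun p _ ↦ width_eq_of_support_eq _
    (support_binomial_eq hg0 (zpow_ne_zero _ α.ne_zero) (zpow_ne_zero _ α.ne_zero))

end Binomial

section Collinear

theorem exists_saturated_generator {M : Type*} [AddCommGroup M] [Module.Free ℤ M] {v : M}
    (hv : v ≠ 0) : ∃ g : M, g ≠ 0 ∧ ∀ x, (∃ a b : ℤ, a ≠ 0 ∧ a • x = b • v) ↔
      x ∈ Submodule.span ℤ {g} := by
  obtain ⟨i, hi⟩ : ∃ i, (Module.Free.chooseBasis ℤ M).repr v i ≠ 0 := by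
    by_contra! h
    exact hv ((Module.Free.chooseBasis ℤ M).repr.map_eq_zero_iff.1 (Finsupp.ext h))
  let w : M →ₗ[ℤ] ℤ := (Module.Free.chooseBasis ℤ M).coord i
  have hw : w v ≠ 0 := hi
  let L : Submodule ℤ M :=
    { carrier := {x | ∃ a b : ℤ, a ≠ 0 ∧ a • x = b • v}
      add_mem' := by
        rintro x y ⟨a, b, ha, hab⟩ ⟨a', b', ha', hab'⟩
        refine ⟨a * a', a' * b + a * b', mul_ne_zero ha ha', ?_⟩
        rw [smul_add, mul_comm a a', mul_smul, hab, mul_comm a' a, mul_smul a a', hab', add_smul,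
          mul_smul, mul_smul]
      zero_mem' := ⟨1, 0, one_ne_zero, by simp⟩
      smul_mem' := by
        rintro c x ⟨a, b, ha, hab⟩
        exact ⟨a, c * b, ha, by rw [smul_comm, hab, mul_smul]⟩ }
  have hinj : ∀ x ∈ L, w x = 0 → x = 0 := by
    rintro x ⟨a, b, ha, hab⟩ hx
    have h1 := congrArg w hab
    rw [map_smul, map_smul, hx, smul_zero, smul_eq_mul] at h1
    have hb : b = 0 := (mul_eq_zero.1 h1.symm).resolve_right hw
    rw [hb, zero_smul] at hab
    exact (smul_eq_zero.1 hab).resolve_left ha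
  obtain ⟨d, hd⟩ := (inferInstance : (L.map w).IsPrincipal)
  obtain ⟨g, hgL, hgd⟩ : d ∈ L.map w := by
    rw [hd]
    exact Submodule.mem_span_singleton_self d
  have hspan : ∀ x ∈ L, ∃ c : ℤ, c • g = x := by
    intro x hx
    have h1 : w x ∈ L.map w := ⟨x, hx, rfl⟩
    rw [hd] at h1
    obtain ⟨c, hc⟩ := Submodule.mem_span_singleton.1 h1
    refine ⟨c, ?_⟩
    have := hinj (c • g - x) (L.sub_mem (L.smul_mem c hgL) hx)
      (by rw [map_sub, map_smul, hgd, hc, sub_self])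
    exact sub_eq_zero.1 this
  refine ⟨g, ?_, fun x ↦ ⟨fun hx ↦ Submodule.mem_span_singleton.2 (hspan x hx), fun hx ↦ ?_⟩⟩
  · rintro rfl
    obtain ⟨c, hc⟩ := hspan v ⟨1, 1, one_ne_zero, rfl⟩
    exact hv (by rw [← hc, smul_zero])
  · obtain ⟨c, rfl⟩ := Submodule.mem_span_singleton.1 hx
    exact L.smul_mem c hgL

theorem retr_single {R M : Type*} [CommRing R] [AddCommGroup M] (N : Submodule ℤ M) {m : M}
    (hm : m ∈ N) (r : R) : retr N R (AddMonoidAlgebra.single m r) =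
      AddMonoidAlgebra.single ⟨m, hm⟩ r := by
  classical
  apply AddMonoidAlgebra.coeff_injective
  ext x
  simp [AddMonoidAlgebra.coeff_single, Finsupp.single_apply, Subtype.ext_iff]

theorem retr_single_of_notMem {R M : Type*} [CommRing R] [AddCommGroup M] (N : Submodule ℤ M)
    {m : M} (hm : m ∉ N) (r : R) : retr N R (AddMonoidAlgebra.single m r) = 0 := by
  classical
  apply AddMonoidAlgebra.coeff_injective
  ext x
  have : m ≠ x := fun h ↦ hm (h ▸ x.2)
  simp [AddMonoidAlgebra.coeff_single, this]

theorem expandHom_retr {R M : Type*} [CommRing R] [AddCommGroup M] (N : Submodule ℤ M) {p : ℕ}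
    (hN : ∀ x, (p : ℤ) • x ∈ N → x ∈ N) (f : R[M]) :
    expandHom R N p (retr N R f) = retr N R (expandHom R M p f) := by
  induction f using AddMonoidAlgebra.induction_linear with
  | zero => simp
  | add a b ha hb => rw [map_add, map_add, map_add, map_add, ha, hb]
  | single m r =>
    rw [expandHom_single]
    by_cases hm : m ∈ N
    · rw [retr_single N hm, expandHom_single, retr_single N (N.smul_mem p hm)]
      rfl
    · rw [retr_single_of_notMem N hm, retr_single_of_notMem N fun h ↦ hm (hN m h), map_zero]

theorem emb_retr {R M : Type*} [CommRing R] [AddCommGroup M] {N : Submodule ℤ M} {f : R[M]}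
    (hf : ∀ m ∈ f.coeff.support, m ∈ N) : emb N R (retr N R f) = f := by
  apply AddMonoidAlgebra.coeff_injective
  ext x
  by_cases hx : x ∈ N
  · rw [show x = ((⟨x, hx⟩ : N) : M) from rfl, coeff_emb, coeff_retr]
  · rw [coeff_emb_of_notMem _ hx]
    by_contra h
    exact hx (hf x (Finsupp.mem_support_iff.2 fun h0 ↦ h h0.symm))

theorem support_emb {R M : Type*} [CommRing R] [AddCommGroup M] {N : Submodule ℤ M} (f : R[N]) :
    (emb N R f).coeff.support = f.coeff.support.map ⟨N.subtype, N.injective_subtype⟩ := by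
  ext x
  simp only [Finsupp.mem_support_iff, Finset.mem_map]
  constructor
  · intro h
    by_cases hx : x ∈ N
    · rw [show x = ((⟨x, hx⟩ : N) : M) from rfl, coeff_emb] at h
      exact ⟨⟨x, hx⟩, h, rfl⟩
    · exact absurd (coeff_emb_of_notMem f hx) h
  · rintro ⟨y, hy, rfl⟩
    rwa [Function.Embedding.coeFn_mk, Submodule.subtype_apply, coeff_emb]

theorem width_emb {R M : Type*} [CommRing R] [AddCommGroup M] {N : Submodule ℤ M}
    (u : M →ₗ[ℤ] ℤ) (f : R[N]) : width u (emb N R f) = width (u ∘ₗ N.subtype) f := by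
  apply le_antisymm <;> rw [width_le_iff] <;> intro x hx y hy
  · rw [support_emb, Finset.mem_map] at hx hy
    obtain ⟨x, hx, rfl⟩ := hx
    obtain ⟨y, hy, rfl⟩ := hy
    exact sub_le_width (u ∘ₗ N.subtype) hx hy
  · refine sub_le_width u (m := (x : M)) (m' := (y : M)) ?_ ?_ <;>
    rw [support_emb, Finset.mem_map]
    · exact ⟨x, hx, rfl⟩
    · exact ⟨y, hy, rfl⟩

theorem card_mul_width_le {K M : Type*} [Field K] [AddCommGroup M] [Module.Free ℤ M]
    [Module.Finite ℤ M] {Φ G : K[M]} (hΦ : Irreducible Φ) {m₀ v : M} (hv : v ≠ 0)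
    (hΦv : ∀ m ∈ Φ.coeff.support, ∃ a b : ℤ, a ≠ 0 ∧ a • (m - m₀) = b • v) {κ : M →ₗ[ℤ] ℤ}
    (hκ : κ v ≠ 0) {α : Kˣ} (hα : ¬ IsOfFinOrder α) (hΦ0 : evalAt K κ α Φ = 0) (hG : G ≠ 0)
    {s : Finset ℕ} (hs : ∀ p ∈ s, 0 < p) (hdvd : ∀ p ∈ s, Φ ∣ expandHom K M p G)
    (u : M →ₗ[ℤ] ℤ) : s.card * width u Φ ≤ width u G := by
  obtain ⟨g, hg0, hg⟩ := exists_saturated_generator hv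
  obtain ⟨N, hN⟩ : ∃ N, N = Submodule.span ℤ {g} := ⟨_, rfl⟩
  rw [← hN] at hg
  have hgN : g ∈ N := hN ▸ Submodule.mem_span_singleton_self g
  have hgen (x : N) : ∃ k : ℤ, x = k • (⟨g, hgN⟩ : N) := by
    obtain ⟨k, hk⟩ := Submodule.mem_span_singleton.1 (hN ▸ x.2 : (x : M) ∈ Submodule.span ℤ {g})
    exact ⟨k, Subtype.ext hk.symm⟩
  have hg0' : (⟨g, hgN⟩ : N) ≠ 0 := fun h ↦ hg0 (congrArg Subtype.val h)
  have hκg : κ g ≠ 0 := by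
    intro h0
    obtain ⟨k, hk⟩ := hgen ⟨v, (hg v).1 ⟨1, 1, one_ne_zero, rfl⟩⟩
    have : v = k • g := congrArg Subtype.val hk
    rw [this, map_smul, h0, smul_zero] at hκ
    exact hκ rfl
  have hsat (p : ℕ) (hp : 0 < p) (x : M) (hx : (p : ℤ) • x ∈ N) : x ∈ N := by
    obtain ⟨a, b, ha, hab⟩ := (hg _).2 hx
    exact (hg x).1 ⟨a * p, b, mul_ne_zero ha (by exact_mod_cast hp.ne'), by rw [mul_smul, hab]⟩
  -- the polynomial `Φ` is a translate of a binomial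
  obtain ⟨Ψ, hΨ⟩ : ∃ Ψ, Ψ = retr N K (AddMonoidAlgebra.single (-m₀) 1 * Φ) := ⟨_, rfl⟩
  have hΨ1 : emb N K Ψ = AddMonoidAlgebra.single (-m₀) 1 * Φ := by
    rw [hΨ]
    refine emb_retr fun m hm ↦ (hg m).1 ?_
    rw [Finsupp.mem_support_iff, coeff_single_mul_eq, one_mul, sub_neg_eq_add] at hm
    have := hΦv (m + m₀) (Finsupp.mem_support_iff.2 hm)
    rwa [add_sub_cancel_right] at this
  have hunit : IsUnit (AddMonoidAlgebra.single (-m₀) 1 : K[M]) := isUnit_single _ isUnit_one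
  have hass : Associated Φ (emb N K Ψ) := by
    rw [hΨ1]
    exact ⟨hunit.unit, mul_comm _ _⟩
  have hΨ0 : evalAt K (κ ∘ₗ N.subtype) α Ψ = 0 := by
    rw [← evalAt_emb, hΨ1, map_mul, hΦ0, mul_zero]
  obtain ⟨D, hD⟩ := binomial_dvd_of_evalAt_eq_zero hgen _ α hΨ0
  have hbu : ¬ IsUnit (binomial (⟨g, hgN⟩ : N) ((α : K) ^ (κ ∘ₗ N.subtype) ⟨g, hgN⟩)) := by
    intro hb
    have := hb.map (evalAt K (κ ∘ₗ N.subtype) α)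
    rw [binomial, map_sub, evalAt_single, evalAt_single, map_zero, zpow_zero] at this
    simp at this
  have hDu : IsUnit D := by
    have h1 := hass.irreducible hΦ
    rw [hD, map_mul] at h1
    exact isUnit_of_isUnit_emb
      ((h1.isUnit_or_isUnit rfl).resolve_left fun h ↦ hbu (isUnit_of_isUnit_emb h))
  have hwΦ : width u Φ = width (u ∘ₗ N.subtype)
      (binomial (⟨g, hgN⟩ : N) ((α : K) ^ (κ ∘ₗ N.subtype) ⟨g, hgN⟩)) := by
    rw [width_eq_of_associated u hass, width_emb]
    refine (width_eq_of_associated _ ?_).symm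
    rw [hD]
    exact ⟨hDu.unit, rfl⟩
  -- a translate of `G` supported on the line
  obtain ⟨m, hm⟩ := Finsupp.support_nonempty_iff.2
    fun h ↦ hG (AddMonoidAlgebra.coeff_injective h)
  obtain ⟨H, hH⟩ : ∃ H, H = retr N K (AddMonoidAlgebra.single (-m) 1 * G) := ⟨_, rfl⟩
  have hH0 : H ≠ 0 := by
    intro h0
    have h1 : H.coeff 0 = G.coeff m := by
      rw [hH, coeff_retr, coeff_single_mul_eq]
      simp
    rw [h0] at h1
    exact Finsupp.mem_support_iff.1 hm h1.symm
  have hHG : width (u ∘ₗ N.subtype) H ≤ width u G := by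
    rw [width_le_iff]
    intro x hx y hy
    rw [Finsupp.mem_support_iff, hH, coeff_retr, coeff_single_mul_eq, one_mul, sub_neg_eq_add,
      ← Finsupp.mem_support_iff] at hx hy
    have := sub_le_width u hx hy
    simpa using this
  have hH' (p : ℕ) (hp : p ∈ s) : evalAt K ((p : ℤ) • (κ ∘ₗ N.subtype)) α H = 0 := by
    rw [← evalAt_expandHom, hH, expandHom_retr N (hsat p (hs p hp)), map_mul, expandHom_single]
    obtain ⟨E, hE⟩ := hdvd p hp
    have h1 : AddMonoidAlgebra.single ((p : ℤ) • -m) 1 * expandHom K M p G =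
        emb N K Ψ * (AddMonoidAlgebra.single m₀ 1 * AddMonoidAlgebra.single ((p : ℤ) • -m) 1 * E) := by
      have h2 : (AddMonoidAlgebra.single (-m₀) 1 * AddMonoidAlgebra.single m₀ 1 : K[M]) = 1 := by
        rw [AddMonoidAlgebra.single_mul_single, neg_add_cancel, one_mul]
        rfl
      rw [hE, hΨ1]
      calc _ = (AddMonoidAlgebra.single (-m₀) 1 * AddMonoidAlgebra.single m₀ 1 : K[M]) *
            (AddMonoidAlgebra.single ((p : ℤ) • -m) 1 * (Φ * E)) := by rw [h2, one_mul]
        _ = _ := by ring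
    rw [h1, retr_emb_mul, map_mul, hΨ0, zero_mul]
  rw [hwΦ]
  exact (card_mul_width_binomial_le hgen hg0' hκg hα hH0 hH' _).trans hHG

end Collinear

end

section

section ZeroEstimate

variable {K M : Type*} [Field K] [AddCommGroup M] [Module.Free ℤ M] [Module.Finite ℤ M]

/-- If `Φ` divides many of the `expandHom K M p G`, then the width of `G` is large. -/
theorem exists_mul_width_le [CharZero K] [IsAlgClosed K] {ι : Type*} {w : ι → M →ₗ[ℤ] ℤ}
    (hw : ∀ x, (∀ i, w i x = 0) → x = 0) {Φ G : K[M]} (hΦ : Irreducible Φ) {r : ℕ}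
    (hr : ∀ i, width (w i) Φ ≤ r) {κ : M →ₗ[ℤ] ℤ}
    (hκ : ∀ x, x ≠ 0 → (∀ i, |w i x| ≤ r) → κ x ≠ 0) {α : Kˣ} (hα : ¬ IsOfFinOrder α)
    (hΦ0 : evalAt K κ α Φ = 0) (hG : G ≠ 0) {s : Finset ℕ} (hs : ∀ p ∈ s, p.Prime)
    (hsr : 2 * r ^ 2 < ∏ p ∈ s, p) (hdvd : ∀ p ∈ s, Φ ∣ expandHom K M p G) (i : ι) :
    (∃ p ∈ s, p * width (w i) Φ ≤ width (w i) G) ∨ s.card * width (w i) Φ ≤ width (w i) G := by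
  by_cases hpos : width (w i) Φ = 0
  · right
    simp [hpos]
  have habs {m m' : M} (hm : m ∈ Φ.coeff.support) (hm' : m' ∈ Φ.coeff.support) (j : ι) :
      |w j (m - m')| ≤ r := by
    have h1 := sub_le_width (w j) hm hm'
    have h2 := sub_le_width (w j) hm' hm
    have h3 : (width (w j) Φ : ℤ) ≤ r := by exact_mod_cast hr j
    rw [map_sub, abs_le]
    constructor <;> linarith
  by_cases hcol : ∃ p ∈ s, ∃ m₀ ∈ Φ.coeff.support, ∃ m₁ ∈ Φ.coeff.support, ∃ m₂ ∈ Φ.coeff.support,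
      ∃ j k, ¬ (p : ℤ) ∣ w j (m₁ - m₀) * w k (m₂ - m₀) - w k (m₁ - m₀) * w j (m₂ - m₀)
  · obtain ⟨p, hp, m₀, h₀, m₁, h₁, m₂, h₂, j, k, hjk⟩ := hcol
    exact Or.inl ⟨p, hp, prime_mul_width_le hΦ h₀ h₁ h₂ (hs p hp) hjk hG (hdvd p hp) _⟩
  push Not at hcol
  have hminor {m₀ m₁ m₂ : M} (h₀ : m₀ ∈ Φ.coeff.support) (h₁ : m₁ ∈ Φ.coeff.support)
      (h₂ : m₂ ∈ Φ.coeff.support) (j k : ι) :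
      w j (m₁ - m₀) * w k (m₂ - m₀) - w k (m₁ - m₀) * w j (m₂ - m₀) = 0 := by
    have h1 : ((∏ p ∈ s, p : ℕ) : ℤ) ∣
        w j (m₁ - m₀) * w k (m₂ - m₀) - w k (m₁ - m₀) * w j (m₂ - m₀) := by
      push_cast
      refine Finset.prod_dvd_of_coprime (fun p hp q hq hpq ↦ ?_)
        fun p hp ↦ hcol p hp m₀ h₀ m₁ h₁ m₂ h₂ j k
      exact Nat.isCoprime_iff_coprime.2 ((Nat.coprime_primes (hs p hp) (hs q hq)).2 hpq)
    refine Int.eq_zero_of_abs_lt_dvd h1 ?_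
    have h2 : |w j (m₁ - m₀) * w k (m₂ - m₀)| ≤ r * r := by
      rw [abs_mul]
      exact mul_le_mul (habs h₁ h₀ j) (habs h₂ h₀ k) (abs_nonneg _) (by positivity)
    have h3 : |w k (m₁ - m₀) * w j (m₂ - m₀)| ≤ r * r := by
      rw [abs_mul]
      exact mul_le_mul (habs h₁ h₀ k) (habs h₂ h₀ j) (abs_nonneg _) (by positivity)
    have h4 : (2 * r ^ 2 : ℤ) < (∏ p ∈ s, p : ℕ) := by exact_mod_cast hsr
    have := abs_sub (w j (m₁ - m₀) * w k (m₂ - m₀)) (w k (m₁ - m₀) * w j (m₂ - m₀))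
    nlinarith
  obtain ⟨m₁, h₁, m₀, h₀, h10⟩ : ∃ m₁ ∈ Φ.coeff.support, ∃ m₀ ∈ Φ.coeff.support,
      0 < w i m₁ - w i m₀ := by
    by_contra! h
    exact hpos (Nat.le_zero.1 (width_le_iff.2 fun m hm m' hm' ↦ by exact_mod_cast h m hm m' hm'))
  rw [← map_sub] at h10
  have hv : m₁ - m₀ ≠ 0 := fun h ↦ by simp [h] at h10
  right
  refine card_mul_width_le hΦ (m₀ := m₀) hv (fun m hm ↦ ?_)
    (hκ _ hv fun j ↦ habs h₁ h₀ j) hα hΦ0 hG (fun p hp ↦ (hs p hp).pos) hdvd _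
  refine ⟨w i (m₁ - m₀), w i (m - m₀), h10.ne', ?_⟩
  rw [← sub_eq_zero]
  refine hw _ fun j ↦ ?_
  rw [map_sub, map_smul, map_smul, smul_eq_mul, smul_eq_mul, mul_comm (w i (m - m₀))]
  exact hminor h₀ h₁ hm i j

end ZeroEstimate

section Denominators

variable {M : Type*} [AddCommGroup M]

theorem support_mapRingHom {R S : Type*} [CommRing R] [CommRing S] {φ : R →+* S}
    (hφ : Function.Injective φ) (f : R[M]) :
    (AddMonoidAlgebra.mapRingHom M φ f).coeff.support = f.coeff.support := by
  ext m
  rw [Finsupp.mem_support_iff, Finsupp.mem_support_iff, AddMonoidAlgebra.coeff_mapRingHom, ne_eq,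
    map_eq_zero_iff φ hφ]

theorem width_mapRingHom {R S : Type*} [CommRing R] [CommRing S] {φ : R →+* S}
    (hφ : Function.Injective φ) (u : M →ₗ[ℤ] ℤ) (f : R[M]) :
    width u (AddMonoidAlgebra.mapRingHom M φ f) = width u f := by
  unfold width
  rw [support_mapRingHom hφ]

theorem exists_mapRingHom_eq_single_mul (f : ℚ[M]) : ∃ (d : ℤ) (g : ℤ[M]), d ≠ 0 ∧
    AddMonoidAlgebra.mapRingHom M (algebraMap ℤ ℚ) g = AddMonoidAlgebra.single 0 (d : ℚ) * f := by
  obtain ⟨d, hd⟩ := IsLocalization.exist_integer_multiples_of_finset (nonZeroDivisors ℤ)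
    (f.coeff.support.image f.coeff)
  obtain ⟨g, hg⟩ := exists_mapRingHom_eq (N := M) (algebraMap ℤ ℚ)
    (f := AddMonoidAlgebra.single 0 ((d : ℤ) : ℚ) * f) fun m ↦ by
      rw [coeff_single_mul_eq, sub_zero]
      by_cases hm : m ∈ f.coeff.support
      · obtain ⟨z, hz⟩ := hd _ (Finset.mem_image_of_mem _ hm)
        refine ⟨z, hz.trans ?_⟩
        simp [Algebra.smul_def]
      · rw [Finsupp.notMem_support_iff.1 hm, mul_zero]
        exact ⟨0, map_zero _⟩
  exact ⟨d, g, nonZeroDivisors.coe_ne_zero d, hg⟩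

theorem abs_le_of_mem_support_pow {R : Type*} [CommRing R] {f : R[M]} {u : M →ₗ[ℤ] ℤ} {w : ℕ}
    (h : ∀ m ∈ f.coeff.support, |u m| ≤ w) (e : ℕ) :
    ∀ m ∈ (f ^ e).coeff.support, |u m| ≤ (e * w : ℕ) := by
  classical
  induction e with
  | zero =>
    intro m hm
    rw [pow_zero, AddMonoidAlgebra.one_def, AddMonoidAlgebra.coeff_single] at hm
    have := Finsupp.support_single_subset hm
    rw [Finset.mem_singleton] at this
    simp [this]
  | succ e ih =>
    intro m hm
    rw [pow_succ] at hm
    obtain ⟨a, ha, b, hb, rfl⟩ := Finset.mem_add.1 (AddMonoidAlgebra.support_coeff_mul_subset _ _ hm)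
    have h1 := ih a ha
    have h2 := h b hb
    rw [map_add]
    refine (abs_add_le _ _).trans ?_
    push_cast at *
    linarith

end Denominators

end

section

section Extrapolation

variable {Λ : Type} [AddCommGroup Λ] [Module.Free ℤ Λ] [Module.Finite ℤ Λ] {ι : Type} [Fintype ι]

theorem eq_zero_or_isUnit_of_forall_width_eq_zero {k : Type*} [Field k] {u : ι → Λ →ₗ[ℤ] ℤ}
    (hu : ∀ x, (∀ i, u i x = 0) → x = 0) {F : k[Λ]} (hF0 : F ≠ 0) (hF : ∀ i, width (u i) F = 0) :
    IsUnit F := by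
  classical
  obtain ⟨m, hm⟩ := Finsupp.support_nonempty_iff.2
    fun h ↦ hF0 (AddMonoidAlgebra.coeff_injective h)
  have h1 : F = AddMonoidAlgebra.single m (F.coeff m) := by
    apply AddMonoidAlgebra.coeff_injective
    ext x
    rw [AddMonoidAlgebra.coeff_single, Finsupp.single_apply]
    split_ifs with h
    · rw [h]
    · by_contra hx
      refine h (sub_eq_zero.1 (hu _ fun i ↦ ?_))
      have h2 := sub_le_width (u i) hm (Finsupp.mem_support_iff.2 hx)
      have h3 := sub_le_width (u i) (Finsupp.mem_support_iff.2 hx) hm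
      rw [hF i] at h2 h3
      rw [map_sub]
      push_cast at h2 h3
      linarith
  rw [h1]
  exact isUnit_single _ (Finsupp.mem_support_iff.1 hm).isUnit

theorem log_card_mul_le {u : ι → Λ →ₗ[ℤ] ℤ} {hu : ∀ x, (∀ i, u i x = 0) → x = 0} {N X : ℕ}
    (hNX : 2 * N + 1 ≤ X) (hN : 1 ≤ N) (e : ℕ) :
    Real.log ((slab u hu N).card * X * N ^ e) ≤ (Fintype.card ι + 1 + e : ℕ) * Real.log X := by
  have hcard : 0 < (slab u hu N).card := Finset.card_pos.2 ⟨0, zero_mem_slab N⟩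
  have hX : 0 < X := by omega
  rw [← Real.log_pow]
  refine Real.log_le_log (by positivity) ?_
  have h1 : (slab u hu N).card ≤ X ^ Fintype.card ι :=
    (card_slab_le N).trans (Nat.pow_le_pow_left hNX _)
  have h2 : N ^ e ≤ X ^ e := Nat.pow_le_pow_left (by omega) _
  rw [pow_add, pow_add, pow_one]
  exact_mod_cast Nat.mul_le_mul (Nat.mul_le_mul_right X h1) h2

/-- A point of small height on the torus cannot lie on a hypersurface of small degree. -/
theorem not_small_point {u : ι → Λ →ₗ[ℤ] ℤ} (hu : ∀ x, (∀ i, u i x = 0) → x = 0) {c : ι → ℤ}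
    {κ : Λ →ₗ[ℤ] ℤ} (hκ : κ = ∑ a, c a • u a) {α : QBarˣ} (hα : ¬ IsOfFinOrder α) {h : ℝ}
    (hh : IsHeightBound α h) {F : ℚ[Λ]} (hF : Irreducible F) {Φ : QBar[Λ]} (hΦ : Irreducible Φ)
    (hΦF : Φ ∣ AddMonoidAlgebra.mapRingHom Λ (algebraMap ℚ QBar) F) {B : ℕ}
    (hB : ∀ u', width u' F ≤ B * width u' Φ) (hΦ0 : evalAt QBar κ α Φ = 0) {r : ℕ}
    (hr : ∀ i, width (u i) F ≤ r) (hκr : ∀ x, x ≠ 0 → (∀ i, |u i x| ≤ r) → κ x ≠ 0) {e A : ℕ}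
    (he : 1 ≤ e) (hA : ∀ c : ℕ → ℕ, 0 < c 1 → (∀ j, c 1 ≤ c (j + 1)) →
      (∀ j, c j ≤ c 1 * (2 * j + 1) ^ Fintype.card ι) →
      ∃ j, e ≤ j ∧ j ≤ A ∧ (Fintype.card ι + e + 2) * (c j - c (j - e)) < c j) {W X : ℕ}
    (hW : ∀ x, (∀ i, |u i x| ≤ (A * r : ℕ)) → |κ x| ≤ W) (hX : 2 * (A * r) + 1 ≤ X)
    (hWX : 2 * W * h < Real.log X) {s : Finset ℕ} (hs : ∀ p ∈ s, p.Prime)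
    (hsB : ∀ p ∈ s, 2 * A * B < p)
    (hsX : ∀ p ∈ s, (Fintype.card ι + 1) * Real.log X + 2 * p * W * h < e * Real.log p)
    (hscard : 2 * A * B < s.card) (hsprod : 2 * r ^ 2 < ∏ p ∈ s, p)
    (hdvd : ∀ p ∈ s, ∀ G : ℤ[Λ], (∀ x ∈ G.coeff.support, ∀ i, |u i x| ≤ (A * r : ℕ)) →
      (∀ x, |G.coeff x| ≤ X) → evalAt ℤ κ α (expandHom ℤ Λ p G) = 0 →
      F ∣ AddMonoidAlgebra.mapRingHom Λ (algebraMap ℤ ℚ) (expandHom ℤ Λ p G)) : False := by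
  classical
  have hQ := (algebraMap ℚ QBar).injective
  have hZ : Function.Injective (algebraMap ℤ ℚ) := Int.cast_injective
  have hF0 : evalAt ℚ κ α F = 0 := by
    rw [← evalAt_mapRingHom (S := QBar)]
    exact zero_dvd_iff.1 (hΦ0 ▸ map_dvd (evalAt QBar κ α) hΦF)
  -- the largest width of `F`
  obtain ⟨w, i₀, hw1, hwi, hwr, hw⟩ : ∃ (w : ℕ) (i₀ : ι), 1 ≤ w ∧ width (u i₀) F = w ∧ w ≤ r ∧
      ∀ i, width (u i) F ≤ w := by
    cases isEmpty_or_nonempty ι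
    · exact absurd (eq_zero_or_isUnit_of_forall_width_eq_zero hu hF.ne_zero fun i ↦ isEmptyElim i)
        hF.not_isUnit
    · obtain ⟨i₀, hi₀⟩ := Finite.exists_max fun i ↦ width (u i) F
      refine ⟨_, i₀, ?_, rfl, hr i₀, hi₀⟩
      by_contra! h0
      exact hF.not_isUnit (eq_zero_or_isUnit_of_forall_width_eq_zero hu hF.ne_zero
        fun i ↦ by have := hi₀ i; omega)
  -- a translate of `F` with integral coefficients
  obtain ⟨F₁, hF₁0, hF₁ev, hF₁⟩ : ∃ F₁ : ℤ[Λ], F₁ ≠ 0 ∧ evalAt ℤ κ α F₁ = 0 ∧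
      ∀ m ∈ F₁.coeff.support, ∀ i, |u i m| ≤ w := by
    obtain ⟨m₀, hm₀⟩ := Finsupp.support_nonempty_iff.2
      fun h ↦ hF.ne_zero (AddMonoidAlgebra.coeff_injective h)
    obtain ⟨d, g, hd, hg⟩ := exists_mapRingHom_eq_single_mul (AddMonoidAlgebra.single (-m₀) 1 * F)
    have hcoeff (m : Λ) : ((g.coeff m : ℤ) : ℚ) = d * F.coeff (m + m₀) := by
      have := congrArg (fun f ↦ f.coeff m) hg
      simp only [AddMonoidAlgebra.coeff_mapRingHom, coeff_single_mul_eq] at this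
      rw [eq_intCast, sub_zero, one_mul, sub_neg_eq_add] at this
      exact this
    have hd' : (d : ℚ) ≠ 0 := by exact_mod_cast hd
    refine ⟨g, fun h0 ↦ ?_, ?_, fun m hm i ↦ ?_⟩
    · have h1 := hcoeff 0
      rw [h0, zero_add] at h1
      have : (d : ℚ) * F.coeff m₀ = 0 := by rw [← h1]; simp
      exact mul_ne_zero hd' (Finsupp.mem_support_iff.1 hm₀) this
    · rw [← evalAt_mapRingHom (S := ℚ), hg, map_mul, map_mul, hF0, mul_zero, mul_zero]
    · have h1 : m + m₀ ∈ F.coeff.support := by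
        rw [Finsupp.mem_support_iff] at hm ⊢
        intro h0
        have := hcoeff m
        rw [h0, mul_zero] at this
        exact hm (by exact_mod_cast this)
      have h2 := sub_le_width (u i) h1 hm₀
      have h3 := sub_le_width (u i) hm₀ h1
      have h4 : (width (u i) F : ℤ) ≤ w := by exact_mod_cast hw i
      rw [map_add] at h2 h3
      rw [abs_le]
      constructor <;> linarith
  obtain ⟨j, hej, hjA, hj⟩ := hA (fun j ↦ (slab u hu (j * w)).card)
    (Finset.card_pos.2 ⟨0, zero_mem_slab _⟩)
    (fun j ↦ Finset.card_le_card (slab_mono (Nat.mul_le_mul_right _ (by omega))))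
    (fun j ↦ by
      have := card_slab_mul_le (u := u) (hu := hu) j w
      rwa [one_mul])
  have hN1 : 1 ≤ j * w := Nat.mul_pos (he.trans hej) hw1
  have hNr : j * w ≤ A * r := Nat.mul_le_mul hjA hwr
  have hNX : 2 * (j * w) + 1 ≤ X := by omega
  have hX2 : 2 ≤ X := by omega
  have hlogX : 0 < Real.log X := Real.log_pos (by exact_mod_cast hX2)
  obtain ⟨G, hG0, hGS, hGX, hG⟩ := exists_small_vanishing_twists u c hκ
    (Algebra.IsAlgebraic.isAlgebraic (R := ℚ) (α : QBar)) hh hF₁0 hF₁ev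
    (e := e) (θ := Fintype.card ι + e + 2) (S := slab u hu (j * w)) (S' := slab u hu ((j - e) * w))
    (by
      intro m hm x hx
      rw [mem_slab] at hm ⊢
      intro i
      have h1 := abs_le_of_mem_support_pow (fun m hm ↦ hF₁ m hm i) e x hx
      have h2 := hm i
      rw [map_add]
      refine (abs_add_le _ _).trans ((add_le_add h2 h1).trans (le_of_eq ?_))
      rw [← Nat.cast_add, ← add_mul, Nat.sub_add_cancel hej]) hj (N := j * w) hN1
    (fun a m hm ↦ mem_slab.1 hm a) (W := W)
    (fun m hm ↦ hW m fun i ↦ (mem_slab.1 hm i).trans (by exact_mod_cast hNr)) hX2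
    (by
      have := log_card_mul_le (hu := hu) hNX hN1 e
      push_cast at this ⊢
      linarith)
  have hGabs (x : Λ) (hx : x ∈ G.coeff.support) (i : ι) : |u i x| ≤ (j * w : ℕ) :=
    mem_slab.1 (hGS hx) i
  have hcomp : AddMonoidAlgebra.mapRingHom Λ (algebraMap ℚ QBar)
      (AddMonoidAlgebra.mapRingHom Λ (algebraMap ℤ ℚ) G) =
      AddMonoidAlgebra.mapRingHom Λ (algebraMap ℤ QBar) G := by
    apply AddMonoidAlgebra.coeff_injective
    ext x
    simp only [AddMonoidAlgebra.coeff_mapRingHom, ← IsScalarTower.algebraMap_apply]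
  have hΦG (p : ℕ) (hp : p ∈ s) :
      Φ ∣ expandHom QBar Λ p (AddMonoidAlgebra.mapRingHom Λ (algebraMap ℤ QBar) G) := by
    have h1 : evalAt ℤ ((p : ℤ) • κ) α G = 0 := by
      refine hG p (hs p hp) (lt_of_le_of_lt ?_ (hsX p hp))
      have := log_card_mul_le (hu := hu) hNX hN1 0
      rw [pow_zero, mul_one] at this
      push_cast at this ⊢
      linarith
    have h2 := hdvd p hp G (fun x hx i ↦ (hGabs x hx i).trans (by exact_mod_cast hNr)) hGX
      (by rw [evalAt_expandHom, h1])
    have h3 := hΦF.trans (map_dvd (AddMonoidAlgebra.mapRingHom Λ (algebraMap ℚ QBar)) h2)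
    rwa [← expandHom_mapRingHom, ← expandHom_mapRingHom, hcomp] at h3
  have hZQ : Function.Injective (algebraMap ℤ QBar) := by
    rw [IsScalarTower.algebraMap_eq ℤ ℚ QBar]
    exact hQ.comp hZ
  have hG0' : AddMonoidAlgebra.mapRingHom Λ (algebraMap ℤ QBar) G ≠ 0 := by
    intro h0
    have := support_mapRingHom hZQ G
    rw [h0] at this
    exact hG0 (AddMonoidAlgebra.coeff_injective (Finsupp.support_eq_empty.1 this.symm))
  have hFQ0 : AddMonoidAlgebra.mapRingHom Λ (algebraMap ℚ QBar) F ≠ 0 := by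
    intro h0
    have := support_mapRingHom hQ F
    rw [h0] at this
    exact hF.ne_zero (AddMonoidAlgebra.coeff_injective (Finsupp.support_eq_empty.1 this.symm))
  have hwG : width (u i₀) (AddMonoidAlgebra.mapRingHom Λ (algebraMap ℤ QBar) G) ≤ 2 * (j * w) := by
    rw [width_mapRingHom hZQ, width_le_iff]
    intro m hm m' hm'
    have h1 := abs_le.1 (hGabs m hm i₀)
    have h2 := abs_le.1 (hGabs m' hm' i₀)
    push_cast at *
    linarith
  have hwB := hB (u i₀)
  rw [hwi] at hwB
  have hΦr (i : ι) : width (u i) Φ ≤ r := by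
    refine (width_le_of_dvd (u i) hFQ0 hΦF).trans ?_
    rw [width_mapRingHom hQ]
    exact hr i
  have hbound : width (u i₀) (AddMonoidAlgebra.mapRingHom Λ (algebraMap ℤ QBar) G) ≤
      2 * A * B * width (u i₀) Φ := by
    refine hwG.trans ?_
    calc 2 * (j * w) ≤ 2 * (A * (B * width (u i₀) Φ)) :=
          Nat.mul_le_mul_left _ (Nat.mul_le_mul hjA hwB)
      _ = _ := by ring
  have hΦpos : 0 < width (u i₀) Φ := by
    by_contra! h0
    rw [Nat.le_zero.1 h0, mul_zero] at hwB
    omega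
  rcases exists_mul_width_le hu hΦ hΦr hκr hα hΦ0 hG0' hs hsprod hΦG i₀ with ⟨p, hp, hle⟩ | hle
  · exact absurd (Nat.le_of_mul_le_mul_right (hle.trans hbound) hΦpos) (hsB p hp).not_ge
  · exact absurd (Nat.le_of_mul_le_mul_right (hle.trans hbound) hΦpos) hscard.not_ge

end Extrapolation

end

section

section Constants

theorem exists_finset_primes (N : ℕ) (hN : N ≠ 0) (m : ℕ) :
    ∃ s : Finset ℕ, s.card = m ∧ ∀ p ∈ s, p.Prime ∧ N < p ∧ p ≤ 2 ^ m * N := by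
  classical
  induction m with
  | zero => exact ⟨∅, by simp⟩
  | succ m ih =>
    obtain ⟨s, hs, h⟩ := ih
    obtain ⟨q, hq, hlt, hle⟩ := Nat.exists_prime_lt_and_le_two_mul (2 ^ m * N) (by positivity)
    refine ⟨insert q s, ?_, ?_⟩
    · rw [Finset.card_insert_of_notMem, hs]
      exact fun hqs ↦ hlt.not_ge (h q hqs).2.2
    · intro p hp
      rcases Finset.mem_insert.1 hp with rfl | hp
      · refine ⟨hq, lt_of_le_of_lt ?_ hlt, hle.trans_eq (by ring)⟩
        exact Nat.le_mul_of_pos_left _ (by positivity)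
      · obtain ⟨h1, h2, h3⟩ := h p hp
        refine ⟨h1, h2, h3.trans ?_⟩
        gcongr <;> omega

theorem exists_parameters (n A A₀ B : ℕ) (C : ℝ) (hC : 0 ≤ C) : ∃ (T X : ℕ) (s : Finset ℕ),
    2 ≤ T ∧ 2 * (A * (A₀ * T ^ n)) + 1 ≤ X ∧ 2 * (C / T) < Real.log X ∧ (∀ p ∈ s, p.Prime) ∧
    (∀ p ∈ s, 2 * A * B < p) ∧
    (∀ p ∈ s, (n + 1) * Real.log X + 2 * p * (C / T) < (n ^ 2 + n + 1 : ℕ) * Real.log p) ∧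
    2 * A * B < s.card ∧ 2 * (A₀ * T ^ n) ^ 2 < ∏ p ∈ s, p := by
  classical
  obtain ⟨m, hm1, hm2⟩ : ∃ m : ℕ, 2 * n + 1 ≤ m ∧ 2 * A * B < m :=
    ⟨2 * n + 1 + 2 * A * B, by omega, by omega⟩
  obtain ⟨D, hD⟩ := exists_nat_gt (2 * 2 ^ m * C)
  have hD0 : (0 : ℝ) < D := lt_of_le_of_lt (by positivity) hD
  have hD1 : 1 ≤ D := by exact_mod_cast hD0
  set c : ℕ := 3 * (A * A₀ + 1) * D ^ n with hc
  obtain ⟨N₁, hN₁⟩ := exists_nat_gt (Real.exp ((n + 1) * Real.log c + 1))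
  set N := N₁ + 2 * A * B + 2 * A₀ ^ 2 * D ^ (2 * n) + 2 with hN
  have hc0 : 0 < c := by positivity
  have hlogN : (n + 1) * Real.log c + 1 < Real.log N := by
    rw [Real.lt_log_iff_exp_lt (by positivity)]
    refine hN₁.trans_le ?_
    exact_mod_cast (by omega : N₁ ≤ N)
  have hlog3 : 1 < Real.log 3 := by
    rw [Real.lt_log_iff_exp_lt (by norm_num)]
    linarith [Real.exp_one_lt_d9]
  obtain ⟨s, hs, h⟩ := exists_finset_primes N (by omega) m
  have hNpos : (0 : ℝ) < N := by positivity
  have hCT : 2 * 2 ^ m * N * (C / (D * N : ℕ)) ≤ 1 := by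
    push_cast
    rw [mul_div_assoc', div_le_one (by positivity)]
    nlinarith
  have hCT0 : 0 ≤ C / (D * N : ℕ) := by positivity
  have hpow : (1 : ℝ) ≤ 2 ^ m * N := by
    have : 1 ≤ 2 ^ m * N := Nat.mul_pos (by positivity) (by omega)
    exact_mod_cast this
  have hX : 3 * (A * A₀ + 1) * (D * N) ^ n = c * N ^ n := by rw [hc, mul_pow]; ring
  have hDN : 1 ≤ (D * N) ^ n := Nat.one_le_pow _ _ (Nat.mul_pos hD1 (by omega))
  refine ⟨D * N, c * N ^ n, s, ?_, ?_, ?_, fun p hp ↦ (h p hp).1, fun p hp ↦ ?_, fun p hp ↦ ?_, ?_,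
    ?_⟩
  · exact (by omega : 2 ≤ N).trans (Nat.le_mul_of_pos_left _ hD1)
  · rw [← hX]
    nlinarith [Nat.zero_le (A * A₀ * (D * N) ^ n)]
  · refine lt_of_le_of_lt ?_ (hlog3.trans_le (Real.log_le_log (by norm_num) ?_))
    · nlinarith
    · rw [← hX]
      have : 3 ≤ 3 * (A * A₀ + 1) * (D * N) ^ n := by nlinarith [Nat.zero_le (A * A₀)]
      exact_mod_cast this
  · have := (h p hp).2.1
    omega
  · obtain ⟨-, h2, h3⟩ := h p hp
    have h4 : Real.log N ≤ Real.log p := Real.log_le_log hNpos (by exact_mod_cast h2.le)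
    have h5 : (p : ℝ) ≤ 2 ^ m * N := by exact_mod_cast h3
    have h6 : 2 * p * (C / (D * N : ℕ)) ≤ 1 := by nlinarith
    have h7 : Real.log (c * N ^ n : ℕ) = Real.log c + n * Real.log N := by
      push_cast
      rw [Real.log_mul (by positivity) (by positivity), Real.log_pow]
    have h8 : ((n ^ 2 + n + 1 : ℕ) : ℝ) = n ^ 2 + n + 1 := by push_cast; ring
    rw [h7]
    calc _ < ((n ^ 2 + n + 1 : ℕ) : ℝ) * Real.log N := by rw [h8]; linarith
      _ ≤ _ := by gcongr
  · omega
  · have h1 : N ^ m ≤ ∏ p ∈ s, p := by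
      rw [← hs]
      exact Finset.pow_card_le_prod _ _ _ fun p hp ↦ (h p hp).2.1.le
    refine lt_of_lt_of_le ?_ h1
    calc 2 * (A₀ * (D * N) ^ n) ^ 2 = 2 * A₀ ^ 2 * D ^ (2 * n) * N ^ (2 * n) := by
          rw [mul_pow D, mul_pow, mul_pow, ← pow_mul, ← pow_mul, mul_comm n 2]; ring
      _ < N * N ^ (2 * n) := by gcongr; omega
      _ = N ^ (2 * n + 1) := by ring
      _ ≤ _ := Nat.pow_le_pow_right (by omega) hm1

end Constants

section Coprime

variable {R : Type*} [CommRing R] [IsDomain R] [UniqueFactorizationMonoid R]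

theorem exists_pair_mem_of_forall_dvd (I : Ideal R) (hI : ∀ D, (∀ g ∈ I, D ∣ g) → IsUnit D) :
    ∃ P ∈ I, ∃ Q ∈ I, P ≠ 0 ∧ Q ≠ 0 ∧ ∀ D, D ∣ P → D ∣ Q → IsUnit D := by
  classical
  obtain ⟨P, hP, hP0⟩ : ∃ P ∈ I, P ≠ 0 := by
    by_contra! h
    exact not_isUnit_zero (hI 0 fun g hg ↦ by rw [h g hg])
  obtain ⟨Q, hQ, hPQ⟩ : ∃ Q ∈ I, ∀ D, D ∣ P → D ∣ Q → IsUnit D := by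
    set s := (UniqueFactorizationMonoid.factors P).toFinset with hs
    have hirr : ∀ π ∈ s, Irreducible π := fun π hπ ↦
      UniqueFactorizationMonoid.irreducible_of_factor π (Multiset.mem_toFinset.1 hπ)
    have h1 : ¬ ((I : Set R) ⊆ ⋃ π ∈ (s : Set R), (Ideal.span {π} : Ideal R)) := by
      rw [Ideal.subset_union_prime 0 0 fun π hπ _ _ ↦
        (Ideal.span_singleton_prime (hirr π hπ).ne_zero).2 (hirr π hπ).prime]
      rintro ⟨π, hπ, hle⟩
      exact (hirr π hπ).not_isUnit (hI π fun g hg ↦ Ideal.mem_span_singleton.1 (hle hg))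
    obtain ⟨Q, hQ, hQn⟩ := Set.not_subset.1 h1
    refine ⟨Q, hQ, fun D hDP hDQ ↦ ?_⟩
    by_contra hD
    obtain ⟨π, hπ, hπD⟩ := WfDvdMonoid.exists_irreducible_factor hD (ne_zero_of_dvd_ne_zero hP0 hDP)
    obtain ⟨ρ, hρ, hass⟩ :=
      UniqueFactorizationMonoid.exists_mem_factors_of_dvd hP0 hπ (hπD.trans hDP)
    refine hQn (Set.mem_biUnion (Multiset.mem_toFinset.2 hρ) ?_)
    exact Ideal.mem_span_singleton.2 (hass.symm.dvd.trans (hπD.trans hDQ))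
  by_cases hQ0 : Q = 0
  · exact ⟨P, hP, P, hP, hP0, hP0, fun D hD _ ↦ hPQ D hD (hQ0 ▸ dvd_zero D)⟩
  · exact ⟨P, hP, Q, hQ, hP0, hQ0, hPQ⟩

end Coprime

section Step

variable {M : Type} [AddCommGroup M] [Module.Free ℤ M] [Module.Finite ℤ M]

theorem exists_integral_pair_mem (I : Ideal ℚ[M]) (hI : ∀ D, (∀ g ∈ I, D ∣ g) → IsUnit D) :
    ∃ P Q : ℤ[M], ∃ P' Q' : ℚ[M], AddMonoidAlgebra.mapRingHom M (algebraMap ℤ ℚ) P = P' ∧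
      AddMonoidAlgebra.mapRingHom M (algebraMap ℤ ℚ) Q = Q' ∧ P' ∈ I ∧ Q' ∈ I ∧ P' ≠ 0 ∧
      Q' ≠ 0 ∧ ∀ D, D ∣ P' → D ∣ Q' → IsUnit D := by
  obtain ⟨P, hP, Q, hQ, hP0, hQ0, h⟩ := exists_pair_mem_of_forall_dvd I hI
  obtain ⟨d, P₁, hd, hP₁⟩ := exists_mapRingHom_eq_single_mul P
  obtain ⟨d', Q₁, hd', hQ₁⟩ := exists_mapRingHom_eq_single_mul Q
  have hu : IsUnit (AddMonoidAlgebra.single (0 : M) (d : ℚ)) :=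
    isUnit_single _ (Int.cast_ne_zero.2 hd).isUnit
  have hu' : IsUnit (AddMonoidAlgebra.single (0 : M) (d' : ℚ)) :=
    isUnit_single _ (Int.cast_ne_zero.2 hd').isUnit
  refine ⟨P₁, Q₁, _, _, hP₁, hQ₁, I.mul_mem_left _ hP, I.mul_mem_left _ hQ,
    mul_ne_zero hu.ne_zero hP0, mul_ne_zero hu'.ne_zero hQ0, fun D hD hD' ↦
    h D (hu.dvd_mul_left.1 hD) (hu'.dvd_mul_left.1 hD')⟩

theorem finite_setOf_support_subset_of_coeff_le {N : Type*} [AddCommGroup N] (S : Finset N)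
    (X : ℕ) : {G : ℤ[N] | G.coeff.support ⊆ S ∧ ∀ x, |G.coeff x| ≤ X}.Finite := by
  classical
  have hfin : (Set.pi Set.univ fun _ : S ↦ Set.Icc (-X : ℤ) X).Finite :=
    Set.Finite.pi fun _ ↦ Set.finite_Icc _ _
  refine Set.Finite.of_injOn (f := fun (G : ℤ[N]) (x : S) ↦ G.coeff x) ?_ ?_ hfin
  · intro G hG x _
    exact abs_le.1 (hG.2 x)
  · intro G hG G' hG' h
    apply AddMonoidAlgebra.coeff_injective
    ext x
    by_cases hx : x ∈ S
    · exact congrFun h ⟨x, hx⟩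
    · rw [Finsupp.notMem_support_iff.1 fun h ↦ hx (hG.1 h),
        Finsupp.notMem_support_iff.1 fun h ↦ hx (hG'.1 h)]

/-- The coordinates of a vector in a submodule with respect to a basis of the ambient module. -/
abbrev kerCoord (N : Submodule ℤ M) (i : Fin (Module.finrank ℤ M)) : N →ₗ[ℤ] ℤ :=
  (Module.finBasis ℤ M).coord i ∘ₗ N.subtype

theorem eq_zero_of_kerCoord {N : Submodule ℤ M} (x : N) (h : ∀ i, kerCoord N i x = 0) : x = 0 := by
  apply N.injective_subtype
  rw [map_zero]
  exact (Module.finBasis ℤ M).ext_elem fun i ↦ by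
    simpa using h i

theorem eventually_irreducible_generator {N : Submodule ℤ M} (hN : GenericallyNonvanishing N)
    {Q : Ideal QBar[M]} (hQ : Q.IsPrime) {F₀ : ℚ[N]} (hF₀ : F₀ ≠ 0) (hF₀Q : F₀ ∈ contract N Q)
    {r : ℕ} (hr : ∀ i, width (kerCoord N i) F₀ ≤ r) (s : Finset ℕ) (R X : ℕ) :
    ∀ᶠ κ in generic M, ∀ α : QBarˣ, ¬ IsOfFinOrder α → (∀ f ∈ Q, evalAt QBar κ α f = 0) →
      ∃ F : ℚ[N], Irreducible F ∧ (∀ i, width (kerCoord N i) F ≤ r) ∧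
        contract N Q = Ideal.span {F} ∧ ∀ p ∈ s, ∀ G : ℤ[N],
          (∀ x ∈ G.coeff.support, ∀ i, |kerCoord N i x| ≤ R) → (∀ x, |G.coeff x| ≤ X) →
          evalAt ℤ (κ ∘ₗ N.subtype) α (expandHom ℤ N p G) = 0 →
          F ∣ AddMonoidAlgebra.mapRingHom N (algebraMap ℤ ℚ) (expandHom ℤ N p G) := by
  classical
  have hprime : (contract N Q).IsPrime := (hQ.comap _).comap _
  obtain ⟨F, hF, hFQ, hFF₀⟩ := exists_irreducible_mem hprime hF₀Q hF₀
  have hfin : {g : ℤ[N] | ∃ p ∈ s, ∃ G : ℤ[N], (G.coeff.support ⊆ slab _ eq_zero_of_kerCoord R ∧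
      ∀ x, |G.coeff x| ≤ X) ∧ expandHom ℤ N p G = g}.Finite := by
    refine (s.finite_toSet.biUnion fun p _ ↦ (finite_setOf_support_subset_of_coeff_le
      (slab _ eq_zero_of_kerCoord R) X).image (expandHom ℤ N p)).subset ?_
    rintro g ⟨p, hp, G, hG, rfl⟩
    exact Set.mem_biUnion hp ⟨G, hG, rfl⟩
  filter_upwards [eventually_dvd_of_evalAt_eq_zero hN hF hFQ hfin.toFinset] with κ hκ α hα hQα
  obtain ⟨h1, h2⟩ := hκ α hα hQα
  refine ⟨F, hF, fun i ↦ (width_le_of_dvd _ hF₀ hFF₀).trans (hr i), h1, fun p hp G hG hGX hev ↦ ?_⟩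
  refine h2 _ (hfin.mem_toFinset.2 ⟨p, hp, G, ⟨fun x hx ↦ ?_, hGX⟩, rfl⟩) hev
  exact mem_slab.2 (hG x hx)


theorem GenericallyNonvanishing.of_ker [Nontrivial M]
    (hM : ∀ v : M →ₗ[ℤ] ℤ, v ≠ 0 → GenericallyNonvanishing (LinearMap.ker v)) :
    GenericallyNonvanishing M := by
  classical
  intro I hI
  obtain ⟨P, Q, P', Q', hPP', hQQ', hPI, hQI, hP0, hQ0, hPQ⟩ := exists_integral_pair_mem I hI
  obtain ⟨C, hC⟩ := exists_height_le_of_coprime hM P Q (by rwa [hPP', hQQ'])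
  obtain ⟨A₀, hA₀⟩ := exists_emb_mem_span_pair hP0 hQ0 hPQ
  set J := Ideal.span {P', Q'} with hJ
  set n := Module.finrank ℤ M with hn
  set 𝓜 := (J.map (AddMonoidAlgebra.mapRingHom M (algebraMap ℚ QBar))).minimalPrimes with h𝓜
  have h𝓜fin : 𝓜.Finite := Ideal.finite_minimalPrimes_of_isNoetherianRing _ _
  obtain ⟨A, hA⟩ := exists_slow_growth n (n ^ 2 + n + 1) (n + (n ^ 2 + n + 1) + 2) (by omega)
    (by omega)
  obtain ⟨T, X, s, hT, hX, hTX, hs, hsB, hsX, hscard, hsprod⟩ :=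
    exists_parameters n A A₀ 𝓜.ncard ((n * A * A₀ : ℕ) * max C 0) (by positivity)
  have hgen : ∀ᶠ κ in generic M, ∀ v ∈ {v : M →ₗ[ℤ] ℤ | ∀ i, |v (Module.finBasis ℤ M i)| ≤ (T ^ n : ℕ)},
      ∀ q ∈ Finset.Icc 1 (T ^ n), ∀ 𝔮 ∈ 𝓜, v ≠ 0 → (∀ i, |v (Module.finBasis ℤ M i)| ≤ q) →
      ∀ α : QBarˣ, ¬ IsOfFinOrder α → (∀ f ∈ 𝔮, evalAt QBar κ α f = 0) →
      ∃ F : ℚ[LinearMap.ker v], Irreducible F ∧ (∀ i, width (kerCoord _ i) F ≤ A₀ * q) ∧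
        contract _ 𝔮 = Ideal.span {F} ∧ ∀ p ∈ s, ∀ G : ℤ[LinearMap.ker v],
          (∀ x ∈ G.coeff.support, ∀ i, |kerCoord _ i x| ≤ (A * (A₀ * q) : ℕ)) →
          (∀ x, |G.coeff x| ≤ X) →
          evalAt ℤ (κ ∘ₗ (LinearMap.ker v).subtype) α (expandHom ℤ _ p G) = 0 →
          F ∣ AddMonoidAlgebra.mapRingHom _ (algebraMap ℤ ℚ) (expandHom ℤ _ p G) := by
    refine (eventually_all_finite (finite_setOf_abs_le M _)).2 fun v _ ↦
      (eventually_all_finset _).2 fun q hq ↦ (eventually_all_finite h𝓜fin).2 fun 𝔮 h𝔮 ↦ ?_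
    by_cases hv : v ≠ 0 ∧ ∀ i, |v (Module.finBasis ℤ M i)| ≤ q
    · obtain ⟨F₀, hF₀, hF₀J, hF₀A⟩ := hA₀ v q hv.1 (Finset.mem_Icc.1 hq).1 hv.2
      have hF₀𝔮 : F₀ ∈ contract (LinearMap.ker v) 𝔮 := by
        change emb _ QBar (AddMonoidAlgebra.mapRingHom _ (algebraMap ℚ QBar) F₀) ∈ 𝔮
        rw [emb_mapRingHom]
        exact h𝔮.1.2 (Ideal.mem_map_of_mem _ hF₀J)
      filter_upwards [eventually_irreducible_generator (hM v hv.1) h𝔮.1.1 hF₀ hF₀𝔮 hF₀A s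
        (A * (A₀ * q)) X] with κ hκ _ _
      exact hκ
    · exact Eventually.of_forall fun κ h1 h2 ↦ absurd ⟨h1, h2⟩ hv
  have hne : ∀ᶠ κ in generic M, ∀ m ∈ {m : M | ∀ i, |(Module.finBasis ℤ M).coord i m| ≤
      (A₀ * T ^ n : ℕ)}, m ≠ 0 → κ m ≠ 0 := by
    refine (eventually_all_finite ?_).2 fun m _ ↦ ?_
    · refine Set.Finite.of_injOn (f := fun m i ↦ (Module.finBasis ℤ M).coord i m)
        (t := Set.pi Set.univ fun _ ↦ Set.Icc (-(A₀ * T ^ n : ℕ) : ℤ) (A₀ * T ^ n : ℕ)) ?_ ?_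
        (Set.Finite.pi fun _ ↦ Set.finite_Icc _ _)
      · intro m hm i _
        exact abs_le.1 (hm i)
      · intro m _ m' _ h
        exact (Module.finBasis ℤ M).ext_elem fun i ↦ congrFun h i
    · by_cases hm : m = 0
      · exact Eventually.of_forall fun _ h ↦ absurd hm h
      · filter_upwards [eventually_generic hm] with κ hκ _ using hκ
  obtain ⟨m₀, hm₀⟩ := exists_ne (0 : M)
  filter_upwards [hC, hgen, hne, eventually_generic hm₀] with κ hC hgen hne hκm₀ α hα
  have hκ0 : κ ≠ 0 := fun h ↦ hκm₀ (by rw [h, LinearMap.zero_apply])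
  by_contra! hI0
  obtain ⟨h, hh⟩ := exists_isHeightBound α
  have hhC : h * supNorm κ ≤ C := by
    refine hC α hα ?_ ?_ h hh
    · rw [← evalAt_mapRingHom (S := ℚ), hPP']
      exact hI0 _ hPI
    · rw [← evalAt_mapRingHom (S := ℚ), hQQ']
      exact hI0 _ hQI
  obtain ⟨𝔮, h𝔮, h𝔮0⟩ : ∃ 𝔮 ∈ 𝓜, 𝔮 ≤ RingHom.ker (evalAt QBar κ α) := by
    have : (RingHom.ker (evalAt QBar κ α)).IsPrime := RingHom.ker_isPrime _
    refine Ideal.exists_minimalPrimes_le (J := RingHom.ker (evalAt QBar κ α)) ?_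
    rw [Ideal.map_le_iff_le_comap, hJ, Ideal.span_le]
    rintro f hf
    change evalAt QBar κ α (AddMonoidAlgebra.mapRingHom M (algebraMap ℚ QBar) f) = 0
    rw [evalAt_mapRingHom]
    rcases hf with rfl | rfl
    · exact hI0 _ hPI
    · exact hI0 _ hQI
  obtain ⟨q, v, hq1, hqT, hv0, hvq, hvT⟩ := exists_simultaneous_approx hκ0 hT
  obtain ⟨F, hF, hFA, hF𝔮, hFdvd⟩ := hgen v
    (fun i ↦ (hvq i).trans (by exact_mod_cast hqT)) q (Finset.mem_Icc.2 ⟨hq1, hqT⟩) 𝔮 h𝔮 hv0 hvq α hα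
    h𝔮0
  obtain ⟨Φ, hΦ, hΦF, hΦ𝔮, hΦw⟩ := exists_irreducible_dvd_and_width_le J h𝔮 hF hF𝔮
  have hT0 : 0 < T := by omega
  have hK : (0 : ℝ) < supNorm κ := by exact_mod_cast supNorm_pos hκ0
  have hW : ((supNorm κ * (n * A * A₀) / T : ℕ) : ℝ) * h ≤ (n * A * A₀ : ℕ) * max C 0 / T := by
    calc _ ≤ ((supNorm κ * (n * A * A₀) : ℕ) / T : ℝ) * h :=
          mul_le_mul_of_nonneg_right Nat.cast_div_le hh.1
      _ = (n * A * A₀ : ℕ) * (h * supNorm κ) / T := by push_cast; ring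
      _ ≤ _ := by gcongr; exact hhC.trans (le_max_left _ _)
  refine not_small_point (u := kerCoord (LinearMap.ker v)) eq_zero_of_kerCoord
    (c := fun a ↦ κ (Module.finBasis ℤ M a)) (κ := κ ∘ₗ (LinearMap.ker v).subtype) ?_ hα hh hF hΦ
    hΦF hΦw ?_ (r := A₀ * q) hFA ?_ (e := n ^ 2 + n + 1) (A := A) (by omega) ?_
    (W := supNorm κ * (n * A * A₀) / T) (X := X) ?_ ?_ ?_ hs hsB ?_ hscard ?_ hFdvd
  · ext x
    simp only [LinearMap.comp_apply, Submodule.subtype_apply, LinearMap.sum_apply,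
      LinearMap.smul_apply, Module.Basis.coord_apply, smul_eq_mul]
    conv_lhs => rw [← (Module.finBasis ℤ M).sum_repr (x : M)]
    simp only [map_sum, map_smul, smul_eq_mul, mul_comm]
  · have := h𝔮0 hΦ𝔮
    rw [RingHom.mem_ker, evalAt_emb] at this
    exact this
  · intro x hx hxr
    refine hne x (fun i ↦ (hxr i).trans ?_) (by simpa using hx)
    exact_mod_cast Nat.mul_le_mul_left _ hqT
  · simpa using hA
  · intro x hx
    have h1 := approx_apply_le hvT (by positivity) (x : M)
    rw [LinearMap.mem_ker.1 x.2, mul_zero, sub_zero, abs_mul, Nat.abs_cast] at h1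
    have h2 : sumNorm (x : M) ≤ n * (A * (A₀ * q) : ℕ) := by
      refine (Finset.sum_le_card_nsmul _ _ _ fun i _ ↦ hx i).trans (le_of_eq ?_)
      simp
      exact Or.inl hn.symm
    have h3 : (q : ℤ) * (T * |κ x|) ≤ q * (supNorm κ * (n * A * A₀) : ℕ) := by
      calc (q : ℤ) * (T * |κ x|) = T * (q * |κ x|) := by ring
        _ ≤ supNorm κ * (n * (A * (A₀ * q) : ℕ)) := h1.trans (by gcongr)
        _ = _ := by push_cast; ring
    have h4 : (T : ℤ) * |κ x| ≤ (supNorm κ * (n * A * A₀) : ℕ) :=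
      le_of_mul_le_mul_left h3 (by exact_mod_cast hq1)
    change |κ x| ≤ _
    rw [Int.natCast_div]
    exact (Int.le_ediv_iff_mul_le (by exact_mod_cast hT0)).2 (by rwa [mul_comm])
  · refine le_trans ?_ hX
    gcongr
  · refine lt_of_le_of_lt ?_ hTX
    rw [mul_assoc]
    gcongr
  · intro p hp
    refine lt_of_le_of_lt ?_ (hsX p hp)
    rw [Fintype.card_fin, mul_assoc (2 * (p : ℝ))]
    gcongr
  · refine lt_of_le_of_lt ?_ hsprod
    gcongr

end Step

end

section

theorem finrank_ker_lt {M : Type*} [AddCommGroup M] [Module.Free ℤ M] [Module.Finite ℤ M]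
    {v : M →ₗ[ℤ] ℤ} (hv : v ≠ 0) :
    Module.finrank ℤ (LinearMap.ker v) < Module.finrank ℤ M := by
  rw [← Submodule.finrank_quotient_add_finrank (LinearMap.ker v)]
  have : Nontrivial (M ⧸ LinearMap.ker v) := by
    rw [Submodule.Quotient.nontrivial_iff]
    exact fun h ↦ hv (LinearMap.ker_eq_top.1 h)
  have : IsAddTorsionFree (M ⧸ LinearMap.ker v) :=
    Function.Injective.isAddTorsionFree (v.quotKerEquivRange : _ →+ LinearMap.range v)
      v.quotKerEquivRange.injective
  have : 0 < Module.finrank ℤ (M ⧸ LinearMap.ker v) := Module.finrank_pos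
  omega

theorem genericallyNonvanishing (M : Type) [AddCommGroup M] [Module.Free ℤ M]
    [Module.Finite ℤ M] : GenericallyNonvanishing M := by
  cases subsingleton_or_nontrivial M
  · intro I hI
    obtain ⟨P, hP, -, -, hP0, -⟩ := exists_pair_mem_of_forall_dvd I hI
    refine Eventually.of_forall fun κ α _ ↦ ⟨P, hP, ?_⟩
    have h1 : P = AddMonoidAlgebra.single 0 (P.coeff 0) := by
      apply AddMonoidAlgebra.coeff_injective
      ext x
      rw [Subsingleton.elim x 0, AddMonoidAlgebra.coeff_single, Finsupp.single_eq_same]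
    rw [h1, evalAt_single, map_zero κ, zpow_zero, mul_one]
    refine (map_ne_zero _).2 fun h0 ↦ hP0 ?_
    rw [h1, h0, AddMonoidAlgebra.single_zero]
  · exact .of_ker fun v hv ↦ genericallyNonvanishing (LinearMap.ker v)
termination_by Module.finrank ℤ M
decreasing_by exact finrank_ker_lt hv

open Polynomial in
theorem exists_toLaurent_eq_prod_cyclotomic {f : ℤ[X]} (hf : f ≠ 0)
    (hprime : ∀ ℓ : ℕ, ℓ.Prime → ¬ (C (ℓ : ℤ) ∣ f))
    (hroot : ∀ α : QBarˣ, aeval (α : QBar) f = 0 → IsOfFinOrder α) :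
    ∃ (s : Multiset ℕ) (u : (LaurentPolynomial ℤ)ˣ), (∀ m ∈ s, 0 < m) ∧
      toLaurent f = u * (s.map fun m ↦ toLaurent (cyclotomic m ℤ)).prod := by
  induction hd : f.natDegree using Nat.strong_induction_on generalizing f with
  | _ d ih =>
  subst hd
  by_cases hdeg : f.degree = 0
  · obtain ⟨c, hc⟩ : ∃ c, f = C c := ⟨_, eq_C_of_degree_eq_zero hdeg⟩
    have hu : IsUnit c := by
      by_contra h
      obtain ⟨ℓ, hℓ, hdvd⟩ := Nat.exists_prime_and_dvd
        (n := c.natAbs) (fun h1 ↦ h (Int.isUnit_iff_natAbs_eq.2 h1))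
      exact hprime ℓ hℓ (hc ▸ map_dvd C (Int.natCast_dvd.2 hdvd))
    refine ⟨0, ((hu.map (C : ℤ →+* ℤ[X])).map toLaurent).unit, by simp, by simp [hc]⟩
  · obtain ⟨x, hx⟩ := IsAlgClosed.exists_aeval_eq_zero QBar f hdeg
    have key (g a : ℤ[X]) (hg : f = a * g) (ha : 0 < a.natDegree) : ∃ (s : Multiset ℕ)
        (u : (LaurentPolynomial ℤ)ˣ), (∀ m ∈ s, 0 < m) ∧
          toLaurent g = u * (s.map fun m ↦ toLaurent (cyclotomic m ℤ)).prod := by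
      have ha0 : a ≠ 0 := fun h ↦ by simp [h] at ha
      have hg0 : g ≠ 0 := fun h ↦ hf (by rw [hg, h, mul_zero])
      refine ih g.natDegree ?_ hg0 (fun ℓ hℓ h ↦ hprime ℓ hℓ (hg ▸ h.mul_left a))
        (fun α hα ↦ hroot α (by rw [hg, map_mul, hα, mul_zero])) rfl
      rw [hg, natDegree_mul ha0 hg0]
      omega
    by_cases hx0 : x = 0
    · have hXf : X ∣ f := by
        rw [X_dvd_iff]
        rw [hx0, ← coeff_zero_eq_aeval_zero'] at hx
        exact (FaithfulSMul.algebraMap_injective ℤ QBar) (by rw [hx, map_zero])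
      obtain ⟨g, hg⟩ := hXf
      obtain ⟨s, u, hs, h⟩ := key g X hg (by simp)
      refine ⟨s, (LaurentPolynomial.isUnit_T 1).unit * u, hs, ?_⟩
      rw [hg, map_mul, h, toLaurent_X, Units.val_mul, IsUnit.unit_spec, mul_assoc]
    · have hfin := hroot (Units.mk0 x hx0) hx
      have hord := hfin.orderOf_pos
      have hprim : IsPrimitiveRoot x (orderOf (Units.mk0 x hx0)) := by
        have := (IsPrimitiveRoot.orderOf (Units.mk0 x hx0)).map_of_injective
          (f := Units.coeHom QBar) Units.val_injective
        exact this
      obtain ⟨g, hg⟩ : cyclotomic (orderOf (Units.mk0 x hx0)) ℤ ∣ f := by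
        rw [cyclotomic_eq_minpoly hprim hord]
        exact minpoly.isIntegrallyClosed_dvd (hprim.isIntegral hord) hx
      obtain ⟨s, u, hs, h⟩ := key g _ hg (by
        rw [natDegree_cyclotomic]
        exact Nat.totient_pos.2 hord)
      refine ⟨orderOf (Units.mk0 x hx0) ::ₘ s, u, ?_, ?_⟩
      · intro m hm
        rcases Multiset.mem_cons.1 hm with rfl | hm
        exacts [hord, hs m hm]
      · rw [hg, map_mul, h, Multiset.map_cons, Multiset.prod_cons]
        ring

open Polynomial in
theorem evalAt_toLaurent (α : QBarˣ) (f : ℤ[X]) :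
    evalAt ℤ LinearMap.id α (toLaurent f) = aeval (α : QBar) f := by
  have : (evalAt ℤ LinearMap.id α).comp toLaurentAlg = aeval (α : QBar) := by
    apply Polynomial.algHom_ext
    rw [AlgHom.comp_apply, toLaurentAlg_apply, toLaurent_X, aeval_X, LaurentPolynomial.T,
      evalAt_single]
    simp
  rw [← this, AlgHom.comp_apply, toLaurentAlg_apply]

theorem exists_eq_prod_cyclotomic {f : LaurentPolynomial ℤ} (hf : f ≠ 0)
    (hprime : ∀ ℓ : ℕ, ℓ.Prime → ¬ (LaurentPolynomial.C (ℓ : ℤ) ∣ f))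
    (hroot : ∀ α : QBarˣ, evalAt ℤ LinearMap.id α f = 0 → IsOfFinOrder α) :
    ∃ (s : Multiset ℕ) (u : (LaurentPolynomial ℤ)ˣ), (∀ m ∈ s, 0 < m) ∧
      f = u * (s.map fun m ↦ Polynomial.toLaurent (Polynomial.cyclotomic m ℤ)).prod := by
  obtain ⟨n, g, hg⟩ := LaurentPolynomial.exists_T_pow f
  have hT := LaurentPolynomial.isUnit_T (R := ℤ) n
  obtain ⟨s, u, hs, h⟩ := exists_toLaurent_eq_prod_cyclotomic (f := g)
    (by
      rintro rfl
      rw [map_zero] at hg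
      exact mul_ne_zero hf hT.ne_zero hg.symm)
    (fun ℓ hℓ h ↦ hprime ℓ hℓ (by
      have := map_dvd Polynomial.toLaurent h
      rwa [hg, hT.dvd_mul_right, Polynomial.toLaurent_C] at this))
    (fun α hα ↦ hroot α (by
      rw [← evalAt_toLaurent, hg, map_mul] at hα
      exact (mul_eq_zero.1 hα).resolve_right (hT.map _).ne_zero))
  refine ⟨s, hT.unit⁻¹ * u, hs, ?_⟩
  rw [Units.val_mul, mul_assoc, ← h, hg, mul_comm f, ← mul_assoc, IsUnit.val_inv_mul, one_mul]

end

section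

section Specialization

variable {M : Type} [AddCommGroup M] [Module.Free ℤ M] [Module.Finite ℤ M] {ι : Type} [Finite ι]

theorem mapRingHom_intCast_injective {N : Type*} [AddCommGroup N] :
    Function.Injective (AddMonoidAlgebra.mapRingHom N (algebraMap ℤ ℚ)) := by
  intro f g h
  apply AddMonoidAlgebra.coeff_injective
  ext m
  have := congrArg (fun f ↦ f.coeff m) h
  simpa only [AddMonoidAlgebra.coeff_mapRingHom, eq_intCast, Int.cast_inj] using this

theorem exists_prime_dvd_of_not_isUnit_map {R S : Type*} [CommRing R] [IsDomain R]
    [UniqueFactorizationMonoid R] [CommRing S] (φ : R →+* S) {a : R} (ha0 : a ≠ 0)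
    (ha : ¬ IsUnit (φ a)) : ∃ π, Prime π ∧ π ∣ a ∧ ¬ IsUnit (φ π) := by
  induction a using UniqueFactorizationMonoid.induction_on_prime with
  | h₁ => exact absurd rfl ha0
  | h₂ x hx => exact absurd (hx.map φ) ha
  | h₃ b p hb hp ih =>
    by_cases hu : IsUnit (φ p)
    · obtain ⟨π, hπ, hdvd, h⟩ := ih hb fun h ↦ ha (by rw [map_mul]; exact hu.mul h)
      exact ⟨π, hπ, hdvd.mul_left p, h⟩
    · exact ⟨p, hp, dvd_mul_right p b, hu⟩

theorem isUnit_of_forall_dvd_mapRingHom {q : ι → ℤ[M]}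
    (hq : ∀ π, (∀ j, π ∣ q j) → IsUnit π) {D : ℚ[M]}
    (hD : ∀ j, D ∣ AddMonoidAlgebra.mapRingHom M (algebraMap ℤ ℚ) (q j)) : IsUnit D := by
  by_contra hDu
  have hD0 : D ≠ 0 := by
    rintro rfl
    refine not_isUnit_zero (hq 0 fun j ↦ zero_dvd_iff.2 ?_)
    exact mapRingHom_intCast_injective (by rw [zero_dvd_iff.1 (hD j), map_zero])
  have hconst (d : ℤ) (hd : d ≠ 0) : IsUnit (AddMonoidAlgebra.single (0 : M) (d : ℚ)) :=
    isUnit_single _ (Int.cast_ne_zero.2 hd).isUnit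
  obtain ⟨d, D₁, hd, hD₁⟩ := exists_mapRingHom_eq_single_mul D
  obtain ⟨π, hπ, hπD, hπu⟩ := exists_prime_dvd_of_not_isUnit_map
    (AddMonoidAlgebra.mapRingHom M (algebraMap ℤ ℚ)) (a := D₁)
    (by
      rintro rfl
      rw [map_zero] at hD₁
      exact mul_ne_zero (hconst d hd).ne_zero hD0 hD₁.symm)
    (by
      rw [hD₁]
      exact fun h ↦ hDu (isUnit_of_mul_isUnit_right h))
  refine hπ.not_isUnit (hq π fun j ↦ ?_)
  have h1 : AddMonoidAlgebra.mapRingHom M (algebraMap ℤ ℚ) π ∣ D := by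
    have := map_dvd (AddMonoidAlgebra.mapRingHom M (algebraMap ℤ ℚ)) hπD
    rwa [hD₁, (hconst d hd).dvd_mul_left] at this
  obtain ⟨h, hh⟩ := h1.trans (hD j)
  obtain ⟨c, g, hc, hg⟩ := exists_mapRingHom_eq_single_mul h
  have h2 : AddMonoidAlgebra.single 0 c * q j = π * g := by
    apply mapRingHom_intCast_injective
    rw [map_mul, map_mul, hg, hh, AddMonoidAlgebra.mapRingHom_single, eq_intCast]
    ring
  rcases hπ.dvd_or_dvd ⟨g, h2⟩ with h3 | h3
  · refine absurd (isUnit_of_dvd_unit ?_ (hconst c hc)) hπu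
    have := map_dvd (AddMonoidAlgebra.mapRingHom M (algebraMap ℤ ℚ)) h3
    rwa [AddMonoidAlgebra.mapRingHom_single, eq_intCast] at this
  · exact h3

theorem eventually_coeff_mapDomain (f : ℤ[M]) : ∀ᶠ κ : M →ₗ[ℤ] ℤ in generic M,
    ∀ m ∈ f.coeff.support,
      (AddMonoidAlgebra.mapDomainRingHom ℤ (κ : M →+ ℤ) f).coeff (κ m) = f.coeff m := by
  classical
  have h : ∀ᶠ κ : M →ₗ[ℤ] ℤ in generic M, ∀ m ∈ f.coeff.support, ∀ m' ∈ f.coeff.support,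
      m - m' ≠ 0 → κ (m - m') ≠ 0 := by
    refine (eventually_all_finset _).2 fun m _ ↦ (eventually_all_finset _).2 fun m' _ ↦ ?_
    by_cases hm : m - m' = 0
    · exact Eventually.of_forall fun _ h ↦ absurd hm h
    · filter_upwards [eventually_generic hm] with κ hκ _ using hκ
  filter_upwards [h] with κ hκ m hm
  refine Finsupp.mapDomain_apply' (f.coeff.support : Set M) f.coeff subset_rfl ?_ hm
  intro x hx y hy hxy
  by_contra hne
  exact hκ x hx y hy (sub_ne_zero.2 hne) (by rw [map_sub]; exact sub_eq_zero.2 hxy)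

theorem eventually_mapDomain_ne_zero {f : ℤ[M]} (hf : f ≠ 0) : ∀ᶠ κ : M →ₗ[ℤ] ℤ in generic M,
    AddMonoidAlgebra.mapDomainRingHom ℤ (κ : M →+ ℤ) f ≠ 0 := by
  obtain ⟨m, hm⟩ := Finsupp.support_nonempty_iff.2 fun h ↦ hf (AddMonoidAlgebra.coeff_injective h)
  filter_upwards [eventually_coeff_mapDomain f] with κ hκ h0
  have := hκ m hm
  rw [h0] at this
  exact Finsupp.mem_support_iff.1 hm this.symm

theorem single_zero_dvd_of_forall_dvd_coeff {N : Type*} [AddCommGroup N] {c : ℤ} {f : ℤ[N]}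
    (h : ∀ m, c ∣ f.coeff m) : AddMonoidAlgebra.single 0 c ∣ f := by
  classical
  have h1 : f = f.coeff.sum fun m r ↦ AddMonoidAlgebra.single m r := by
    apply AddMonoidAlgebra.coeff_injective
    ext x
    rw [Finsupp.sum, AddMonoidAlgebra.coeff_sum, Finsupp.finsetSum_apply]
    simp only [AddMonoidAlgebra.coeff_single, Finsupp.single_apply, Finset.sum_ite_eq',
      Finsupp.mem_support_iff]
    split_ifs with hx
    · rfl
    · exact not_not.1 hx
  rw [h1]
  refine Finset.dvd_sum fun m _ ↦ ?_
  obtain ⟨b, hb⟩ := h m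
  exact ⟨AddMonoidAlgebra.single m b, by
    rw [AddMonoidAlgebra.single_mul_single, zero_add]; exact congrArg _ hb⟩

theorem dvd_coeff_of_single_zero_dvd {N : Type*} [AddCommGroup N] {c : ℤ} {f : ℤ[N]}
    (h : AddMonoidAlgebra.single 0 c ∣ f) (m : N) : c ∣ f.coeff m := by
  obtain ⟨g, rfl⟩ := h
  rw [coeff_single_mul_eq]
  exact dvd_mul_right _ _

theorem eventually_eq_prod_cyclotomic {q : ι → ℤ[M]} (hq : ∀ π, (∀ j, π ∣ q j) → IsUnit π) :
    ∀ᶠ κ : M →ₗ[ℤ] ℤ in generic M, ∀ e : LaurentPolynomial ℤ,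
      (∀ j, e ∣ AddMonoidAlgebra.mapDomainRingHom ℤ (κ : M →+ ℤ) (q j)) →
      ∃ (s : Multiset ℕ) (u : (LaurentPolynomial ℤ)ˣ), (∀ m ∈ s, 0 < m) ∧
        e = u * (s.map fun m ↦ Polynomial.toLaurent (Polynomial.cyclotomic m ℤ)).prod := by
  obtain ⟨j₀, hj₀⟩ : ∃ j, q j ≠ 0 := by
    by_contra! h
    exact not_isUnit_zero (hq 0 fun j ↦ by rw [h j])
  set I : Ideal ℚ[M] :=
    Ideal.span (Set.range fun j ↦ AddMonoidAlgebra.mapRingHom M (algebraMap ℤ ℚ) (q j)) with hI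
  have hgn := genericallyNonvanishing M I fun D hD ↦
    isUnit_of_forall_dvd_mapRingHom hq fun j ↦ hD _ (Ideal.subset_span ⟨j, rfl⟩)
  filter_upwards [hgn, eventually_mapDomain_ne_zero hj₀,
    eventually_all.2 fun j ↦ eventually_coeff_mapDomain (q j)] with κ hκ hκ0 hκc e he
  refine exists_eq_prod_cyclotomic (ne_zero_of_dvd_ne_zero hκ0 (he j₀)) ?_ ?_
  · intro ℓ hℓ hdvd
    have hu : IsUnit (AddMonoidAlgebra.single (0 : M) (ℓ : ℤ)) := by
      refine hq _ fun j ↦ single_zero_dvd_of_forall_dvd_coeff fun m ↦ ?_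
      by_cases hm : m ∈ (q j).coeff.support
      · rw [← hκc j m hm]
        exact dvd_coeff_of_single_zero_dvd (hdvd.trans (he j)) _
      · rw [Finsupp.notMem_support_iff.1 hm]
        exact dvd_zero _
    have h1 := dvd_coeff_of_single_zero_dvd hu.dvd (f := AddMonoidAlgebra.single 0 1) 0
    rw [AddMonoidAlgebra.coeff_single, Finsupp.single_eq_same] at h1
    exact hℓ.one_lt.ne' (by exact_mod_cast Int.eq_one_of_dvd_one (by positivity) h1)
  · intro α hα
    by_contra hfin
    obtain ⟨g, hg, hg0⟩ := hκ α hfin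
    refine hg0 ?_
    have : I ≤ RingHom.ker (evalAt ℚ κ α) := by
      rw [hI, Ideal.span_le]
      rintro _ ⟨j, rfl⟩
      change evalAt ℚ κ α (AddMonoidAlgebra.mapRingHom M (algebraMap ℤ ℚ) (q j)) = 0
      rw [evalAt_mapRingHom]
      have h1 := map_dvd (evalAt ℤ LinearMap.id α) (he j)
      rw [hα, zero_dvd_iff, evalAt_mapDomainRingHom, LinearMap.id_comp] at h1
      exact h1
    exact this hg

end Specialization

theorem exists_lt_gaugeVec_of_eventually_generic {n : ℕ} {P : ((Fin n → ℤ) →ₗ[ℤ] ℤ) → Prop}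
    (hP : ∀ᶠ κ in generic (Fin n → ℤ), P κ) :
    ∃ C : ℝ, ∀ k : Fin n → ℤ, C < gaugeVec k → P (dotHom k).toIntLinearMap := by
  obtain ⟨s, hs, h⟩ := exists_finset_of_eventually_generic hP
  refine ⟨∑ b ∈ s, √(∑ i, (b i : ℝ) ^ 2), fun k hk ↦ h _ fun b hb hbk ↦ hk.not_ge ?_⟩
  have h1 : gaugeVec k ≤ √(∑ i, (b i : ℝ) ^ 2) :=
    csInf_le ⟨0, by rintro _ ⟨m, -, -, rfl⟩; exact Real.sqrt_nonneg _⟩ ⟨b, hs b hb, hbk, rfl⟩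
  exact h1.trans (Finset.single_le_sum (f := fun b : Fin n → ℤ ↦ √(∑ i, (b i : ℝ) ^ 2))
    (fun b _ ↦ Real.sqrt_nonneg _) hb)

end

end

theorem statement18 {n : ℕ} (hn : 2 ≤ n) (ℓ : ℕ) (p : Fin ℓ → RL n) :
    ∃ C : ℝ, ∀ k : Fin n → ℤ, C < gaugeVec k →
      ∀ Dg : RL n, IsGCDOf Dg (Set.range p) →
      ∀ dg : LaurentPolynomial ℤ, IsGCDOf dg (Set.range fun j => tau k (p j)) →
      ∃ (s : Multiset ℕ) (u : (LaurentPolynomial ℤ)ˣ), (∀ m ∈ s, 0 < m) ∧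
        dg = (u : LaurentPolynomial ℤ) *
          (s.map fun m => Polynomial.toLaurent (Polynomial.cyclotomic m ℤ)).prod *
          tau k Dg := by
  by_cases hD : ∃ D : RL n, D ≠ 0 ∧ IsGCDOf D (Set.range p)
  · obtain ⟨D, hD0, hDdvd, hDgcd⟩ := hD
    choose q hq using fun j ↦ hDdvd _ ⟨j, rfl⟩
    have hqu : ∀ π, (∀ j, π ∣ q j) → IsUnit π := fun π hπ ↦ by
      have h1 : D * π ∣ D * 1 := by
        rw [mul_one]
        refine hDgcd _ ?_
        rintro _ ⟨j, rfl⟩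
        rw [hq j]
        exact mul_dvd_mul_left D (hπ j)
      exact isUnit_of_dvd_one ((mul_dvd_mul_iff_left hD0).1 h1)
    obtain ⟨C, hC⟩ := exists_lt_gaugeVec_of_eventually_generic
      ((eventually_eq_prod_cyclotomic hqu).and (eventually_mapDomain_ne_zero hD0))
    refine ⟨C, fun k hk Dg hDg dg hdg ↦ ?_⟩
    obtain ⟨hcyc, hτ0⟩ := hC k hk
    have hτ0' : tau k D ≠ 0 := hτ0
    obtain ⟨w, hw⟩ : Associated Dg D :=
      associated_of_dvd_dvd (hDgcd Dg hDg.1) (hDg.2 D hDdvd)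
    obtain ⟨e, he⟩ : tau k D ∣ dg := by
      refine hdg.2 _ ?_
      rintro _ ⟨j, rfl⟩
      exact map_dvd (tau k) (hDdvd _ ⟨j, rfl⟩)
    obtain ⟨s, u, hs, hsu⟩ := hcyc e fun j ↦ by
      have h1 := hdg.1 _ ⟨j, rfl⟩
      simp only at h1
      rw [he, hq j, map_mul] at h1
      exact (mul_dvd_mul_iff_left hτ0').1 h1
    refine ⟨s, u * Units.map (tau k).toMonoidHom w, hs, ?_⟩
    rw [he, hsu, ← hw, map_mul, Units.val_mul]
    change _ * tau k w * _ = _ * tau k w * _ * _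
    ring
  · refine ⟨0, fun k _ Dg hDg dg hdg ↦ ⟨0, 1, by simp, ?_⟩⟩
    have hDg0 : Dg = 0 := not_not.1 fun h ↦ hD ⟨Dg, h, hDg⟩
    have : dg = 0 := by
      refine zero_dvd_iff.1 (hdg.2 0 ?_)
      rintro _ ⟨j, rfl⟩
      have := hDg.1 _ ⟨j, rfl⟩
      rw [hDg0, zero_dvd_iff] at this
      simp [this]
    rw [this, hDg0, map_zero, mul_zero]

end
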